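/- Let K/k be an imaginary geometric Artin-Schreier extension of k = F_q(t) with normalized D = Σ D_i + f, ramified finite primes P_1, ..., P_m. Define the Rédei matrix R ∈ M_{m×m}(F_p) by R_{ij} = {D_j/P_i} (Hasse symbol) for i ≠ j and R_{ii} determined by Σ_j R_{ij} + {f/P_i} = 0. Then λ_2 := dim_{F_p}((σ−1)Cl(K)_p/(σ−1)^2 Cl(K)_p) = m − rank(R). If K is real (f = 0, R_{ii} determined by Σ_j R_{ij} = 0), then λ_2 = m − 1 − rank(R). -/

import Mathlib

open scoped nonZeroDivisors

set_option synthInstance.maxHeartbeats 1000000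
set_option maxHeartbeats 4000000
set_option linter.unusedSectionVars false

namespace RedeiReichardt

open Polynomial UniqueFactorizationMonoid

section EulerProduct

variable (F : Type*) [Field F] [Fintype F]

theorem finite_monicsOfDegree (n : ℕ) : {b : F[X] | b.Monic ∧ b.natDegree = n}.Finite := by
  have : Finite (degreeLT F (n + 1)) := Finite.of_equiv _ (degreeLTEquiv F (n + 1)).symm.toEquiv
  refine Set.Finite.subset (Set.toFinite (degreeLT F (n + 1) : Set F[X])) ?_
  rintro b ⟨-, hb⟩
  rw [SetLike.mem_coe, mem_degreeLT]
  exact lt_of_le_of_lt degree_le_natDegree (by rw [hb]; exact_mod_cast Nat.lt_succ_self n)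

/-- The finite set of monic polynomials of degree `n`. -/
noncomputable def monicsOfDegree (n : ℕ) : Finset F[X] := (finite_monicsOfDegree F n).toFinset

variable {F}

@[simp]
theorem mem_monicsOfDegree {n : ℕ} {b : F[X]} :
    b ∈ monicsOfDegree F n ↔ b.Monic ∧ b.natDegree = n := by
  simp [monicsOfDegree]

open Classical in
variable (F) in
/-- Pairs `(Q, k)` with `Q` monic irreducible, `k ≥ 1` and `k * deg Q = n`. -/
noncomputable def primePowersOfDegree (n : ℕ) : Finset (F[X] × ℕ) :=
  (((Finset.range (n + 1)).biUnion (monicsOfDegree F)) ×ˢ Finset.Icc 1 n).filter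
    fun x ↦ Irreducible x.1 ∧ x.2 * x.1.natDegree = n

theorem mem_primePowersOfDegree {n : ℕ} {x : F[X] × ℕ} :
    x ∈ primePowersOfDegree F n ↔
      x.1.Monic ∧ Irreducible x.1 ∧ 1 ≤ x.2 ∧ x.2 * x.1.natDegree = n := by
  simp only [primePowersOfDegree, Finset.mem_filter, Finset.mem_product, Finset.mem_biUnion,
    Finset.mem_range, mem_monicsOfDegree, Finset.mem_Icc]
  constructor
  · rintro ⟨⟨⟨d, -, hm, -⟩, h1, -⟩, h2, h3⟩
    exact ⟨hm, h2, h1, h3⟩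
  · rintro ⟨hm, hi, h1, h3⟩
    have := hi.natDegree_pos
    refine ⟨⟨⟨_, ?_, hm, rfl⟩, h1, ?_⟩, hi, h3⟩ <;> nlinarith

/-- The L-series of a function on monic polynomials. -/
noncomputable def lSeries (χ : F[X] → ℂ) : PowerSeries ℂ :=
  PowerSeries.mk fun n ↦ ∑ b ∈ monicsOfDegree F n, χ b

/-- The logarithmic derivative series of an Euler product. -/
noncomputable def logSeries (χ : F[X] → ℂ) : PowerSeries ℂ :=
  PowerSeries.mk fun n ↦ ∑ x ∈ primePowersOfDegree F n, (x.1.natDegree : ℂ) * χ x.1 ^ x.2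

open Classical in
theorem natDegree_eq_sum_primePowers {b : F[X]} (hb : b.Monic) :
    b.natDegree = ∑ x ∈ ((Finset.range (b.natDegree + 1)).biUnion (primePowersOfDegree F)).filter
      (fun x ↦ x.1 ^ x.2 ∣ b), x.1.natDegree := by
  have hb0 : b ≠ 0 := hb.ne_zero
  have hprod : (normalizedFactors b).prod = b := by
    rw [prod_normalizedFactors_eq hb0, hb.normalize_eq_self]
  have hmonic : ∀ q ∈ normalizedFactors b, q.Monic := fun q hq ↦ by
    have h := normalize_normalized_factor q hq
    rw [← h]
    exact monic_normalize (irreducible_of_normalized_factor q hq).ne_zero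
  have hdeg : b.natDegree = ((normalizedFactors b).map natDegree).sum := by
    conv_lhs => rw [← hprod]
    rw [natDegree_multiset_prod_of_monic _ hmonic]
  refine hdeg.trans ?_
  rw [Finset.sum_multiset_map_count]
  have key : ∀ q ∈ (normalizedFactors b).toFinset, (normalizedFactors b).count q • q.natDegree =
      ∑ k ∈ Finset.Icc 1 ((normalizedFactors b).count q), q.natDegree := by
    intro q _
    simp
  rw [Finset.sum_congr rfl key, Finset.sum_sigma']
  refine Finset.sum_bij' (fun x _ ↦ (x.1, x.2)) (fun x _ ↦ ⟨x.1, x.2⟩) ?_ ?_ ?_ ?_ ?_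
  · rintro ⟨q, k⟩ h
    simp only [Finset.mem_sigma, Multiset.mem_toFinset, Finset.mem_Icc] at h
    obtain ⟨hq, h1, h2⟩ := h
    have hqi := irreducible_of_normalized_factor q hq
    have hdvd : q ^ k ∣ b := by
      rw [pow_dvd_iff_le_emultiplicity, emultiplicity_eq_count_normalizedFactors hqi hb0,
        normalize_normalized_factor q hq]
      exact_mod_cast h2
    simp only [Finset.mem_filter, Finset.mem_biUnion, Finset.mem_range]
    refine ⟨⟨k * q.natDegree, ?_, mem_primePowersOfDegree.2 ⟨hmonic q hq, hqi, h1, rfl⟩⟩, hdvd⟩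
    have := natDegree_le_of_dvd hdvd hb0
    rw [natDegree_pow] at this
    omega
  · rintro ⟨q, k⟩ h
    simp only [Finset.mem_filter, Finset.mem_biUnion, Finset.mem_range] at h
    obtain ⟨⟨i, -, hi⟩, hdvd⟩ := h
    obtain ⟨hm, hqi, h1, -⟩ := mem_primePowersOfDegree.1 hi
    simp only at hm hqi h1
    have hle : k ≤ (normalizedFactors b).count q := by
      rw [pow_dvd_iff_le_emultiplicity, emultiplicity_eq_count_normalizedFactors hqi hb0,
        hm.normalize_eq_self] at hdvd
      exact_mod_cast hdvd
    simp only [Finset.mem_sigma, Multiset.mem_toFinset, Finset.mem_Icc]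
    exact ⟨Multiset.count_pos.1 (by omega), h1, hle⟩
  · intros; rfl
  · intros; rfl
  · intros; rfl

open Classical in
theorem X_mul_derivative_lSeries (χ : F[X] → ℂ)
    (hmul : ∀ b c : F[X], b.Monic → c.Monic → χ (b * c) = χ b * χ c) (h1 : χ 1 = 1) :
    PowerSeries.X * PowerSeries.derivative ℂ (lSeries χ) = logSeries χ * lSeries χ := by
  have hpow : ∀ (b : F[X]) (k : ℕ), b.Monic → χ (b ^ k) = χ b ^ k := by
    intro b k hb
    induction k with
    | zero => simp [h1]
    | succ k ih => rw [pow_succ, hmul _ _ (hb.pow k) hb, ih, pow_succ]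
  ext n
  have hl : PowerSeries.coeff n (PowerSeries.X * PowerSeries.derivative ℂ (lSeries χ)) =
      ∑ b ∈ monicsOfDegree F n, (n : ℂ) * χ b := by
    cases n with
    | zero => simp
    | succ n =>
      rw [PowerSeries.coeff_succ_X_mul, PowerSeries.coeff_derivative, lSeries,
        PowerSeries.coeff_mk, Finset.sum_mul]
      exact Finset.sum_congr rfl fun b _ ↦ by push_cast; ring
  have hr : PowerSeries.coeff n (logSeries χ * lSeries χ) =
      ∑ i ∈ Finset.range (n + 1), ∑ x ∈ primePowersOfDegree F i,
        ∑ c ∈ monicsOfDegree F (n - i), (x.1.natDegree : ℂ) * χ x.1 ^ x.2 * χ c := by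
    rw [PowerSeries.coeff_mul, Finset.Nat.sum_antidiagonal_eq_sum_range_succ
      (fun i j ↦ PowerSeries.coeff i (logSeries χ) * PowerSeries.coeff j (lSeries χ))]
    refine Finset.sum_congr rfl fun i _ ↦ ?_
    simp only [logSeries, lSeries, PowerSeries.coeff_mk]
    rw [Finset.sum_mul_sum]
  rw [hl, hr]
  have h2 : ∀ b ∈ monicsOfDegree F n, (n : ℂ) * χ b =
      ∑ x ∈ (Finset.range (n + 1)).biUnion (primePowersOfDegree F),
        if x.1 ^ x.2 ∣ b then (x.1.natDegree : ℂ) * χ b else 0 := by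
    intro b hb
    obtain ⟨hbm, hbn⟩ := mem_monicsOfDegree.1 hb
    have := natDegree_eq_sum_primePowers hbm
    rw [hbn] at this
    rw [← Finset.sum_filter, ← Finset.sum_mul]
    congr 1
    exact_mod_cast this
  rw [Finset.sum_congr rfl h2, Finset.sum_comm, Finset.sum_biUnion]
  · refine Finset.sum_congr rfl fun i hi ↦ Finset.sum_congr rfl fun x hx ↦ ?_
    obtain ⟨hm, hq, hk, hd⟩ := mem_primePowersOfDegree.1 hx
    have hi' : i ≤ n := by simpa [Nat.lt_succ_iff] using hi
    have hxm : (x.1 ^ x.2).Monic := hm.pow _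
    have hxd : (x.1 ^ x.2).natDegree = i := by rw [hm.natDegree_pow, hd]
    rw [← Finset.sum_filter]
    symm
    refine Finset.sum_bij (fun c _ ↦ x.1 ^ x.2 * c) ?_ ?_ ?_ ?_
    · intro c hc
      obtain ⟨hcm, hcd⟩ := mem_monicsOfDegree.1 hc
      simp only [Finset.mem_filter, mem_monicsOfDegree]
      refine ⟨⟨hxm.mul hcm, ?_⟩, dvd_mul_right _ _⟩
      rw [hxm.natDegree_mul hcm, hxd, hcd]
      omega
    · intro c _ c' _ h
      exact mul_left_cancel₀ hxm.ne_zero h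
    · intro b hb
      simp only [Finset.mem_filter, mem_monicsOfDegree] at hb
      obtain ⟨⟨hbm, hbd⟩, c, rfl⟩ := hb
      have hcm : c.Monic := hxm.of_mul_monic_left hbm
      refine ⟨c, mem_monicsOfDegree.2 ⟨hcm, ?_⟩, rfl⟩
      rw [hxm.natDegree_mul hcm, hxd] at hbd
      omega
    · intro c hc
      obtain ⟨hcm, hcd⟩ := mem_monicsOfDegree.1 hc
      rw [hmul _ _ hxm hcm, hpow _ _ hm]
      ring
  · intro i _ j _ hij
    rw [Function.onFun, Finset.disjoint_left]
    intro x hx hx'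
    exact hij ((mem_primePowersOfDegree.1 hx).2.2.2.symm.trans
      (mem_primePowersOfDegree.1 hx').2.2.2)

theorem constantCoeff_lSeries {χ : F[X] → ℂ} (h1 : χ 1 = 1) :
    PowerSeries.constantCoeff (lSeries χ) = 1 := by
  rw [← PowerSeries.coeff_zero_eq_constantCoeff_apply, lSeries, PowerSeries.coeff_mk]
  have : monicsOfDegree F 0 = {1} := by
    ext b
    rw [mem_monicsOfDegree, Finset.mem_singleton]
    constructor
    · rintro ⟨hb, h0⟩
      exact hb.natDegree_eq_zero.1 h0
    · rintro rfl
      simp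
  simp [this, h1]

theorem X_mul_derivative_prod_lSeries {ι : Type*} (s : Finset ι) (χ : ι → F[X] → ℂ)
    (hmul : ∀ a, ∀ b c : F[X], b.Monic → c.Monic → χ a (b * c) = χ a b * χ a c)
    (h1 : ∀ a, χ a 1 = 1) :
    PowerSeries.X * PowerSeries.derivative ℂ (∏ a ∈ s, lSeries (χ a)) =
      (∑ a ∈ s, logSeries (χ a)) * ∏ a ∈ s, lSeries (χ a) := by
  classical
  induction s using Finset.induction_on with
  | empty => simp
  | insert a s ha ih =>
    rw [Finset.prod_insert ha, Finset.sum_insert ha, Derivation.leibniz, smul_eq_mul, smul_eq_mul]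
    linear_combination lSeries (χ a) * ih +
      (∏ a ∈ s, lSeries (χ a)) * X_mul_derivative_lSeries (χ a) (hmul a) (h1 a)

open scoped ComplexOrder in
theorem complex_nonneg_of_mul_nonneg {a x : ℂ} (ha : 0 < a) (h : 0 ≤ a * x) : 0 ≤ x := by
  rw [Complex.pos_iff] at ha
  rw [Complex.nonneg_iff] at h ⊢
  rw [Complex.mul_re, Complex.mul_im, ← ha.2] at h
  simp only [zero_mul, sub_zero, add_zero] at h
  exact ⟨nonneg_of_mul_nonneg_right h.1 ha.1,
    ((mul_eq_zero.1 h.2.symm).resolve_left ha.1.ne').symm⟩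


open scoped ComplexOrder in
/-- If the power sums of the local parameters of a finite family of characters are nonnegative,
then the product of their L-series has no shape `g / (1 - z X)` with `g` a polynomial, unless
`z > 0`. -/
theorem prod_lSeries_mul_ne_coe {ι : Type*} [Fintype ι] (χ : ι → F[X] → ℂ)
    (hmul : ∀ a, ∀ b c : F[X], b.Monic → c.Monic → χ a (b * c) = χ a b * χ a c)
    (h1 : ∀ a, χ a 1 = 1)
    (hnonneg : ∀ (Q : F[X]) (k : ℕ), Q.Monic → Irreducible Q → 0 ≤ ∑ a, χ a Q ^ k)
    (hpos : ∃ (Q : F[X]) (d : ℕ), Q.Monic ∧ Irreducible Q ∧ 0 < d ∧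
      ∀ k : ℕ, 0 < ∑ a, χ a Q ^ (d * k))
    (z : ℂ) (hz : ¬ 0 < z) (g : ℂ[X]) :
    (∏ a, lSeries (χ a)) * (1 - PowerSeries.C z * PowerSeries.X) ≠ (g : PowerSeries ℂ) := by
  intro h
  set H : PowerSeries ℂ := ∏ a, lSeries (χ a) with hH
  set S : PowerSeries ℂ := ∑ a, logSeries (χ a) with hS
  have hHS : PowerSeries.X * PowerSeries.derivative ℂ H = S * H :=
    X_mul_derivative_prod_lSeries _ χ hmul h1
  have hScoeff : ∀ n, PowerSeries.coeff n S =
      ∑ x ∈ primePowersOfDegree F n, (x.1.natDegree : ℂ) * ∑ a, χ a x.1 ^ x.2 := by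
    intro n
    simp only [hS, map_sum, logSeries, PowerSeries.coeff_mk, Finset.mul_sum]
    rw [Finset.sum_comm]
  have hSnonneg : ∀ n, 0 ≤ PowerSeries.coeff n S := by
    intro n
    rw [hScoeff]
    refine Finset.sum_nonneg fun x hx ↦ ?_
    obtain ⟨hm, hq, -, -⟩ := mem_primePowersOfDegree.1 hx
    exact mul_nonneg (Nat.cast_nonneg _) (hnonneg _ _ hm hq)
  have hH0 : PowerSeries.coeff 0 H = 1 := by
    rw [PowerSeries.coeff_zero_eq_constantCoeff_apply, hH, map_prod]
    exact Finset.prod_eq_one fun a _ ↦ constantCoeff_lSeries (h1 a)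
  have hrec : ∀ n : ℕ, (n : ℂ) * PowerSeries.coeff n H =
      ∑ x ∈ Finset.HasAntidiagonal.antidiagonal n,
        PowerSeries.coeff x.1 S * PowerSeries.coeff x.2 H := by
    intro n
    rw [← PowerSeries.coeff_mul, ← hHS]
    cases n with
    | zero => simp
    | succ n =>
      rw [PowerSeries.coeff_succ_X_mul, PowerSeries.coeff_derivative]
      push_cast
      ring
  have hS0 : PowerSeries.coeff 0 S = 0 := by
    have := hrec 0
    simpa [hH0] using this.symm
  have hHnonneg : ∀ n, 0 ≤ PowerSeries.coeff n H := by
    intro n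
    induction n using Nat.strong_induction_on with
    | _ n ih =>
      rcases Nat.eq_zero_or_pos n with rfl | hn
      · rw [hH0]; exact zero_le_one
      · have hn' : (0 : ℂ) < n := by exact_mod_cast hn
        have : 0 ≤ (n : ℂ) * PowerSeries.coeff n H := by
          rw [hrec]
          refine Finset.sum_nonneg fun x hx ↦ ?_
          rw [Finset.HasAntidiagonal.mem_antidiagonal] at hx
          rcases Nat.eq_zero_or_pos x.1 with h0 | h0
          · rw [h0, hS0, zero_mul]
          · exact mul_nonneg (hSnonneg _) (ih _ (by omega))
        exact complex_nonneg_of_mul_nonneg hn' this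
  obtain ⟨Q, d, hQm, hQi, hd, hQpos⟩ := hpos
  have hHpos : ∀ k, 1 ≤ k → 0 < PowerSeries.coeff (d * k * Q.natDegree) H := by
    intro k hk
    have hn0 : 0 < d * k * Q.natDegree := by
      have := hQi.natDegree_pos
      positivity
    set n := d * k * Q.natDegree
    have hn' : (0 : ℂ) < n := by exact_mod_cast hn0
    have hSn : 0 < PowerSeries.coeff n S := by
      rw [hScoeff]
      refine Finset.sum_pos' (fun x hx ↦ ?_) ⟨(Q, d * k), mem_primePowersOfDegree.2
        ⟨hQm, hQi, Nat.one_le_iff_ne_zero.2 (by positivity), rfl⟩, ?_⟩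
      · obtain ⟨hm, hq, -, -⟩ := mem_primePowersOfDegree.1 hx
        exact mul_nonneg (Nat.cast_nonneg _) (hnonneg _ _ hm hq)
      · exact mul_pos (by exact_mod_cast hQi.natDegree_pos) (hQpos k)
    have : 0 < (n : ℂ) * PowerSeries.coeff n H := by
      rw [hrec]
      refine Finset.sum_pos' (fun x _ ↦ mul_nonneg (hSnonneg _) (hHnonneg _))
        ⟨(n, 0), by simp, ?_⟩
      simpa [hH0] using hSn
    refine lt_of_le_of_ne (hHnonneg n) fun h0 ↦ ?_
    rw [← h0, mul_zero] at this
    exact lt_irrefl _ this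
  have hlin : ∀ n, g.natDegree < n + 1 →
      PowerSeries.coeff (n + 1) H = z * PowerSeries.coeff n H := by
    intro n hn
    have := congrArg (PowerSeries.coeff (n + 1)) h
    rw [mul_sub, mul_one, map_sub, mul_left_comm, PowerSeries.coeff_C_mul,
      PowerSeries.coeff_succ_mul_X, Polynomial.coeff_coe, coeff_eq_zero_of_natDegree_lt hn] at this
    exact sub_eq_zero.1 this
  set k := g.natDegree + 1 with hk
  have hQd := hQi.natDegree_pos
  set n := d * k * Q.natDegree with hn
  have hnk : k ≤ n := by
    rw [hn]
    calc k = 1 * k * 1 := by ring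
      _ ≤ _ := by gcongr <;> omega
  have hz0 : 0 ≤ z := by
    have h2 := hHnonneg (n + 1)
    rw [hlin n (by omega), mul_comm] at h2
    exact complex_nonneg_of_mul_nonneg (hHpos k (by omega)) h2
  have hz1 : z = 0 := by
    by_contra hne
    exact hz (lt_of_le_of_ne hz0 (Ne.symm hne))
  have h3 := hHpos (k + 1) (by omega)
  have h4 : d * (k + 1) * Q.natDegree = (d * (k + 1) * Q.natDegree - 1) + 1 := by
    have : 0 < d * (k + 1) * Q.natDegree := by positivity
    omega
  have h5 : n < d * (k + 1) * Q.natDegree := by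
    rw [hn]
    gcongr
    omega
  rw [h4, hlin _ (by omega), hz1, zero_mul] at h3
  exact lt_irrefl _ h3

end EulerProduct

section Residues

open Polynomial

variable {F : Type*} [Field F]

/-- The coefficient of `X⁻¹` in the expansion of a rational function at infinity. -/
noncomputable def coeffInvX (h : RatFunc F) : F := (h.num %ₘ h.denom).coeff (h.denom.natDegree - 1)

theorem mul_modByMonic_mul (N : F[X]) {E G : F[X]} (hE : E.Monic) (hG : G.Monic) :
    (N * G) %ₘ (E * G) = (N %ₘ E) * G := by
  refine (div_modByMonic_unique (N /ₘ E) _ (hE.mul hG) ⟨?_, ?_⟩).2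
  · linear_combination G * modByMonic_add_div N E
  · rw [degree_mul, degree_mul]
    have := degree_modByMonic_lt N hE
    have hG0 : G.degree ≠ ⊥ := degree_ne_bot.2 hG.ne_zero
    exact WithBot.add_lt_add_right hG0 this

theorem coeffInvX_div (N : F[X]) {E : F[X]} (hE : E.Monic) :
    coeffInvX (algebraMap F[X] (RatFunc F) N / algebraMap F[X] (RatFunc F) E) =
      (N %ₘ E).coeff (E.natDegree - 1) := by
  set h := algebraMap F[X] (RatFunc F) N / algebraMap F[X] (RatFunc F) E with hh
  have hE0 : algebraMap F[X] (RatFunc F) E ≠ 0 := by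
    simpa using hE.ne_zero
  have hd0 : algebraMap F[X] (RatFunc F) h.denom ≠ 0 := by
    simpa using h.denom_ne_zero
  have h1 : N * h.denom = h.num * E := by
    apply RatFunc.algebraMap_injective F
    rw [map_mul, map_mul]
    have := RatFunc.num_div_denom h
    rw [div_eq_iff hd0] at this
    rw [this, hh]
    field_simp
  have hdm := RatFunc.monic_denom h
  have key : ∀ (N E G : F[X]), E.Monic → G.Monic →
      ((N * G) %ₘ (E * G)).coeff ((E * G).natDegree - 1) = (N %ₘ E).coeff (E.natDegree - 1) := by
    intro N E G hE hG
    rw [mul_modByMonic_mul N hE hG, hE.natDegree_mul hG]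
    by_cases hE1 : E.natDegree = 0
    · rw [hE.natDegree_eq_zero.1 hE1]; simp
    · have : E.natDegree + G.natDegree - 1 = (E.natDegree - 1) + G.natDegree := by omega
      rw [this, coeff_mul_add_eq_of_natDegree_le (df := E.natDegree - 1) _ le_rfl,
        hG.coeff_natDegree, mul_one]
      have := natDegree_modByMonic_lt N hE (fun h ↦ hE1 (by simp [h]))
      omega
  rw [coeffInvX, ← key h.num h.denom E hdm hE, ← key N E h.denom hE hdm, h1, mul_comm E]

theorem exists_eq_div_monic (h : RatFunc F) : ∃ N E : F[X], E.Monic ∧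
    h = algebraMap F[X] (RatFunc F) N / algebraMap F[X] (RatFunc F) E :=
  ⟨h.num, h.denom, h.monic_denom, (RatFunc.num_div_denom h).symm⟩

theorem algebraMap_ratFunc_ne_zero {a : F[X]} (h : a ≠ 0) : algebraMap F[X] (RatFunc F) a ≠ 0 := by
  simpa using h

theorem coeffInvX_add (g h : RatFunc F) : coeffInvX (g + h) = coeffInvX g + coeffInvX h := by
  obtain ⟨N, E, hE, rfl⟩ := exists_eq_div_monic g
  obtain ⟨N', E', hE', rfl⟩ := exists_eq_div_monic h
  have h1 := algebraMap_ratFunc_ne_zero hE.ne_zero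
  have h2 := algebraMap_ratFunc_ne_zero hE'.ne_zero
  rw [show algebraMap F[X] (RatFunc F) N / algebraMap F[X] (RatFunc F) E =
    algebraMap F[X] (RatFunc F) (N * E') / algebraMap F[X] (RatFunc F) (E * E') by
      simp only [map_mul]; field_simp,
    show algebraMap F[X] (RatFunc F) N' / algebraMap F[X] (RatFunc F) E' =
    algebraMap F[X] (RatFunc F) (N' * E) / algebraMap F[X] (RatFunc F) (E * E') by
      simp only [map_mul]; field_simp, ← add_div, ← map_add,
    coeffInvX_div _ (hE.mul hE'), coeffInvX_div _ (hE.mul hE'), coeffInvX_div _ (hE.mul hE'),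
    add_modByMonic, coeff_add]

theorem coeffInvX_smul (c : F) (h : RatFunc F) : coeffInvX (c • h) = c • coeffInvX h := by
  obtain ⟨N, E, hE, rfl⟩ := exists_eq_div_monic h
  rw [← smul_div_assoc, show c • algebraMap F[X] (RatFunc F) N = algebraMap F[X] (RatFunc F) (c • N)
    by rw [Polynomial.smul_eq_C_mul, map_mul, Algebra.smul_def]; rfl, coeffInvX_div _ hE,
    coeffInvX_div _ hE, smul_modByMonic, coeff_smul]

/-- The coefficient of `X⁻¹` at infinity, as a linear form. -/
noncomputable def coeffInv : RatFunc F →ₗ[F] F where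
  toFun := coeffInvX
  map_add' := coeffInvX_add
  map_smul' := coeffInvX_smul

theorem coeffInv_div (N : F[X]) {E : F[X]} (hE : E.Monic) :
    coeffInv (algebraMap F[X] (RatFunc F) N / algebraMap F[X] (RatFunc F) E) =
      (N %ₘ E).coeff (E.natDegree - 1) := coeffInvX_div N hE

theorem coeffInv_algebraMap (N : F[X]) : coeffInv (algebraMap F[X] (RatFunc F) N) = 0 := by
  have := coeffInv_div N (monic_one (R := F))
  simpa using this

/-- The monic irreducible polynomials, i.e. the finite places of `F(X)`. -/
abbrev FinitePlace (F : Type*) [Field F] := {P : F[X] // P.Monic ∧ Irreducible P}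

/-- The local ring of a finite place. -/
def localRing (P : FinitePlace F) : Subalgebra F[X] (RatFunc F) where
  carrier := {h | ∃ a b : F[X], ¬ P.1 ∣ b ∧ h * algebraMap F[X] (RatFunc F) b =
    algebraMap F[X] (RatFunc F) a}
  mul_mem' := by
    rintro g h ⟨a, b, hb, hg⟩ ⟨c, d, hd, hh⟩
    refine ⟨a * c, b * d, fun H ↦ (P.2.2.prime.dvd_or_dvd H).elim hb hd, ?_⟩
    rw [map_mul, map_mul, ← hg, ← hh]; ring
  add_mem' := by
    rintro g h ⟨a, b, hb, hg⟩ ⟨c, d, hd, hh⟩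
    refine ⟨a * d + c * b, b * d, fun H ↦ (P.2.2.prime.dvd_or_dvd H).elim hb hd, ?_⟩
    rw [map_mul, map_add, map_mul, map_mul, ← hg, ← hh]; ring
  algebraMap_mem' := fun a ↦ ⟨a, 1, fun H ↦ P.2.2.not_isUnit (isUnit_of_dvd_one H), by simp⟩

theorem mem_localRing {P : FinitePlace F} {h : RatFunc F} : h ∈ localRing P ↔
    ∃ a b : F[X], ¬ P.1 ∣ b ∧
      h * algebraMap F[X] (RatFunc F) b = algebraMap F[X] (RatFunc F) a := Iff.rfl

theorem inv_mem_localRing {P : FinitePlace F} {b : F[X]} (hb : ¬ P.1 ∣ b) :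
    (algebraMap F[X] (RatFunc F) b)⁻¹ ∈ localRing P :=
  ⟨1, b, hb, by
    rw [inv_mul_cancel₀, map_one]
    exact algebraMap_ratFunc_ne_zero (fun h ↦ hb (h ▸ dvd_zero _))⟩

theorem div_mem_localRing {P : FinitePlace F} (a : F[X]) {b : F[X]} (hb : ¬ P.1 ∣ b) :
    algebraMap F[X] (RatFunc F) a / algebraMap F[X] (RatFunc F) b ∈ localRing P := by
  rw [div_eq_mul_inv]
  exact mul_mem ((localRing P).algebraMap_mem a) (inv_mem_localRing hb)

theorem smul_mem_localRing {P : FinitePlace F} (c : F) {h : RatFunc F} (hh : h ∈ localRing P) :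
    c • h ∈ localRing P := by
  have : c • h = algebraMap F[X] (RatFunc F) (C c) * h := by
    rw [Algebra.smul_def]; rfl
  rw [this]
  exact mul_mem ((localRing P).algebraMap_mem _) hh

/-- The polar parts at a finite place. -/
def polarPart (P : FinitePlace F) : Submodule F (RatFunc F) where
  carrier := {h | ∃ (n : ℕ) (a : F[X]), a.degree < (P.1 ^ n).degree ∧
    h = algebraMap F[X] (RatFunc F) a / algebraMap F[X] (RatFunc F) (P.1 ^ n)}
  add_mem' := by
    rintro g h ⟨n, a, ha, rfl⟩ ⟨m, b, hb, rfl⟩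
    have hP := P.2.1.ne_zero
    have h1 := algebraMap_ratFunc_ne_zero (pow_ne_zero n hP)
    have h2 := algebraMap_ratFunc_ne_zero (pow_ne_zero m hP)
    refine ⟨n + m, a * P.1 ^ m + b * P.1 ^ n, ?_, ?_⟩
    · refine (degree_add_le _ _).trans_lt (max_lt ?_ ?_)
      · rw [pow_add, degree_mul, degree_mul]
        exact WithBot.add_lt_add_right (degree_ne_bot.2 (pow_ne_zero _ hP)) ha
      · rw [add_comm n, pow_add, degree_mul, degree_mul]
        exact WithBot.add_lt_add_right (degree_ne_bot.2 (pow_ne_zero _ hP)) hb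
    · rw [pow_add, map_add, map_mul, map_mul, map_mul]
      field_simp
  zero_mem' := ⟨0, 0, by simp, by simp⟩
  smul_mem' := by
    rintro c h ⟨n, a, ha, rfl⟩
    refine ⟨n, C c * a, ?_, ?_⟩
    · rw [← smul_eq_C_mul]
      exact (degree_smul_le _ _).trans_lt ha
    · rw [map_mul, mul_div_assoc, Algebra.smul_def]; rfl

theorem div_pow_mem_polarPart (P : FinitePlace F) {n : ℕ} {a : F[X]}
    (ha : a.degree < (P.1 ^ n).degree) :
    algebraMap F[X] (RatFunc F) a / algebraMap F[X] (RatFunc F) (P.1 ^ n) ∈ polarPart P :=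
  ⟨n, a, ha, rfl⟩

/-- The local ring of a finite place, as a space over the constants. -/
def localSpace (P : FinitePlace F) : Submodule F (RatFunc F) where
  carrier := localRing P
  add_mem' := add_mem
  zero_mem' := zero_mem (localRing P)
  smul_mem' := fun c _ ↦ smul_mem_localRing c

theorem exists_eq_div_pow_mul (P : FinitePlace F) (h : RatFunc F) : ∃ (n : ℕ) (N E : F[X]),
    ¬ P.1 ∣ E ∧ h = algebraMap F[X] (RatFunc F) N /
      (algebraMap F[X] (RatFunc F) (P.1 ^ n) * algebraMap F[X] (RatFunc F) E) := by
  obtain ⟨E, hE, hdvd⟩ := (FiniteMultiplicity.of_prime_left P.2.2.prime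
    h.denom_ne_zero).exists_eq_pow_mul_and_not_dvd
  refine ⟨multiplicity P.1 h.denom, h.num, E, hdvd, ?_⟩
  rw [← map_mul, ← hE, RatFunc.num_div_denom]

theorem isCompl_polarPart (P : FinitePlace F) : IsCompl (polarPart P) (localSpace P) := by
  constructor
  · rw [Submodule.disjoint_def]
    rintro x ⟨n, a, ha, rfl⟩ ⟨c, b, hb, h⟩
    have h1 := algebraMap_ratFunc_ne_zero (pow_ne_zero n P.2.1.ne_zero)
    have h2 : a * b = P.1 ^ n * c := by
      apply RatFunc.algebraMap_injective F
      rw [map_mul, map_mul, ← h]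
      field_simp
    have h3 : P.1 ^ n ∣ a := by
      refine IsCoprime.dvd_of_dvd_mul_right ?_ ⟨c, h2⟩
      exact ((P.2.2.coprime_iff_not_dvd).2 hb).pow_left
    rw [eq_zero_of_dvd_of_degree_lt h3 ha]
    simp
  · rw [codisjoint_iff, eq_top_iff]
    rintro h -
    obtain ⟨n, N, E, hE, rfl⟩ := exists_eq_div_pow_mul P h
    obtain ⟨u, v, huv⟩ : IsCoprime (P.1 ^ n) E := ((P.2.2.coprime_iff_not_dvd).2 hE).pow_left
    have hm : (P.1 ^ n).Monic := P.2.1.pow n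
    have h1 := algebraMap_ratFunc_ne_zero hm.ne_zero
    have h2 : algebraMap F[X] (RatFunc F) E ≠ 0 :=
      algebraMap_ratFunc_ne_zero (fun h ↦ hE (h ▸ dvd_zero _))
    refine Submodule.mem_sup.2 ⟨_, div_pow_mem_polarPart P (degree_modByMonic_lt (N * v) hm), _,
      (show algebraMap F[X] (RatFunc F) ((N * v) /ₘ (P.1 ^ n)) +
        algebraMap F[X] (RatFunc F) (u * N) / algebraMap F[X] (RatFunc F) E ∈ localRing P from
        add_mem ((localRing P).algebraMap_mem _) (div_mem_localRing _ hE)), ?_⟩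
    have h3 := modByMonic_add_div (N * v) (P.1 ^ n)
    have h4 := congrArg (algebraMap F[X] (RatFunc F)) h3
    have h5 := congrArg (algebraMap F[X] (RatFunc F)) huv
    simp only [map_add, map_mul, map_one] at h4 h5 ⊢
    field_simp
    linear_combination algebraMap F[X] (RatFunc F) E * h4 + algebraMap F[X] (RatFunc F) N * h5

/-- The residue of `h dX` at a finite place (more precisely its trace to the constants). -/
noncomputable def residue (P : FinitePlace F) : RatFunc F →ₗ[F] F :=
  coeffInv ∘ₗ (polarPart P).projection (localSpace P) (isCompl_polarPart P)

theorem residue_of_mem_localRing {P : FinitePlace F} {h : RatFunc F} (hh : h ∈ localRing P) :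
    residue P h = 0 := by
  rw [residue, LinearMap.comp_apply,
    (Submodule.projection_apply_eq_zero_iff (isCompl_polarPart P)).2 hh, map_zero]

theorem residue_of_mem_polarPart {P : FinitePlace F} {h : RatFunc F} (hh : h ∈ polarPart P) :
    residue P h = coeffInv h := by
  rw [residue, LinearMap.comp_apply, Submodule.projection_apply_of_mem_left _ hh]

theorem exists_polarPart_add (P : FinitePlace F) (h : RatFunc F) :
    ∃ u ∈ polarPart P, ∃ v ∈ localRing P, h = u + v ∧ residue P h = coeffInv u := by
  refine ⟨_, Submodule.projection_apply_mem (isCompl_polarPart P) h, _,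
    Submodule.sub_projection_mem (isCompl_polarPart P) h, (add_sub_cancel _ _).symm, rfl⟩

theorem mem_localRing_of_mem_polarPart {P Q : FinitePlace F} (hPQ : P ≠ Q) {h : RatFunc F}
    (hh : h ∈ polarPart P) : h ∈ localRing Q := by
  obtain ⟨n, a, ha, rfl⟩ := hh
  refine div_mem_localRing a fun H ↦ hPQ ?_
  have h1 := Q.2.2.prime.dvd_of_dvd_pow H
  have h2 := (Q.2.2.associated_of_dvd P.2.2 h1)
  exact Subtype.ext (eq_of_monic_of_associated Q.2.1 P.2.1 h2).symm

theorem exists_eq_algebraMap_of_mem_localRing {h : RatFunc F}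
    (hh : ∀ P : FinitePlace F, h ∈ localRing P) : ∃ a : F[X], h = algebraMap F[X] (RatFunc F) a := by
  by_cases hu : IsUnit h.denom
  · refine ⟨h.num, ?_⟩
    have := RatFunc.num_div_denom h
    rw [h.monic_denom.eq_one_of_isUnit hu, map_one, div_one] at this
    exact this.symm
  · obtain ⟨Q, hQm, hQi, hQ⟩ := exists_monic_irreducible_factor _ hu
    obtain ⟨a, b, hb, hab⟩ := hh ⟨Q, hQm, hQi⟩
    have hd0 := algebraMap_ratFunc_ne_zero h.denom_ne_zero
    have h1 : h.num * b = a * h.denom := by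
      apply RatFunc.algebraMap_injective F
      rw [map_mul, map_mul, ← hab]
      have := RatFunc.num_div_denom h
      rw [div_eq_iff hd0] at this
      rw [this]
      ring
    have h2 : Q ∣ h.num := (hQi.prime.dvd_or_dvd (h1 ▸ hQ.mul_left a)).resolve_right hb
    exact absurd (h.isCoprime_num_denom.isUnit_of_dvd' h2 hQ) hQi.not_isUnit

/-- The residue theorem on the projective line. -/
theorem coeffInv_eq_sum_residue (S : Finset (FinitePlace F)) (h : RatFunc F)
    (hh : ∀ P ∉ S, h ∈ localRing P) : coeffInv h = ∑ P ∈ S, residue P h := by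
  classical
  choose u hu v hv huv hr using fun P : FinitePlace F ↦ exists_polarPart_add P h
  obtain ⟨a, ha⟩ := exists_eq_algebraMap_of_mem_localRing (h := h - ∑ P ∈ S, u P) fun Q ↦ by
    by_cases hQ : Q ∈ S
    · rw [← Finset.add_sum_erase S u hQ, ← sub_sub]
      refine sub_mem ?_ (sum_mem fun P hP ↦
        mem_localRing_of_mem_polarPart (Finset.ne_of_mem_erase hP) (hu P))
      nth_rewrite 1 [huv Q]
      rw [add_sub_cancel_left]
      exact hv Q
    · refine sub_mem (hh Q hQ) (sum_mem fun P hP ↦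
        mem_localRing_of_mem_polarPart (fun H ↦ hQ (by rwa [← H])) (hu P))
  rw [sub_eq_iff_eq_add.1 ha, map_add, coeffInv_algebraMap, zero_add, map_sum]
  refine Finset.sum_congr rfl fun P _ ↦ ?_
  rw [← hr P, ← sub_eq_iff_eq_add.1 ha]

/-- A rational function vanishing to order at least `2` at infinity has no residue there. -/
theorem coeffInv_div_of_degree_lt (N : F[X]) {E : F[X]} (hE : E.Monic) 
    (h : N.natDegree + 1 < E.natDegree) :
    coeffInv (algebraMap F[X] (RatFunc F) N / algebraMap F[X] (RatFunc F) E) = 0 := by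
  rw [coeffInv_div N hE, (modByMonic_eq_self_iff hE).2 (degree_lt_degree (by omega))]
  exact coeff_eq_zero_of_natDegree_lt (by omega)

end Residues

section DerivationExtension

theorem exists_derivation_extend (R : Type*) {S : Type*} (T : Type*) [CommRing R] [CommRing S]
    [CommRing T] [Algebra R S] [Algebra S T] [Algebra R T] [IsScalarTower R S T]
    [Algebra.FormallyEtale S T] (d : Derivation R S S) :
    ∃ d' : Derivation R T T, ∀ s, d' (algebraMap S T s) = algebraMap S T (d s) := by
  let l := LinearMap.liftBaseChange T ((Algebra.linearMap S T) ∘ₗ d.liftKaehlerDifferential)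
  let e := KaehlerDifferential.tensorKaehlerEquivOfFormallyEtale R S T
  refine ⟨(l ∘ₗ e.symm.toLinearMap).compDer (KaehlerDifferential.D R T), fun s ↦ ?_⟩
  have : e.symm (KaehlerDifferential.D R T (algebraMap S T s)) =
    1 ⊗ₜ[S] KaehlerDifferential.D R S s :=
    KaehlerDifferential.tensorKaehlerEquivOfFormallyEtale_symm_D_algebraMap R S T s
  change l (e.symm (KaehlerDifferential.D R T (algebraMap S T s))) = _
  rw [this]
  simp [l]

end DerivationExtension

section ResidueTrace

open Polynomial

variable {F : Type*} [Field F]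

theorem trace_mk_eq_coeff [PerfectField F] (P : FinitePlace F) (c : F[X]) :
    Algebra.trace F (F[X] ⧸ Ideal.span {P.1}) (Ideal.Quotient.mk _ c) =
      ((c * derivative P.1) %ₘ P.1).coeff (P.1.natDegree - 1) := by
  have hP := P.2.2
  have hPm := P.2.1
  have := Fact.mk hP
  change Algebra.trace F (AdjoinRoot P.1) (AdjoinRoot.mk P.1 c) = _
  let pb := AdjoinRoot.powerBasis hP.ne_zero
  have : FiniteDimensional F (AdjoinRoot P.1) := pb.finite
  have hdim : pb.dim = P.1.natDegree := AdjoinRoot.powerBasis_dim _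
  have hgen : pb.gen = AdjoinRoot.root P.1 := AdjoinRoot.powerBasis_gen _
  have hmin : minpoly F pb.gen = P.1 := by
    rw [hgen, AdjoinRoot.minpoly_root hP.ne_zero, hPm.leadingCoeff]; simp
  have hd := hP.natDegree_pos
  let i : Fin pb.dim := ⟨P.1.natDegree - 1, by omega⟩
  have h1 := Module.Basis.traceDual_powerBasis_eq pb i
  have hint : IsIntegral F pb.gen := Algebra.IsIntegral.isIntegral _
  have h2 : (minpolyDiv F pb.gen).coeff i = 1 := by
    have h3 := natDegree_minpolyDiv (R := F) (x := pb.gen)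
    rw [hmin] at h3
    have := minpolyDiv_monic hint
    rw [Monic, leadingCoeff, h3] at this
    exact this
  rw [h2, hmin] at h1
  have h4 : ∀ j : Fin pb.dim, Algebra.traceForm F _ (pb.basis.traceDual i) (pb.basis j) =
      if j = i then 1 else 0 := fun j ↦ (Module.Basis.traceDual_eq_iff (b := pb.basis)).1 rfl i j
  have hne : aeval pb.gen (derivative P.1) ≠ 0 := by
    have := (Algebra.IsSeparable.isSeparable F pb.gen).aeval_derivative_ne_zero
      (minpoly.aeval F pb.gen)
    rwa [hmin] at this
  set u := (c * derivative P.1) %ₘ P.1 with hu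
  have h5 : AdjoinRoot.mk P.1 c = (pb.basis.traceDual i) * aeval pb.gen u := by
    rw [h1, hgen, one_div, AdjoinRoot.aeval_eq, AdjoinRoot.aeval_eq]
    rw [hgen, AdjoinRoot.aeval_eq] at hne
    rw [eq_inv_mul_iff_mul_eq₀ hne, ← map_mul, mul_comm]
    refine AdjoinRoot.mk_eq_mk.2 ⟨(c * derivative P.1) /ₘ P.1, ?_⟩
    linear_combination - modByMonic_add_div (c * derivative P.1) P.1
  have h6 : u.natDegree < P.1.natDegree := natDegree_modByMonic_lt _ hPm hP.ne_one
  rw [h5, aeval_eq_sum_range' (n := pb.dim) (by omega), Finset.mul_sum, map_sum,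
    Finset.sum_range]
  have h7 : ∀ j : Fin pb.dim, Algebra.trace F (AdjoinRoot P.1)
      (pb.basis.traceDual i * u.coeff j • pb.gen ^ (j : ℕ)) = u.coeff j * if j = i then 1 else 0 := by
    intro j
    rw [mul_smul_comm, map_smul, smul_eq_mul, ← h4 j, Algebra.traceForm_apply, PowerBasis.coe_basis]
  simp only [h7, mul_ite, mul_one, mul_zero, Finset.sum_ite_eq', Finset.mem_univ, if_true]
  rfl

end ResidueTrace

section RatFuncDerivation

open Polynomial

variable {F : Type*} [Field F]

theorem exists_derivation_ratFunc (F : Type*) [Field F] :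
    ∃ d : Derivation F (RatFunc F) (RatFunc F), ∀ a : F[X],
      d (algebraMap F[X] (RatFunc F) a) = algebraMap F[X] (RatFunc F) (derivative a) := by
  have : Algebra.FormallyEtale F[X] (RatFunc F) :=
    Algebra.FormallyEtale.of_isLocalization (nonZeroDivisors F[X])
  exact exists_derivation_extend F (RatFunc F) (Polynomial.derivative' (R := F))

/-- The residue of a logarithmic differential. -/
theorem residue_mul_logDeriv [PerfectField F] (d : Derivation F (RatFunc F) (RatFunc F))
    (hd : ∀ a : F[X],
      d (algebraMap F[X] (RatFunc F) a) = algebraMap F[X] (RatFunc F) (derivative a))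
    (P : FinitePlace F) (c : F[X]) (h : RatFunc F)
    (hh : (h - algebraMap F[X] (RatFunc F) c) / algebraMap F[X] (RatFunc F) P.1 ∈ localRing P) :
    residue P (h * (d (algebraMap F[X] (RatFunc F) P.1) / algebraMap F[X] (RatFunc F) P.1)) =
      Algebra.trace F (F[X] ⧸ Ideal.span {P.1}) (Ideal.Quotient.mk _ c) := by
  have hP0 := algebraMap_ratFunc_ne_zero P.2.1.ne_zero
  have h1 : h * (d (algebraMap F[X] (RatFunc F) P.1) / algebraMap F[X] (RatFunc F) P.1) =
      (h - algebraMap F[X] (RatFunc F) c) / algebraMap F[X] (RatFunc F) P.1 *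
        algebraMap F[X] (RatFunc F) (derivative P.1) +
      algebraMap F[X] (RatFunc F) (c * derivative P.1 /ₘ P.1) +
      algebraMap F[X] (RatFunc F) (c * derivative P.1 %ₘ P.1) /
        algebraMap F[X] (RatFunc F) (P.1 ^ 1) := by
    have := congrArg (algebraMap F[X] (RatFunc F)) (modByMonic_add_div (c * derivative P.1) P.1)
    rw [hd, pow_one]
    simp only [map_add, map_mul] at this
    field_simp
    linear_combination - this
  have h2 := degree_modByMonic_lt (c * derivative P.1) P.2.1
  rw [h1, map_add, map_add,
    residue_of_mem_localRing (mul_mem hh ((localRing P).algebraMap_mem _)),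
    residue_of_mem_localRing ((localRing P).algebraMap_mem _), 
    residue_of_mem_polarPart (div_pow_mem_polarPart P (by rwa [pow_one])), pow_one,
    coeffInv_div _ P.2.1, (modByMonic_eq_self_iff P.2.1).2 h2, trace_mk_eq_coeff]
  simp

end RatFuncDerivation

section CharPDerivation

variable {F E : Type*} [Field F] [Field E] [Algebra F E] {p : ℕ} [Fact p.Prime] [CharP E p]

theorem derivation_pow_char_mul (d : Derivation F E E) (c x : E) : d (c ^ p * x) = c ^ p * d x := by
  rw [d.leibniz, d.leibniz_pow]
  simp [smul_eq_mul]

theorem iterate_derivation_pow_char_mul (d : Derivation F E E) (c x : E) (n : ℕ) :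
    d^[n] (c ^ p * x) = c ^ p * d^[n] x := by
  induction n with
  | zero => rfl
  | succ n ih => rw [Function.iterate_succ_apply', ih, derivation_pow_char_mul,
      Function.iterate_succ_apply']

theorem iterate_derivation_pow (d : Derivation F E E) {t : E} (ht : d t = 1) (i n : ℕ) :
    d^[n] (t ^ i) = (i.descFactorial n : E) * t ^ (i - n) := by
  induction n with
  | zero => simp
  | succ n ih =>
    rw [Function.iterate_succ_apply', ih, d.leibniz, d.map_natCast, d.leibniz_pow, ht,
      Nat.descFactorial_succ]
    simp only [smul_eq_mul, nsmul_eq_mul, mul_one, mul_zero, add_zero]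
    rw [Nat.sub_sub]
    push_cast
    ring

theorem iterate_derivation_add (d : Derivation F E E) (n : ℕ) (x y : E) :
    d^[n] (x + y) = d^[n] x + d^[n] y := iterate_map_add d n x y

/-- The additive subgroup generated by the products of `p`-th powers with `t ^ i`, `i < p`. -/
def frobeniusSpan (p : ℕ) (t : E) : AddSubgroup E :=
  AddSubgroup.closure {x | ∃ (c : E) (i : ℕ), i < p ∧ x = c ^ p * t ^ i}

theorem pow_mul_mem_frobeniusSpan {t : E} (c : E) (i : ℕ) : c ^ p * t ^ i ∈ frobeniusSpan p t := by
  refine AddSubgroup.subset_closure ⟨c * t ^ (i / p), i % p, Nat.mod_lt _ (Fact.out (p := p.Prime)).pos, ?_⟩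
  rw [mul_pow, ← pow_mul, mul_assoc, ← pow_add, mul_comm (i / p), Nat.div_add_mod]

theorem pow_char_mul_mem_frobeniusSpan {t : E} (c : E) {x : E} (hx : x ∈ frobeniusSpan p t) :
    c ^ p * x ∈ frobeniusSpan p t := by
  induction hx using AddSubgroup.closure_induction with
  | mem x hx =>
    obtain ⟨b, i, hi, rfl⟩ := hx
    exact AddSubgroup.subset_closure ⟨c * b, i, hi, by ring⟩
  | zero => rw [mul_zero]; exact zero_mem _
  | add x y _ _ hx hy => rw [mul_add]; exact add_mem hx hy
  | neg x _ hx => rw [mul_neg]; exact neg_mem hx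

theorem iterate_derivation_char (d : Derivation F E E) {t : E} (ht : d t = 1)
    (hspan : frobeniusSpan p t = ⊤) (x : E) : d^[p] x = 0 := by
  have hx : x ∈ frobeniusSpan p t := hspan ▸ AddSubgroup.mem_top x
  induction hx using AddSubgroup.closure_induction with
  | mem x hx =>
    obtain ⟨b, i, hi, rfl⟩ := hx
    rw [iterate_derivation_pow_char_mul, iterate_derivation_pow d ht, Nat.descFactorial_of_lt hi]
    simp
  | zero => exact iterate_map_zero d p
  | add x y _ _ hx hy => rw [iterate_derivation_add, hx, hy, add_zero]
  | neg x _ hx => rw [iterate_map_neg, hx, neg_zero]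

theorem exists_derivation_eq_pow_sub (d : Derivation F E E) (x y : E) :
    ∃ w, d w = (x + y) ^ (p - 1) * d (x + y) - x ^ (p - 1) * d x - y ^ (p - 1) * d y := by
  obtain ⟨n, hn⟩ : ∃ n, p = n + 1 := ⟨p - 1, by have := (Fact.out : p.Prime).pos; omega⟩
  have hp : p.Prime := Fact.out
  have hn1 : 1 ≤ n := by have := hp.two_le; omega
  have h0 : ((n : E) + 1) = 0 := by
    have := CharP.cast_eq_zero E p
    rw [hn] at this; exact_mod_cast this
  have hdvd : ∀ i ∈ Finset.range n, p ∣ p.choose (i + 1) := fun i hi ↦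
    hp.dvd_choose_self (by omega) (by have := Finset.mem_range.1 hi; omega)
  choose! c hc using hdvd
  have hc1 : ∀ i ∈ Finset.range n, (c i * (i + 1) : ℕ) = n.choose i := by
    intro i hi
    have h1 := Nat.add_one_mul_choose_eq n i
    rw [← hn, hc i hi, mul_assoc] at h1
    exact (Nat.eq_of_mul_eq_mul_left hp.pos h1).symm
  have hc2 : ∀ i ∈ Finset.range n, (c i * (n - i) : ℕ) = n.choose (i + 1) := by
    intro i hi
    have h1 := Nat.choose_mul_succ_eq n (i + 1)
    rw [← hn, hc i hi, mul_comm, mul_assoc] at h1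
    rw [Nat.eq_of_mul_eq_mul_left hp.pos h1]
    congr 1
    omega
  refine ⟨∑ i ∈ Finset.range n, (c i : E) * (x ^ (i + 1) * y ^ (n - i)), ?_⟩
  have h1 : ∀ i ∈ Finset.range n, d ((c i : E) * (x ^ (i + 1) * y ^ (n - i))) =
      x ^ i * y ^ (n - i) * (n.choose i : E) * d x +
      x ^ (i + 1) * y ^ (n - (i + 1)) * (n.choose (i + 1) : E) * d y := by
    intro i hi
    have := Finset.mem_range.1 hi
    rw [← hc1 i hi, ← hc2 i hi, d.leibniz, d.map_natCast, d.leibniz, d.leibniz_pow, d.leibniz_pow]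
    simp only [smul_eq_mul, nsmul_eq_mul, mul_zero, add_zero, add_tsub_cancel_right]
    rw [Nat.sub_sub]
    push_cast
    ring
  rw [map_sum, Finset.sum_congr rfl h1, Finset.sum_add_distrib, map_add, mul_add, hn,
    add_tsub_cancel_right]
  have h2 := add_pow x y n
  have h3 := h2
  rw [Finset.sum_range_succ] at h2
  rw [Finset.sum_range_succ'] at h3
  rw [← Finset.sum_mul, ← Finset.sum_mul]
  nth_rewrite 1 [h2]
  rw [h3]
  simp
  ring

theorem iterate_derivation_pow_mul_derivation (d : Derivation F E E) {t : E} (ht : d t = 1)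
    (hspan : frobeniusSpan p t = ⊤) (x : E) :
    d^[p - 1] (x ^ (p - 1) * d x) = - (d x) ^ p := by
  have hp : p.Prime := Fact.out
  have hwil : (((p - 1).factorial : ℕ) : E) = -1 := by
    have := congrArg (ZMod.castHom (dvd_refl p) E) (ZMod.wilsons_lemma p)
    rwa [map_natCast, map_neg, map_one] at this
  have hx : x ∈ frobeniusSpan p t := hspan ▸ AddSubgroup.mem_top x
  have hadd : ∀ x y, d^[p - 1] (x ^ (p - 1) * d x) = - (d x) ^ p →
      d^[p - 1] (y ^ (p - 1) * d y) = - (d y) ^ p →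
      d^[p - 1] ((x + y) ^ (p - 1) * d (x + y)) = - (d (x + y)) ^ p := by
    intro x y hx hy
    obtain ⟨w, hw⟩ := exists_derivation_eq_pow_sub (p := p) d x y
    have h1 : (x + y) ^ (p - 1) * d (x + y) = (x ^ (p - 1) * d x + y ^ (p - 1) * d y) + d w := by
      rw [hw]; ring
    have h2 : d^[p - 1] (d w) = 0 := by
      rw [← Function.iterate_succ_apply, Nat.succ_eq_add_one, Nat.sub_add_cancel hp.one_le]
      exact iterate_derivation_char d ht hspan w
    rw [h1, iterate_derivation_add, iterate_derivation_add, h2, hx, hy, map_add, add_pow_char]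
    ring
  induction hx using AddSubgroup.closure_induction with
  | mem x hx =>
    obtain ⟨b, i, hi, rfl⟩ := hx
    rw [derivation_pow_char_mul, d.leibniz_pow, ht]
    simp only [smul_eq_mul, nsmul_eq_mul, mul_one]
    rcases Nat.eq_zero_or_pos i with rfl | hi0
    · simp [iterate_map_zero, hp.ne_zero]
    · obtain ⟨j, rfl⟩ : ∃ j, i = j + 1 := ⟨i - 1, by omega⟩
      obtain ⟨q, rfl⟩ : ∃ q, p = q + 1 := ⟨p - 1, by omega⟩
      have hFr : (((j + 1 : ℕ) : E)) ^ (q + 1) = ((j + 1 : ℕ) : E) := by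
        have := congrArg (ZMod.castHom (dvd_refl (q + 1)) E) (ZMod.pow_card ((j + 1 : ℕ) : ZMod
          (q + 1)))
        rwa [map_pow, map_natCast] at this
      have h1 : (b ^ (q + 1) * t ^ (j + 1)) ^ (q + 1 - 1) * (b ^ (q + 1) * (((j + 1 : ℕ) : E) * t ^
        (j + 1 - 1)))
          = (((j + 1 : ℕ) : E) * b ^ (q + 1) * t ^ j) ^ (q + 1) * t ^ q := by
        rw [mul_pow _ (t ^ j), mul_pow _ (b ^ (q + 1)), hFr, Nat.add_sub_cancel, Nat.add_sub_cancel]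
        ring
      rw [h1, iterate_derivation_pow_char_mul, iterate_derivation_pow d ht, Nat.add_sub_cancel,
        Nat.descFactorial_self]
      rw [Nat.add_sub_cancel] at hwil
      rw [hwil, Nat.add_sub_cancel, Nat.sub_self]
      ring
  | zero => simp [iterate_map_zero, hp.ne_zero]
  | add x y _ _ hx hy => exact hadd x y hx hy
  | neg x _ hx =>
    have hxx : (d 0) ^ p = 0 := by simp [hp.ne_zero]
    rcases hp.eq_two_or_odd' with rfl | hodd
    · have : (-1 : E) = 1 := by
        have := CharP.cast_eq_zero E 2
        linear_combination (-1 : E) * this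
      rw [neg_eq_neg_one_mul, this, one_mul]
      exact hx
    · rw [map_neg, Even.neg_pow (hodd.tsub_odd odd_one), hodd.neg_pow, mul_neg, iterate_map_neg, hx]

end CharPDerivation

section FrobeniusSpan

open Polynomial

variable {F : Type*} [Field F] {p : ℕ} [Fact p.Prime] [CharP F p]

theorem frobeniusSpan_ratFunc [PerfectRing F p] :
    frobeniusSpan p (algebraMap F[X] (RatFunc F) X) = ⊤ := by
  have hp : p.Prime := Fact.out
  rw [eq_top_iff]
  rintro h -
  have hpoly : ∀ N : F[X], algebraMap F[X] (RatFunc F) N ∈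
      frobeniusSpan p (algebraMap F[X] (RatFunc F) X) := by
    intro N
    induction N using Polynomial.induction_on' with
    | add a b ha hb => rw [map_add]; exact add_mem ha hb
    | monomial n a =>
      obtain ⟨b, hb⟩ := (PerfectRing.bijective_frobenius (R := F) (p := p)).2 a
      have hb' : b ^ p = a := hb
      rw [← C_mul_X_pow_eq_monomial, ← hb', map_mul, C_pow, map_pow, map_pow]
      exact pow_mul_mem_frobeniusSpan _ _
  have hd0 := algebraMap_ratFunc_ne_zero h.denom_ne_zero
  have h1 : h = (algebraMap F[X] (RatFunc F) h.denom)⁻¹ ^ p *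
      algebraMap F[X] (RatFunc F) (h.num * h.denom ^ (p - 1)) := by
    nth_rewrite 1 [← RatFunc.num_div_denom h]
    rw [map_mul, map_pow, inv_pow]
    have h2 : algebraMap F[X] (RatFunc F) h.denom ^ p =
        algebraMap F[X] (RatFunc F) h.denom ^ (p - 1) * algebraMap F[X] (RatFunc F) h.denom := by
      rw [← pow_succ, Nat.sub_add_cancel hp.one_le]
    rw [h2]
    field_simp
  rw [h1]
  exact pow_char_mul_mem_frobeniusSpan _ (hpoly _)

theorem residue_pow_mul_X_pow (P : FinitePlace F) (y : RatFunc F) {i : ℕ} (hi : i < p) :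
    residue P (y ^ p * algebraMap F[X] (RatFunc F) X ^ i) =
      if i = p - 1 then residue P y ^ p else 0 := by
  have hp : p.Prime := Fact.out
  have : CharP (RatFunc F) p := charP_of_injective_algebraMap (algebraMap F (RatFunc F)).injective p
  obtain ⟨_, ⟨n, a, ha, rfl⟩, v, hv, rfl, hr⟩ := exists_polarPart_add P y
  have hPm := P.2.1.pow n
  rw [hr, coeffInv_div _ hPm, (modByMonic_eq_self_iff hPm).2 ha, add_pow_char, add_mul, map_add,
    residue_of_mem_localRing (mul_mem (pow_mem hv p)
      (pow_mem ((localRing P).algebraMap_mem X) i)), add_zero, div_pow, ← map_pow, ← map_pow,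
    div_mul_eq_mul_div, ← map_pow, ← map_mul, ← pow_mul]
  by_cases hn : (P.1 ^ n).natDegree = 0
  · have h1 : P.1 ^ n = 1 := (hPm.natDegree_eq_zero).1 hn
    have ha0 : a = 0 := by
      rw [h1, degree_one] at ha
      exact degree_eq_bot.1 (Nat.WithBot.lt_zero_iff.1 ha)
    simp [ha0, hp.ne_zero]
  set d := (P.1 ^ n).natDegree with hd
  have hnd : (P.1 ^ (n * p)).natDegree = p * d := by rw [pow_mul, natDegree_pow]
  have had : a.natDegree ≤ d - 1 := by
    by_cases ha0 : a = 0
    · simp [ha0]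
    · have := natDegree_lt_natDegree ha0 ha
      omega
  have hdeg : (a ^ p * X ^ i).natDegree ≤ p * (d - 1) + i := by
    refine natDegree_mul_le.trans ?_
    rw [natDegree_pow, natDegree_X_pow]
    gcongr
  have hpd : p * (d - 1) + p = p * d := by
    rw [← Nat.mul_succ]; congr 1; omega
  have hlt : (a ^ p * X ^ i).degree < (P.1 ^ (n * p)).degree := by
    refine degree_lt_degree ?_
    rw [hnd]; omega
  have hPm' : (P.1 ^ (n * p)).Monic := P.2.1.pow _
  rw [residue_of_mem_polarPart (div_pow_mem_polarPart P hlt), coeffInv_div _ hPm',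
    (modByMonic_eq_self_iff hPm').2 hlt, hnd]
  split_ifs with h
  · subst h
    have h2 : p * d - 1 = p * (d - 1) + (p - 1) := by omega
    rw [h2, coeff_mul_X_pow, coeff_pow_of_natDegree_le had]
  · exact coeff_eq_zero_of_natDegree_lt (by omega)

theorem residue_eq_residue_pow [PerfectRing F p] (d : Derivation F (RatFunc F) (RatFunc F))
    (hd : d (algebraMap F[X] (RatFunc F) X) = 1) (P : FinitePlace F) (h g : RatFunc F)
    (hgh : d^[p - 1] h = - g ^ p) : residue P h = residue P g ^ p := by
  have hp : p.Prime := Fact.out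
  have : CharP (RatFunc F) p := charP_of_injective_algebraMap (algebraMap F (RatFunc F)).injective p
  have hwil : (((p - 1).factorial : ℕ) : RatFunc F) = -1 := by
    have := congrArg (ZMod.castHom (dvd_refl p) (RatFunc F)) (ZMod.wilsons_lemma p)
    rwa [map_natCast, map_neg, map_one] at this
  suffices H : ∃ y, d^[p - 1] h = - y ^ p ∧ residue P h = residue P y ^ p by
    obtain ⟨y, hy, hr⟩ := H
    rw [hr]
    have : y = g := by
      apply frobenius_inj (RatFunc F) p
      rw [frobenius_def, frobenius_def]
      exact neg_injective (hy.symm.trans hgh)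
    rw [this]
  clear hgh g
  have hx : h ∈ frobeniusSpan p (algebraMap F[X] (RatFunc F) X) :=
    frobeniusSpan_ratFunc (F := F) (p := p) ▸ AddSubgroup.mem_top h
  induction hx using AddSubgroup.closure_induction with
  | mem x hx =>
    obtain ⟨b, i, hi, rfl⟩ := hx
    refine ⟨if i = p - 1 then b else 0, ?_, ?_⟩
    · rw [iterate_derivation_pow_char_mul, iterate_derivation_pow d hd]
      split_ifs with h
      · subst h
        rw [Nat.descFactorial_self, hwil]; simp
      · rw [Nat.descFactorial_of_lt (by omega)]; simp [hp.ne_zero]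
    · rw [residue_pow_mul_X_pow P b hi]
      split_ifs <;> simp [hp.ne_zero]
  | zero => exact ⟨0, by simp [iterate_map_zero, hp.ne_zero], by simp [hp.ne_zero]⟩
  | add x y _ _ hx hy =>
    obtain ⟨u, hu, hu'⟩ := hx
    obtain ⟨v, hv, hv'⟩ := hy
    refine ⟨u + v, ?_, ?_⟩
    · rw [iterate_derivation_add, hu, hv, add_pow_char]; ring
    · rw [map_add, map_add, add_pow_char, hu', hv']
  | neg x _ hx =>
    obtain ⟨u, hu, hu'⟩ := hx
    have h1 : ∀ {R : Type _} [CommRing R] [CharP R p] (z : R), (-z) ^ p = - z ^ p := by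
      intro R _ _ z
      have := add_pow_char (p := p) z (-z)
      rw [add_neg_cancel, zero_pow hp.ne_zero] at this
      linear_combination -this
    refine ⟨-u, ?_, ?_⟩
    · rw [iterate_map_neg, hu, h1]
    · rw [map_neg, map_neg, h1, hu']

end FrobeniusSpan

section NormDerivation

open Polynomial

theorem logDeriv_prod {F E : Type*} [Field F] [Field E] [Algebra F E] (d : Derivation F E E)
    {ι : Type*} (s : Finset ι) (f : ι → E) (hf : ∀ i, f i ≠ 0) :
    d (∏ i ∈ s, f i) / ∏ i ∈ s, f i = ∑ i ∈ s, d (f i) / f i := by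
  classical
  induction s using Finset.induction_on with
  | empty => simp
  | insert a s ha ih =>
    have h1 := hf a
    have h2 : ∏ i ∈ s, f i ≠ 0 := Finset.prod_ne_zero_iff.2 fun i _ ↦ hf i
    rw [Finset.prod_insert ha, Finset.sum_insert ha, ← ih, d.leibniz]
    simp only [smul_eq_mul]
    field_simp
    ring

variable {F : Type*} [Field F] {p : ℕ} [Fact p.Prime] [CharP F p]
  {K : Type*} [Field K] [Algebra (RatFunc F) K] [FiniteDimensional (RatFunc F) K]
  [IsGalois (RatFunc F) K] [Algebra F K] [IsScalarTower F (RatFunc F) K]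

theorem frobeniusSpan_eq_top_of_adjoin {k K : Type*} [Field k] [Field K] [Algebra k K] [CharP K p]
    {t : k} (hk : frobeniusSpan p t = ⊤) {D : k} {α : K}
    (hα : α ^ p - α = algebraMap k K D) (hadj : Algebra.adjoin k {α} = ⊤) :
    frobeniusSpan p (algebraMap k K t) = ⊤ := by
  have h1 : ∀ a : k, algebraMap k K a ∈ frobeniusSpan p (algebraMap k K t) := by
    intro a
    have ha : a ∈ frobeniusSpan p t := hk ▸ AddSubgroup.mem_top a
    induction ha using AddSubgroup.closure_induction with
    | mem x hx =>
      obtain ⟨b, i, hi, rfl⟩ := hx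
      rw [map_mul, map_pow, map_pow]
      exact AddSubgroup.subset_closure ⟨_, i, hi, rfl⟩
    | zero => rw [map_zero]; exact zero_mem _
    | add x y _ _ hx hy => rw [map_add]; exact add_mem hx hy
    | neg x _ hx => rw [map_neg]; exact neg_mem hx
  have h2 : ∀ (a b c : K), b ^ p * a ∈ frobeniusSpan p (algebraMap k K t) →
      (b * c) ^ p * a ∈ frobeniusSpan p (algebraMap k K t) := by
    intro a b c h
    rw [mul_comm b, mul_pow, mul_assoc]
    exact pow_char_mul_mem_frobeniusSpan c h
  rw [eq_top_iff]
  rintro x -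
  have hx : x ∈ Algebra.adjoin k {α} := hadj ▸ Algebra.mem_top
  suffices H : ∀ c : K, ∀ a : k, c ^ p * (algebraMap k K a * x) ∈ frobeniusSpan p
    (algebraMap k K t) by
    simpa using H 1 1
  induction hx using Algebra.adjoin_induction with
  | mem x hx =>
    rw [Set.mem_singleton_iff.1 hx]
    intro c a
    have h3 : c ^ p * (algebraMap k K a * α) =
        (c * α) ^ p * algebraMap k K a - c ^ p * algebraMap k K (a * D) := by
      rw [map_mul, ← hα]; ring
    rw [h3]
    exact sub_mem (pow_char_mul_mem_frobeniusSpan _ (h1 _)) (pow_char_mul_mem_frobeniusSpan _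
      (h1 _))
  | algebraMap r =>
    intro c a
    rw [← map_mul]
    exact pow_char_mul_mem_frobeniusSpan _ (h1 _)
  | add x y _ _ hx hy =>
    intro c a
    rw [mul_add, mul_add]
    exact add_mem (hx c a) (hy c a)
  | mul x y _ _ hx hy =>
    intro c a
    have key : ∀ z ∈ frobeniusSpan p (algebraMap k K t),
        z * y ∈ frobeniusSpan p (algebraMap k K t) := by
      intro z hz
      induction hz using AddSubgroup.closure_induction with
      | mem z hz =>
        obtain ⟨b, i, hi, rfl⟩ := hz
        rw [← map_pow, mul_assoc]
        exact hy b (t ^ i)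
      | zero => rw [zero_mul]; exact zero_mem _
      | add x y _ _ hx hy => rw [add_mul]; exact add_mem hx hy
      | neg x _ hx => rw [neg_mul]; exact neg_mem hx
    have := key _ (hx c a)
    convert this using 1
    ring

theorem exists_norm_logDeriv [PerfectRing F p] (d : Derivation F (RatFunc F) (RatFunc F))
    (hd : d (algebraMap F[X] (RatFunc F) X) = 1) {D : RatFunc F} {α : K}
    (hα : α ^ p - α = algebraMap (RatFunc F) K D) (hadj : Algebra.adjoin (RatFunc F) {α} = ⊤)
    {x : K} (hx : x ≠ 0) :
    ∃ g h : RatFunc F, D * (d (Algebra.norm (RatFunc F) x) / Algebra.norm (RatFunc F) x) = h - g ∧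
      d^[p - 1] h = - g ^ p := by
  have hp : p.Prime := Fact.out
  have : CharP (RatFunc F) p := charP_of_injective_algebraMap (algebraMap F (RatFunc F)).injective p
  have : CharP K p := charP_of_injective_algebraMap (algebraMap (RatFunc F) K).injective p
  have : Algebra.FormallyEtale (RatFunc F) K := Algebra.FormallyEtale.of_isSeparable (RatFunc F) K
  obtain ⟨δ, hδ⟩ := exists_derivation_extend F K d
  have hspan : frobeniusSpan p (algebraMap (RatFunc F) K (algebraMap F[X] (RatFunc F) X)) = ⊤ :=
    frobeniusSpan_eq_top_of_adjoin frobeniusSpan_ratFunc hα hadj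
  have hδt : δ (algebraMap (RatFunc F) K (algebraMap F[X] (RatFunc F) X)) = 1 := by
    rw [hδ, hd, map_one]
  have hδpow : ∀ y : K, δ (y ^ p) = 0 := by
    intro y
    have := derivation_pow_char_mul (p := p) δ y 1
    rwa [mul_one, δ.map_one_eq_zero, mul_zero] at this
  have hroot : ∀ y : K, y ^ p - y = algebraMap (RatFunc F) K D → δ y =
    algebraMap (RatFunc F) K (- d D) := by
    intro y hy
    have := congrArg δ hy
    rw [map_sub, hδpow, hδ, zero_sub] at this
    rw [map_neg, ← this, neg_neg]
  have hcomm : ∀ (τ : K ≃ₐ[(RatFunc F)] K) (y : K), δ (τ y) = τ (δ y) := by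
    intro τ y
    have hy : y ∈ Algebra.adjoin (RatFunc F) {α} := hadj ▸ Algebra.mem_top
    induction hy using Algebra.adjoin_induction with
    | mem y hy =>
      rw [Set.mem_singleton_iff.1 hy, hroot α hα, hroot (τ α), τ.commutes]
      rw [← map_pow, ← map_sub, hα, τ.commutes]
    | algebraMap r => rw [τ.commutes, hδ, τ.commutes]
    | add x y _ _ hx hy => rw [map_add, map_add, hx, hy, map_add, map_add]
    | mul x y _ _ hx hy =>
      rw [map_mul, δ.leibniz, δ.leibniz, hx, hy]
      simp
  have hcomm' : ∀ (τ : K ≃ₐ[(RatFunc F)] K) (n : ℕ) (y : K), δ^[n] (τ y) = τ (δ^[n] y) := by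
    intro τ n
    induction n with
    | zero => intro y; rfl
    | succ n ih => intro y; rw [Function.iterate_succ_apply, hcomm, ih, Function.iterate_succ_apply]
  have hδit : ∀ (n : ℕ) (a : (RatFunc F)), δ^[n] (algebraMap (RatFunc F) K a) =
    algebraMap (RatFunc F) K (d^[n] a) := by
    intro n
    induction n with
    | zero => intro y; rfl
    | succ n ih => intro y; rw [Function.iterate_succ_apply, hδ, ih, Function.iterate_succ_apply]
  have hδsum : ∀ (n : ℕ) (f : (K ≃ₐ[(RatFunc F)] K) → K), δ^[n] (∑ τ, f τ) = ∑ τ, δ^[n] (f τ) := by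
    intro n f
    induction n with
    | zero => rfl
    | succ n ih => simp only [Function.iterate_succ_apply', ih, map_sum]
  have hinj := (algebraMap (RatFunc F) K).injective
  refine ⟨Algebra.trace (RatFunc F) K (α * (δ x / x)),
    Algebra.trace (RatFunc F) K (α ^ p * (δ x / x)), hinj ?_, hinj ?_⟩
  · rw [map_mul, map_div₀, ← hδ, map_sub, Algebra.norm_eq_prod_automorphisms,
      logDeriv_prod δ _ _ (fun τ ↦ by simpa using hx), trace_eq_sum_automorphisms,
      trace_eq_sum_automorphisms, Finset.mul_sum, ← Finset.sum_sub_distrib]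
    refine Finset.sum_congr rfl fun τ _ ↦ ?_
    rw [hcomm, ← map_sub, ← sub_mul, hα, map_mul, τ.commutes, map_div₀]
  · rw [← hδit, map_neg, map_pow, trace_eq_sum_automorphisms, trace_eq_sum_automorphisms, hδsum,
      sum_pow_char, ← Finset.sum_neg_distrib]
    refine Finset.sum_congr rfl fun τ _ ↦ ?_
    rw [hcomm', ← map_pow, ← map_neg]
    congr 1
    have h1 : α ^ p * (δ x / x) = (α / x) ^ p * (x ^ (p - 1) * δ x) := by
      have : x ^ p = x ^ (p - 1) * x := by rw [← pow_succ, Nat.sub_add_cancel hp.one_le]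
      rw [div_pow, this]
      field_simp
    rw [h1, iterate_derivation_pow_char_mul, iterate_derivation_pow_mul_derivation δ hδt hspan]
    rw [div_pow, mul_pow, div_pow]
    ring

theorem trace_pow_char [Fintype F] [Algebra (ZMod p) F] (x : F) :
    Algebra.trace (ZMod p) F (x ^ p) = Algebra.trace (ZMod p) F x := by
  have := Algebra.trace_eq_of_algEquiv (FiniteField.frobeniusAlgEquivOfAlgebraic (ZMod p) F) x
  rwa [FiniteField.coe_frobeniusAlgEquivOfAlgebraic, ZMod.card] at this

theorem trace_residue_norm [Fintype F] [Algebra (ZMod p) F]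
    (d : Derivation F (RatFunc F) (RatFunc F))
    (hd : d (algebraMap F[X] (RatFunc F) X) = 1) {D : RatFunc F} {α : K}
    (hα : α ^ p - α = algebraMap (RatFunc F) K D) (hadj : Algebra.adjoin (RatFunc F) {α} = ⊤)
    {x : K} (hx : x ≠ 0) (P : FinitePlace F) :
    Algebra.trace (ZMod p) F (residue P
      (D * (d (Algebra.norm (RatFunc F) x) / Algebra.norm (RatFunc F) x))) = 0 := by
  obtain ⟨g, h, hgh, hh⟩ := exists_norm_logDeriv d hd hα hadj hx
  rw [hgh, map_sub, residue_eq_residue_pow d hd P h g hh, map_sub, trace_pow_char, sub_self]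

end NormDerivation

section Symbols

open Polynomial

/-- The derivation `d/dX` of `F(X)`. -/
noncomputable def ratFuncDerivation (F : Type*) [Field F] : Derivation F (RatFunc F) (RatFunc F) :=
  (exists_derivation_ratFunc F).choose

theorem ratFuncDerivation_algebraMap {F : Type*} [Field F] (a : F[X]) :
    ratFuncDerivation F (algebraMap F[X] (RatFunc F) a) =
      algebraMap F[X] (RatFunc F) (derivative a) :=
  (exists_derivation_ratFunc F).choose_spec a

/-- The logarithmic derivative of a rational function. -/
noncomputable def ratLogDeriv {F : Type*} [Field F] (b : RatFunc F) : RatFunc F :=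
  ratFuncDerivation F b / b

theorem ratLogDeriv_mul {F : Type*} [Field F] {a b : RatFunc F} (ha : a ≠ 0) (hb : b ≠ 0) :
    ratLogDeriv (a * b) = ratLogDeriv a + ratLogDeriv b := by
  rw [ratLogDeriv, ratLogDeriv, ratLogDeriv, Derivation.leibniz]
  simp only [smul_eq_mul]
  field_simp
  ring

theorem ratLogDeriv_algebraMap {F : Type*} [Field F] (b : F[X]) :
    ratLogDeriv (algebraMap F[X] (RatFunc F) b) =
      algebraMap F[X] (RatFunc F) (derivative b) / algebraMap F[X] (RatFunc F) b := by
  rw [ratLogDeriv, ratFuncDerivation_algebraMap]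

theorem ratLogDeriv_C {F : Type*} [Field F] (c : F) :
    ratLogDeriv (algebraMap F[X] (RatFunc F) (C c)) = 0 := by
  rw [ratLogDeriv_algebraMap, derivative_C, map_zero, zero_div]

/-- Normalized Artin-Schreier data over `F[X]`. -/
structure ArtinSchreierData (F : Type*) [Field F] (p m : ℕ) where
  /-- the finite ramified places -/
  P : Fin m → FinitePlace F
  injective : Function.Injective P
  /-- the numerators of the polar parts -/
  Q : Fin m → F[X]
  /-- the orders of the poles -/
  e : Fin m → ℕ
  /-- the polynomial part -/
  f : F[X]
  coprime : ∀ i, IsCoprime (P i).1 (Q i)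
  not_dvd : ∀ i, ¬ p ∣ e i
  degree_lt : ∀ i, (Q i).degree < ((P i).1 ^ (e i)).degree

namespace ArtinSchreierData

variable {F : Type*} [Field F] {p m : ℕ} (𝒟 : ArtinSchreierData F p m)

/-- The polar part of the Artin-Schreier constant at a ramified place. -/
noncomputable def polar (i : Fin m) : RatFunc F :=
  algebraMap F[X] (RatFunc F) (𝒟.Q i) / algebraMap F[X] (RatFunc F) ((𝒟.P i).1 ^ 𝒟.e i)

/-- The Artin-Schreier constant. -/
noncomputable def D : RatFunc F := ∑ i, 𝒟.polar i + algebraMap F[X] (RatFunc F) 𝒟.f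

theorem e_pos (i : Fin m) : 0 < 𝒟.e i :=
  Nat.pos_of_ne_zero fun h ↦ 𝒟.not_dvd i (h ▸ dvd_zero p)

theorem polar_mem (i : Fin m) : 𝒟.polar i ∈ polarPart (𝒟.P i) :=
  div_pow_mem_polarPart _ (𝒟.degree_lt i)

theorem polar_mem_localRing {i : Fin m} {P : FinitePlace F} (h : 𝒟.P i ≠ P) :
    𝒟.polar i ∈ localRing P := mem_localRing_of_mem_polarPart h (𝒟.polar_mem i)

theorem D_sub_polar_mem (i : Fin m) : 𝒟.D - 𝒟.polar i ∈ localRing (𝒟.P i) := by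
  classical
  rw [D, ← Finset.add_sum_erase _ _ (Finset.mem_univ i), add_assoc, add_sub_cancel_left]
  refine add_mem (sum_mem fun j hj ↦ 𝒟.polar_mem_localRing fun h ↦ ?_)
    ((localRing _).algebraMap_mem _)
  exact Finset.ne_of_mem_erase hj (𝒟.injective h)

theorem D_mem_localRing {P : FinitePlace F} (h : ∀ i, 𝒟.P i ≠ P) : 𝒟.D ∈ localRing P :=
  add_mem (sum_mem fun j _ ↦ 𝒟.polar_mem_localRing (h j)) ((localRing _).algebraMap_mem _)

theorem ratLogDeriv_mem {P : FinitePlace F} {b : F[X]} (hb : ¬ P.1 ∣ b) :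
    ratLogDeriv (algebraMap F[X] (RatFunc F) b) ∈ localRing P := by
  rw [ratLogDeriv_algebraMap]
  exact div_mem_localRing _ hb

theorem FinitePlace.not_dvd_of_ne {P Q : FinitePlace F} (h : P ≠ Q) : ¬ P.1 ∣ Q.1 := fun H ↦
  h (Subtype.ext (eq_of_monic_of_associated P.2.1 Q.2.1 (P.2.2.associated_of_dvd Q.2.2 H)))

variable [Fact p.Prime] [Fintype F] [Algebra (ZMod p) F]

/-- The local symbol `b ↦ -Tr Res (D db/b)` at a ramified place. -/
noncomputable def symbol (j : Fin m) (b : RatFunc F) : ZMod p :=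
  - Algebra.trace (ZMod p) F (residue (𝒟.P j) (𝒟.D * ratLogDeriv b))

/-- The local symbol at infinity. -/
noncomputable def symbolInf (b : RatFunc F) : ZMod p :=
  Algebra.trace (ZMod p) F (coeffInv (algebraMap F[X] (RatFunc F) 𝒟.f * ratLogDeriv b))

theorem symbol_mul (j : Fin m) {a b : RatFunc F} (ha : a ≠ 0) (hb : b ≠ 0) :
    𝒟.symbol j (a * b) = 𝒟.symbol j a + 𝒟.symbol j b := by
  rw [symbol, symbol, symbol, ratLogDeriv_mul ha hb, mul_add, map_add, map_add]
  ring

theorem symbolInf_mul {a b : RatFunc F} (ha : a ≠ 0) (hb : b ≠ 0) :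
    𝒟.symbolInf (a * b) = 𝒟.symbolInf a + 𝒟.symbolInf b := by
  rw [symbolInf, symbolInf, symbolInf, ratLogDeriv_mul ha hb, mul_add, map_add, map_add]

theorem symbol_C (j : Fin m) (c : F) : 𝒟.symbol j (algebraMap F[X] (RatFunc F) (C c)) = 0 := by
  rw [symbol, ratLogDeriv_C, mul_zero, map_zero, map_zero, neg_zero]

theorem symbol_one (j : Fin m) : 𝒟.symbol j 1 = 0 := by
  simpa using 𝒟.symbol_C j 1

theorem symbolInf_one : 𝒟.symbolInf 1 = 0 := by
  have := ratLogDeriv_C (1 : F)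
  rw [C_1, map_one] at this
  rw [symbolInf, this, mul_zero, map_zero, map_zero]

theorem symbol_norm [CharP F p] {K : Type*} [Field K] [Algebra (RatFunc F) K]
    [FiniteDimensional (RatFunc F) K]
    [IsGalois (RatFunc F) K] [Algebra F K] [IsScalarTower F (RatFunc F) K] {α : K}
    (hα : α ^ p - α = algebraMap (RatFunc F) K 𝒟.D) (hadj : Algebra.adjoin (RatFunc F) {α} = ⊤)
    (j : Fin m) {x : K} (hx : x ≠ 0) : 𝒟.symbol j (Algebra.norm (RatFunc F) x) = 0 := by
  rw [symbol, ratLogDeriv, trace_residue_norm (ratFuncDerivation F)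
    (by rw [ratFuncDerivation_algebraMap, derivative_X, map_one]) hα hadj hx, neg_zero]

theorem symbol_eq_of_not_dvd (j : Fin m) {b : F[X]} (hb : ¬ (𝒟.P j).1 ∣ b) :
    𝒟.symbol j (algebraMap F[X] (RatFunc F) b) = - Algebra.trace (ZMod p) F
      (residue (𝒟.P j) (𝒟.polar j * ratLogDeriv (algebraMap F[X] (RatFunc F) b))) := by
  have h1 : 𝒟.D * ratLogDeriv (algebraMap F[X] (RatFunc F) b) =
      (𝒟.D - 𝒟.polar j) * ratLogDeriv (algebraMap F[X] (RatFunc F) b) +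
      𝒟.polar j * ratLogDeriv (algebraMap F[X] (RatFunc F) b) := by ring
  rw [symbol, h1, map_add, residue_of_mem_localRing
    (mul_mem (𝒟.D_sub_polar_mem j) (ratLogDeriv_mem hb)), zero_add]

theorem derivative_pow_succ_mul (P s : F[X]) (n : ℕ) : P ^ n ∣ derivative (P ^ (n + 1) * s) := by
  refine ⟨C ((n : F) + 1) * derivative P * s + P * derivative s, ?_⟩
  rw [derivative_mul, derivative_pow_succ]
  ring

theorem symbol_congr (j : Fin m) {b b' : F[X]} (hb : ¬ (𝒟.P j).1 ∣ b) (hb' : ¬ (𝒟.P j).1 ∣ b')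
    (h : (𝒟.P j).1 ^ (𝒟.e j + 1) ∣ b - b') :
    𝒟.symbol j (algebraMap F[X] (RatFunc F) b) = 𝒟.symbol j (algebraMap F[X] (RatFunc F) b') := by
  obtain ⟨s, hs⟩ := h
  obtain rfl : b = b' + (𝒟.P j).1 ^ (𝒟.e j + 1) * s := by rw [← hs]; ring
  obtain ⟨w, hw⟩ := derivative_pow_succ_mul (𝒟.P j).1 s (𝒟.e j)
  rw [𝒟.symbol_eq_of_not_dvd j hb, 𝒟.symbol_eq_of_not_dvd j hb', neg_inj, ← sub_eq_zero, ← map_sub,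
    ← map_sub, ← mul_sub]
  suffices h : 𝒟.polar j * (ratLogDeriv (algebraMap F[X] (RatFunc F)
      (b' + (𝒟.P j).1 ^ (𝒟.e j + 1) * s)) - ratLogDeriv (algebraMap F[X] (RatFunc F) b')) ∈
      localRing (𝒟.P j) by
    rw [residue_of_mem_localRing h, map_zero]
  have h1 : algebraMap F[X] (RatFunc F) (b' + (𝒟.P j).1 ^ (𝒟.e j + 1) * s) ≠ 0 :=
    algebraMap_ratFunc_ne_zero fun h ↦ hb (h ▸ dvd_zero _)
  have h2 : algebraMap F[X] (RatFunc F) b' ≠ 0 :=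
    algebraMap_ratFunc_ne_zero fun h ↦ hb' (h ▸ dvd_zero _)
  have h3 : algebraMap F[X] (RatFunc F) (𝒟.P j).1 ≠ 0 :=
    algebraMap_ratFunc_ne_zero (𝒟.P j).2.1.ne_zero
  have h4 : 𝒟.polar j * (ratLogDeriv (algebraMap F[X] (RatFunc F)
      (b' + (𝒟.P j).1 ^ (𝒟.e j + 1) * s)) - ratLogDeriv (algebraMap F[X] (RatFunc F) b')) =
      algebraMap F[X] (RatFunc F) (𝒟.Q j * (w * b' - (𝒟.P j).1 * s * derivative b')) /
      algebraMap F[X] (RatFunc F) ((b' + (𝒟.P j).1 ^ (𝒟.e j + 1) * s) * b') := by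
    rw [polar, ratLogDeriv_algebraMap, ratLogDeriv_algebraMap, derivative_add, hw]
    rw [map_mul _ _ b']
    field_simp
    simp only [map_add, map_sub, map_mul, map_pow]
    ring
  rw [h4]
  exact div_mem_localRing _ fun h ↦ ((𝒟.P j).2.2.prime.dvd_or_dvd h).elim hb hb'

/-- The composed trace from the residue field at a finite place to the prime field. -/
noncomputable def residueTrace (p : ℕ) [Fact p.Prime] [Algebra (ZMod p) F] (P : FinitePlace F)
    (c : F[X]) : ZMod p :=
  Algebra.trace (ZMod p) F (Algebra.trace F (F[X] ⧸ Ideal.span {P.1}) (Ideal.Quotient.mk _ c))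

theorem exists_residueTrace_ne_zero (P : FinitePlace F) : ∃ c, residueTrace p P c ≠ 0 := by
  have := Fact.mk P.2.2
  have : FiniteDimensional F (AdjoinRoot P.1) := (AdjoinRoot.powerBasis P.2.2.ne_zero).finite
  obtain ⟨y, hy⟩ := Algebra.trace_surjective (ZMod p) F 1
  obtain ⟨x, hx⟩ := Algebra.trace_surjective F (AdjoinRoot P.1) y
  obtain ⟨c, rfl⟩ := AdjoinRoot.mk_surjective x
  refine ⟨c, ?_⟩
  change Algebra.trace (ZMod p) F (Algebra.trace F (AdjoinRoot P.1) (AdjoinRoot.mk P.1 c)) ≠ 0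
  rw [hx, hy]
  exact one_ne_zero

theorem residueTrace_congr (P : FinitePlace F) {c c' : F[X]} (h : P.1 ∣ c - c') :
    residueTrace p P c = residueTrace p P c' := by
  rw [residueTrace, residueTrace, (Ideal.Quotient.eq (x := c) (y := c')).2 (Ideal.mem_span_singleton.2 h)]

theorem exists_symbol_ne_zero [CharP F p] (j : Fin m) {W : F[X]} (hW : ¬ (𝒟.P j).1 ∣ W) :
    ∃ s : F[X], 𝒟.symbol j (algebraMap F[X] (RatFunc F) (1 + (𝒟.P j).1 ^ 𝒟.e j * (W * s))) ≠ 0 := by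
  have hP := (𝒟.P j).2.2
  obtain ⟨u, hu⟩ := exists_residueTrace_ne_zero (p := p) (𝒟.P j)
  have he0 : (𝒟.e j : F) ≠ 0 := fun h ↦ 𝒟.not_dvd j ((CharP.cast_eq_zero_iff F p _).1 h)
  obtain ⟨n, hn⟩ : ∃ n, 𝒟.e j = n + 1 := ⟨𝒟.e j - 1, by have := 𝒟.e_pos j; omega⟩
  have hcop : IsCoprime (𝒟.P j).1 (C (𝒟.e j : F) * W * 𝒟.Q j) := by
    refine IsCoprime.mul_right (IsCoprime.mul_right ?_ (hP.coprime_iff_not_dvd.2 hW)) (𝒟.coprime j)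
    exact (isCoprime_one_right (x := (𝒟.P j).1)).of_isCoprime_of_dvd_right (isUnit_iff_dvd_one.1
      (isUnit_C.2 he0.isUnit))
  obtain ⟨x, y, hxy⟩ := hcop
  refine ⟨y * u, ?_⟩
  set s := W * (y * u) with hs
  set b := 1 + (𝒟.P j).1 ^ 𝒟.e j * s with hb
  have hbd : ¬ (𝒟.P j).1 ∣ b := by
    intro h
    have h1 : (𝒟.P j).1 ∣ (𝒟.P j).1 ^ 𝒟.e j * s := (dvd_pow_self _ (𝒟.e_pos j).ne').mul_right _
    exact hP.not_isUnit (isUnit_of_dvd_one ((dvd_add_left h1).1 h))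
  rw [𝒟.symbol_eq_of_not_dvd j hbd, neg_ne_zero]
  have hb0 : algebraMap F[X] (RatFunc F) b ≠ 0 :=
    algebraMap_ratFunc_ne_zero fun h ↦ hbd (h ▸ dvd_zero _)
  have hP0 : algebraMap F[X] (RatFunc F) (𝒟.P j).1 ≠ 0 :=
    algebraMap_ratFunc_ne_zero (𝒟.P j).2.1.ne_zero
  set c := C (𝒟.e j : F) * s * 𝒟.Q j with hc
  have h1 : 𝒟.polar j * ratLogDeriv (algebraMap F[X] (RatFunc F) b) =
      (algebraMap F[X] (RatFunc F) c / algebraMap F[X] (RatFunc F) b) *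
        (ratFuncDerivation F (algebraMap F[X] (RatFunc F) (𝒟.P j).1) /
          algebraMap F[X] (RatFunc F) (𝒟.P j).1) +
      algebraMap F[X] (RatFunc F) (𝒟.Q j * derivative s) / algebraMap F[X] (RatFunc F) b := by
    have h2 : derivative b = C (𝒟.e j : F) * (𝒟.P j).1 ^ n * derivative (𝒟.P j).1 * s +
        (𝒟.P j).1 ^ 𝒟.e j * derivative s := by
      rw [hb, derivative_add, derivative_one, zero_add, derivative_mul, hn, derivative_pow_succ]
      push_cast
      ring
    rw [polar, ratLogDeriv_algebraMap, h2, ratFuncDerivation_algebraMap, hc, hn]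
    simp only [map_add, map_mul, map_pow]
    field_simp
    ring
  rw [h1, map_add, residue_of_mem_localRing (div_mem_localRing _ hbd), add_zero,
    residue_mul_logDeriv _ ratFuncDerivation_algebraMap (𝒟.P j) c]
  · change residueTrace p (𝒟.P j) c ≠ 0
    rwa [residueTrace_congr (𝒟.P j) (c' := u)]
    refine ⟨- x * u, ?_⟩
    rw [hc, hs]
    linear_combination u * hxy
  · have h3 : (algebraMap F[X] (RatFunc F) c / algebraMap F[X] (RatFunc F) b -
        algebraMap F[X] (RatFunc F) c) / algebraMap F[X] (RatFunc F) (𝒟.P j).1 =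
        algebraMap F[X] (RatFunc F) (- c * (𝒟.P j).1 ^ n * s) / algebraMap F[X] (RatFunc F) b := by
      have : algebraMap F[X] (RatFunc F) b = 1 + algebraMap F[X] (RatFunc F) (𝒟.P j).1 ^ (n + 1) *
          algebraMap F[X] (RatFunc F) s := by rw [hb, hn]; simp
      field_simp
      rw [this]
      simp only [map_mul, map_neg, map_pow]
      ring
    rw [h3]
    exact div_mem_localRing _ hbd

theorem coeffInv_polar_mul (j : Fin m) {b : F[X]} (hb : b.Monic) :
    coeffInv (𝒟.polar j * ratLogDeriv (algebraMap F[X] (RatFunc F) b)) = 0 := by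
  rw [polar, ratLogDeriv_algebraMap, div_mul_div_comm, ← map_mul, ← map_mul]
  have hPm := (𝒟.P j).2.1.pow (𝒟.e j)
  by_cases h0 : 𝒟.Q j * derivative b = 0
  · rw [h0]; simp
  refine coeffInv_div_of_degree_lt _ (hPm.mul hb) ?_
  have hQ0 := left_ne_zero_of_mul h0
  have hb0 := right_ne_zero_of_mul h0
  rw [natDegree_mul hQ0 hb0, hPm.natDegree_mul hb]
  have h1 := natDegree_lt_natDegree hQ0 (𝒟.degree_lt j)
  have h2 : (derivative b).natDegree < b.natDegree :=
    natDegree_derivative_lt fun h ↦ hb0 (by rw [eq_C_of_natDegree_eq_zero h, derivative_C])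
  omega

theorem coeffInv_D_mul {b : F[X]} (hb : b.Monic) :
    coeffInv (𝒟.D * ratLogDeriv (algebraMap F[X] (RatFunc F) b)) =
      coeffInv (algebraMap F[X] (RatFunc F) 𝒟.f * ratLogDeriv (algebraMap F[X] (RatFunc F) b)) := by
  rw [D, add_mul, map_add, Finset.sum_mul, map_sum,
    Finset.sum_eq_zero fun j _ ↦ 𝒟.coeffInv_polar_mul j hb, zero_add]

theorem symbol_P_of_ne {i j : Fin m} (hij : i ≠ j) {c : F[X]}
    (hc : (𝒟.P i).1 ∣ (𝒟.P j).1 ^ 𝒟.e j * c - 𝒟.Q j) :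
    𝒟.symbol j (algebraMap F[X] (RatFunc F) (𝒟.P i).1) = residueTrace p (𝒟.P i) c := by
  classical
  have hne : 𝒟.P i ≠ 𝒟.P j := fun h ↦ hij (𝒟.injective h)
  have h0 : algebraMap F[X] (RatFunc F) (𝒟.P i).1 ≠ 0 :=
    algebraMap_ratFunc_ne_zero (𝒟.P i).2.1.ne_zero
  have h0' : algebraMap F[X] (RatFunc F) (𝒟.P j).1 ≠ 0 :=
    algebraMap_ratFunc_ne_zero (𝒟.P j).2.1.ne_zero
  have h1 := coeffInv_eq_sum_residue {𝒟.P i, 𝒟.P j}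
    (𝒟.polar j * ratLogDeriv (algebraMap F[X] (RatFunc F) (𝒟.P i).1)) fun P hP ↦ by
      simp only [Finset.mem_insert, Finset.mem_singleton, not_or] at hP
      exact mul_mem (𝒟.polar_mem_localRing (Ne.symm hP.2))
        (ratLogDeriv_mem (FinitePlace.not_dvd_of_ne hP.1))
  rw [𝒟.coeffInv_polar_mul j (𝒟.P i).2.1, Finset.sum_pair hne] at h1
  rw [𝒟.symbol_eq_of_not_dvd j (FinitePlace.not_dvd_of_ne (Ne.symm hne)),
    eq_neg_of_add_eq_zero_right h1.symm, map_neg, neg_neg, residueTrace]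
  congr 1
  refine residue_mul_logDeriv _ ratFuncDerivation_algebraMap (𝒟.P i) c _ ?_
  obtain ⟨w, hw⟩ := hc
  have h2 : (𝒟.polar j - algebraMap F[X] (RatFunc F) c) / algebraMap F[X] (RatFunc F) (𝒟.P i).1 =
      algebraMap F[X] (RatFunc F) (- w) / algebraMap F[X] (RatFunc F) ((𝒟.P j).1 ^ 𝒟.e j) := by
    have := congrArg (algebraMap F[X] (RatFunc F)) hw
    simp only [map_sub, map_mul, map_pow, map_neg, polar] at this ⊢
    field_simp
    linear_combination - this
  rw [h2]
  exact div_mem_localRing _ fun h ↦ FinitePlace.not_dvd_of_ne hne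
    ((𝒟.P i).2.2.prime.dvd_of_dvd_pow h)

theorem symbolInf_place (P : FinitePlace F) :
    𝒟.symbolInf (algebraMap F[X] (RatFunc F) P.1) = residueTrace p P 𝒟.f := by
  rw [symbolInf, residueTrace, trace_mk_eq_coeff, ratLogDeriv_algebraMap, ← mul_div_assoc,
    ← map_mul, coeffInv_div _ P.2.1]

theorem sum_symbol_P (i : Fin m) :
    ∑ j, 𝒟.symbol j (algebraMap F[X] (RatFunc F) (𝒟.P i).1) + residueTrace p (𝒟.P i) 𝒟.f = 0 := by
  classical
  have h1 := coeffInv_eq_sum_residue (Finset.univ.map ⟨𝒟.P, 𝒟.injective⟩)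
    (𝒟.D * ratLogDeriv (algebraMap F[X] (RatFunc F) (𝒟.P i).1)) fun P hP ↦ by
      simp only [Finset.mem_map, Finset.mem_univ, Function.Embedding.coeFn_mk, true_and,
        not_exists] at hP
      exact mul_mem (𝒟.D_mem_localRing hP)
        (ratLogDeriv_mem (FinitePlace.not_dvd_of_ne (Ne.symm (hP i))))
  rw [𝒟.coeffInv_D_mul (𝒟.P i).2.1, Finset.sum_map] at h1
  rw [← 𝒟.symbolInf_place, symbolInf, h1, map_sum, ← Finset.sum_add_distrib]
  exact Finset.sum_eq_zero fun j _ ↦ neg_add_cancel _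

theorem sum_symbol_add_symbolInf (P : FinitePlace F) (hP : ∀ i, 𝒟.P i ≠ P) {c : F[X]}
    (hc : (𝒟.D - algebraMap F[X] (RatFunc F) c) / algebraMap F[X] (RatFunc F) P.1 ∈ localRing P) :
    ∑ j, 𝒟.symbol j (algebraMap F[X] (RatFunc F) P.1) +
      𝒟.symbolInf (algebraMap F[X] (RatFunc F) P.1) = residueTrace p P c := by
  classical
  have hPm : P ∉ Finset.univ.map ⟨𝒟.P, 𝒟.injective⟩ := by simpa using hP
  have h1 := coeffInv_eq_sum_residue (insert P (Finset.univ.map ⟨𝒟.P, 𝒟.injective⟩))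
    (𝒟.D * ratLogDeriv (algebraMap F[X] (RatFunc F) P.1)) fun P' hP' ↦ by
      simp only [Finset.mem_insert, Finset.mem_map, Finset.mem_univ, Function.Embedding.coeFn_mk,
        true_and, not_or, not_exists] at hP'
      exact mul_mem (𝒟.D_mem_localRing hP'.2)
        (ratLogDeriv_mem (FinitePlace.not_dvd_of_ne hP'.1))
  rw [𝒟.coeffInv_D_mul P.2.1, Finset.sum_insert hPm, Finset.sum_map] at h1
  rw [symbolInf, h1, map_add, map_sum, add_left_comm, ← Finset.sum_add_distrib,
    Finset.sum_eq_zero fun j _ ↦ neg_add_cancel _, add_zero, residueTrace]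
  congr 1
  exact residue_mul_logDeriv _ ratFuncDerivation_algebraMap P c _ hc

end ArtinSchreierData

end Symbols

section Characters

open Polynomial

/-- The additive form of Hilbert's Theorem 90 for a finite field over its prime field. -/
theorem exists_pow_sub_eq_of_trace_eq_zero {p : ℕ} [Fact p.Prime] {E : Type*} [Field E] [Finite E]
    [Algebra (ZMod p) E] {x : E} (hx : Algebra.trace (ZMod p) E x = 0) : ∃ y : E, y ^ p - y = x := by
  have : CharP E p := charP_of_injective_algebraMap (algebraMap (ZMod p) E).injective p
  have : FiniteDimensional (ZMod p) E := Module.Finite.of_finite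
  have := Fintype.ofFinite E
  let w : E →ₗ[ZMod p] E :=
    ((frobenius E p).toAddMonoidHom - AddMonoidHom.id E).toZModLinearMap p
  have hw (y : E) : w y = y ^ p - y := rfl
  have h1 : LinearMap.range w ≤ LinearMap.ker (Algebra.trace (ZMod p) E) := by
    rintro _ ⟨y, rfl⟩
    rw [LinearMap.mem_ker, hw, map_sub, trace_pow_char, sub_self]
  have h2 : Module.finrank (ZMod p) (LinearMap.ker w) ≤ 1 := by
    have h : LinearMap.ker w ≤ Submodule.span (ZMod p) {1} := by
      intro y hy
      have hy' : y ∈ (⊥ : Subfield E) :=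
        (Subfield.mem_bot_iff_pow_eq_self E p).2 (sub_eq_zero.1 hy)
      obtain ⟨a, rfl⟩ : y ∈ (algebraMap (ZMod p) E).fieldRange :=
        (bot_le : (⊥ : Subfield E) ≤ _) hy'
      exact Submodule.mem_span_singleton.2 ⟨a, (Algebra.algebraMap_eq_smul_one a).symm⟩
    exact (Submodule.finrank_mono h).trans (finrank_span_singleton one_ne_zero).le
  have h3 := LinearMap.finrank_range_add_finrank_ker w
  have h4 := LinearMap.finrank_range_add_finrank_ker (Algebra.trace (ZMod p) E)
  rw [LinearMap.range_eq_top.2 (Algebra.trace_surjective _ _), finrank_top,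
    Module.finrank_self] at h4
  have h5 := Submodule.eq_of_le_of_finrank_le h1 (by omega)
  obtain ⟨y, hy⟩ : x ∈ LinearMap.range w := h5 ▸ hx
  exact ⟨y, hy⟩

theorem exists_dvd_pow_sub_sub {F : Type*} [Field F] {p : ℕ} [Fact p.Prime] [Fintype F]
    [Algebra (ZMod p) F] (P : FinitePlace F) {c : F[X]}
    (hc : ArtinSchreierData.residueTrace p P c = 0) : ∃ y : F[X], P.1 ∣ y ^ p - y - c := by
  have := Fact.mk P.2.2
  have : FiniteDimensional F (AdjoinRoot P.1) := (AdjoinRoot.powerBasis P.2.2.ne_zero).finite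
  have : Finite (AdjoinRoot P.1) := Module.finite_of_finite F
  have : FiniteDimensional (ZMod p) F := Module.Finite.of_finite
  have : FiniteDimensional (ZMod p) (AdjoinRoot P.1) := Module.Finite.of_finite
  have hc' : Algebra.trace (ZMod p) (AdjoinRoot P.1) (AdjoinRoot.mk P.1 c) = 0 := by
    rw [← Algebra.trace_trace (S := F)]
    exact hc
  obtain ⟨y, hy⟩ := exists_pow_sub_eq_of_trace_eq_zero hc'
  obtain ⟨y, rfl⟩ := AdjoinRoot.mk_surjective y
  refine ⟨y, AdjoinRoot.mk_eq_zero.1 ?_⟩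
  rw [map_sub, map_sub, map_pow, hy, sub_self]

theorem sum_eq_zero_of_twist {α : Type*} {s : Finset α} {χ : α → ℂ} {ω : ℂ} (hω : ω ≠ 1)
    (π : α → α) (hs : ∀ b ∈ s, π b ∈ s) (hinj : Set.InjOn π s) (h : ∀ b ∈ s, χ (π b) = ω * χ b) :
    ∑ b ∈ s, χ b = 0 := by
  have h1 : ∑ b ∈ s, χ (π b) = ∑ b ∈ s, χ b :=
    Finset.sum_nbij π hs hinj (Finset.surjOn_of_injOn_of_card_le π hs hinj le_rfl) fun _ _ ↦ rfl
  rw [Finset.sum_congr rfl h, ← Finset.mul_sum] at h1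
  have h2 : (ω - 1) * ∑ b ∈ s, χ b = 0 := by rw [sub_mul, h1, one_mul, sub_self]
  exact (mul_eq_zero.1 h2).resolve_left (sub_ne_zero.2 hω)

theorem exists_coe_eq_of_coeff_eq_zero (L : PowerSeries ℂ) (N : ℕ)
    (h : ∀ n, N ≤ n → PowerSeries.coeff n L = 0) : ∃ g : ℂ[X], (g : PowerSeries ℂ) = L := by
  refine ⟨L.trunc N, ?_⟩
  ext n
  rw [Polynomial.coeff_coe, PowerSeries.coeff_trunc]
  split_ifs with hn
  · rfl
  · exact (h n (not_lt.1 hn)).symm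

end Characters

section CharacterSums

open Polynomial

namespace ArtinSchreierData

variable {F : Type*} [Field F] {p m : ℕ} (𝒟 : ArtinSchreierData F p m)

/-- A modulus for the local symbols at the finite ramified places. -/
noncomputable def modulus : F[X] := ∏ i, (𝒟.P i).1 ^ (𝒟.e i + 1)

theorem modulus_monic : 𝒟.modulus.Monic := monic_prod_of_monic _ _ fun i _ ↦ (𝒟.P i).2.1.pow _

theorem pow_dvd_modulus (i : Fin m) : (𝒟.P i).1 ^ (𝒟.e i + 1) ∣ 𝒟.modulus :=
  Finset.dvd_prod_of_mem _ (Finset.mem_univ i)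

theorem isCoprime_modulus_iff {b : F[X]} :
    IsCoprime b 𝒟.modulus ↔ ∀ i, ¬ (𝒟.P i).1 ∣ b := by
  rw [modulus, IsCoprime.prod_right_iff]
  refine ⟨fun h i ↦ ?_, fun h i _ ↦ ?_⟩
  · have h1 := (IsCoprime.pow_right_iff (Nat.succ_pos _)).1 (h i (Finset.mem_univ i))
    exact (𝒟.P i).2.2.coprime_iff_not_dvd.1 h1.symm
  · exact IsCoprime.pow_right ((𝒟.P i).2.2.coprime_iff_not_dvd.2 (h i)).symm

theorem isCoprime_modulus_congr {b b' : F[X]} (h : 𝒟.modulus ∣ b - b') :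
    IsCoprime b 𝒟.modulus ↔ IsCoprime b' 𝒟.modulus := by
  obtain ⟨s, hs⟩ := h
  rw [show b = b' + 𝒟.modulus * s by rw [← hs]; ring, IsCoprime.add_mul_left_left_iff]

variable [Fact p.Prime] [Fintype F] [Algebra (ZMod p) F]

theorem symbol_congr_modulus (i : Fin m) {b b' : F[X]} (hb : IsCoprime b 𝒟.modulus)
    (h : 𝒟.modulus ∣ b - b') : 𝒟.symbol i (algebraMap F[X] (RatFunc F) b) =
      𝒟.symbol i (algebraMap F[X] (RatFunc F) b') :=
  𝒟.symbol_congr i (𝒟.isCoprime_modulus_iff.1 hb i)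
    (𝒟.isCoprime_modulus_iff.1 ((𝒟.isCoprime_modulus_congr h).1 hb) i)
    ((𝒟.pow_dvd_modulus i).trans h)

theorem symbolInf_add {b r : F[X]} (hb : b.Monic) (hbr : (b + r).Monic) :
    𝒟.symbolInf (algebraMap F[X] (RatFunc F) (b + r)) =
      𝒟.symbolInf (algebraMap F[X] (RatFunc F) b) + Algebra.trace (ZMod p) F
        (((𝒟.f * (derivative r * b - r * derivative b)) %ₘ ((b + r) * b)).coeff
          (((b + r) * b).natDegree - 1)) := by
  rw [← coeffInv_div _ (hbr.mul hb), symbolInf, symbolInf, ← map_add, ← map_add]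
  congr 2
  have h1 := algebraMap_ratFunc_ne_zero hb.ne_zero
  have h2 := algebraMap_ratFunc_ne_zero hbr.ne_zero
  rw [ratLogDeriv_algebraMap, ratLogDeriv_algebraMap, map_mul _ (b + r) b]
  field_simp
  simp only [map_add, map_sub, map_mul]
  ring

theorem natDegree_wronskian_le (b r : F[X]) :
    (derivative r * b - r * derivative b).natDegree ≤ r.natDegree + b.natDegree - 1 := by
  refine (natDegree_sub_le _ _).trans (max_le ?_ ?_)
  · rcases Nat.eq_zero_or_pos r.natDegree with h | h
    · rw [eq_C_of_natDegree_eq_zero h]; simp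
    · refine natDegree_mul_le.trans ?_
      have := natDegree_derivative_le r
      omega
  · rcases Nat.eq_zero_or_pos b.natDegree with h | h
    · rw [eq_C_of_natDegree_eq_zero h]; simp
    · refine natDegree_mul_le.trans ?_
      have := natDegree_derivative_le b
      omega

theorem symbolInf_add_of_lt {b r : F[X]} (hb : b.Monic)
    (h : r.natDegree + 𝒟.f.natDegree + 1 < b.natDegree) :
    𝒟.symbolInf (algebraMap F[X] (RatFunc F) (b + r)) =
      𝒟.symbolInf (algebraMap F[X] (RatFunc F) b) := by
  have hbr : (b + r).Monic := hb.add_of_left (degree_lt_degree (by omega))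
  have hdeg : (b + r).natDegree = b.natDegree := natDegree_add_eq_left_of_natDegree_lt (by omega)
  have h1 := natDegree_wronskian_le b r
  have h2 : (𝒟.f * (derivative r * b - r * derivative b)).natDegree ≤ _ := natDegree_mul_le
  have h3 : ((b + r) * b).natDegree = b.natDegree + b.natDegree := by
    rw [hbr.natDegree_mul hb, hdeg]
  rw [𝒟.symbolInf_add hb hbr, (modByMonic_eq_self_iff (hbr.mul hb)).2 (degree_lt_degree (by omega)),
    coeff_eq_zero_of_natDegree_lt (by omega), map_zero, add_zero]

variable (c : Fin m → ZMod p) (a : ZMod p)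

/-- A linear combination of the local symbols. -/
noncomputable def phase (b : F[X]) : ZMod p :=
  ∑ j, (a + c j) * 𝒟.symbol j (algebraMap F[X] (RatFunc F) b) +
    a * 𝒟.symbolInf (algebraMap F[X] (RatFunc F) b)

open Classical in
/-- The character of `F[X]` attached to a linear combination of the local symbols. -/
noncomputable def twist (b : F[X]) : ℂ :=
  if IsCoprime b 𝒟.modulus then ZMod.stdAddChar (𝒟.phase c a b) else 0

theorem phase_mul {b b' : F[X]} (hb : b ≠ 0) (hb' : b' ≠ 0) :
    𝒟.phase c a (b * b') = 𝒟.phase c a b + 𝒟.phase c a b' := by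
  simp only [phase, map_mul]
  rw [𝒟.symbolInf_mul (algebraMap_ratFunc_ne_zero hb) (algebraMap_ratFunc_ne_zero hb')]
  simp only [𝒟.symbol_mul _ (algebraMap_ratFunc_ne_zero hb) (algebraMap_ratFunc_ne_zero hb'),
    mul_add, Finset.sum_add_distrib]
  ring

theorem phase_one : 𝒟.phase c a 1 = 0 := by
  simp [phase, map_one, symbol_one, symbolInf_one]

theorem twist_mul {b b' : F[X]} (hb : b.Monic) (hb' : b'.Monic) :
    𝒟.twist c a (b * b') = 𝒟.twist c a b * 𝒟.twist c a b' := by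
  by_cases h1 : IsCoprime b 𝒟.modulus
  · by_cases h2 : IsCoprime b' 𝒟.modulus
    · rw [twist, twist, twist, if_pos h1, if_pos h2, if_pos (h1.mul_left h2),
        𝒟.phase_mul c a hb.ne_zero hb'.ne_zero, AddChar.map_add_eq_mul]
    · rw [twist, twist, twist, if_neg h2, mul_zero, if_neg fun h ↦ h2 h.of_mul_left_right]
  · rw [twist, twist, if_neg h1, zero_mul, if_neg fun h ↦ h1 h.of_mul_left_left]

theorem twist_one : 𝒟.twist c a 1 = 1 := by
  rw [twist, if_pos isCoprime_one_left, phase_one, AddChar.map_zero_eq_one]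

theorem twist_eq_mul {b b' : F[X]} {t : ZMod p} 
    (h : IsCoprime b 𝒟.modulus ↔ IsCoprime b' 𝒟.modulus)
    (ht : IsCoprime b 𝒟.modulus → 𝒟.phase c a b' = t + 𝒟.phase c a b) :
    𝒟.twist c a b' = ZMod.stdAddChar t * 𝒟.twist c a b := by
  by_cases h1 : IsCoprime b 𝒟.modulus
  · rw [twist, twist, if_pos h1, if_pos (h.1 h1), ht h1, AddChar.map_add_eq_mul]
  · rw [twist, twist, if_neg h1, if_neg (mt h.2 h1), mul_zero]

theorem stdAddChar_ne_one {t : ZMod p} (ht : t ≠ 0) : (ZMod.stdAddChar t : ℂ) ≠ 1 := fun h ↦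
  ht (ZMod.injective_stdAddChar (h.trans (AddChar.map_zero_eq_one _).symm))

variable {c a}

theorem coeff_lSeries_twist_of_ne [CharP F p] {j : Fin m} (hj : a + c j ≠ 0) {n : ℕ}
    (hn : 𝒟.modulus.natDegree + 𝒟.f.natDegree + 1 < n) :
    PowerSeries.coeff n (lSeries (𝒟.twist c a)) = 0 := by
  classical
  set M := 𝒟.modulus with hM
  have hMm : M.Monic := 𝒟.modulus_monic
  set W := ∏ i ∈ Finset.univ.erase j, (𝒟.P i).1 ^ (𝒟.e i + 1) with hW
  have hW' : ¬ (𝒟.P j).1 ∣ W := fun h ↦ by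
    obtain ⟨i, hi, h⟩ := ((𝒟.P j).2.2.prime.dvd_finsetProd_iff _).1 h
    exact FinitePlace.not_dvd_of_ne (fun h ↦ Finset.ne_of_mem_erase hi (𝒟.injective h).symm)
      ((𝒟.P j).2.2.prime.dvd_of_dvd_pow h)
  have hPW (i : Fin m) (hij : i ≠ j) : (𝒟.P i).1 ^ (𝒟.e i + 1) ∣ W :=
    Finset.dvd_prod_of_mem (fun i ↦ (𝒟.P i).1 ^ (𝒟.e i + 1))
      (Finset.mem_erase.2 ⟨hij, Finset.mem_univ i⟩)
  clear_value W
  obtain ⟨s, hs⟩ := 𝒟.exists_symbol_ne_zero j hW'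
  set g := 1 + (𝒟.P j).1 ^ 𝒟.e j * (W * s) with hg
  have hgP (i : Fin m) : (𝒟.P i).1 ∣ g - 1 := by
    rw [hg, add_sub_cancel_left]
    by_cases hij : i = j
    · rw [hij]; exact (dvd_pow_self _ (𝒟.e_pos j).ne').mul_right _
    · exact (((dvd_pow_self _ (Nat.succ_ne_zero _)).trans (hPW i hij)).mul_right s).mul_left _
  have hgd (i : Fin m) : ¬ (𝒟.P i).1 ∣ g := fun h ↦ (𝒟.P i).2.2.not_isUnit
    (isUnit_of_dvd_one ((dvd_sub_right h).1 (hgP i)))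
  have hgc : IsCoprime g M := 𝒟.isCoprime_modulus_iff.2 hgd
  have hg0 : g ≠ 0 := fun h ↦ hgd j (h ▸ dvd_zero _)
  have hgi (i : Fin m) (hij : i ≠ j) : 𝒟.symbol i (algebraMap F[X] (RatFunc F) g) = 0 := by
    rw [𝒟.symbol_congr i (hgd i) (b' := 1) (fun h ↦ (𝒟.P i).2.2.not_isUnit (isUnit_of_dvd_one h)),
      map_one, symbol_one]
    rw [hg, add_sub_cancel_left]
    exact ((hPW i hij).mul_right s).mul_left _
  set t := (a + c j) * 𝒟.symbol j (algebraMap F[X] (RatFunc F) g) with ht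
  rw [lSeries, PowerSeries.coeff_mk]
  have hrdeg (b : F[X]) : (((g - 1) * b) %ₘ M).natDegree ≤ M.natDegree :=
    natDegree_modByMonic_le _ hMm
  have hcong (b : F[X]) : M ∣ b + ((g - 1) * b) %ₘ M - g * b := by
    refine ⟨- (((g - 1) * b) /ₘ M), ?_⟩
    linear_combination modByMonic_add_div ((g - 1) * b) M
  refine sum_eq_zero_of_twist (stdAddChar_ne_one (t := t) (mul_ne_zero hj hs))
    (fun b ↦ b + ((g - 1) * b) %ₘ M) ?_ ?_ ?_
  · intro b hb
    rw [mem_monicsOfDegree] at hb ⊢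
    have := hrdeg b
    exact ⟨hb.1.add_of_left (degree_lt_degree (by omega)),
      (natDegree_add_eq_left_of_natDegree_lt (by omega)).trans hb.2⟩
  · intro b _ b' _ h
    simp only at h
    have h1 : M ∣ g * (b - b') := by
      have := dvd_sub (hcong b') (hcong b)
      rw [h] at this
      convert this using 1
      ring
    have h2 : M ∣ b - b' := hgc.symm.dvd_of_dvd_mul_left h1
    have h3 : ((g - 1) * b) %ₘ M = ((g - 1) * b') %ₘ M := by
      rw [← sub_eq_zero, ← sub_modByMonic, ← mul_sub]
      exact (modByMonic_eq_zero_iff_dvd hMm).2 (h2.mul_left _)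
    rw [h3] at h
    exact add_right_cancel h
  · intro b hb
    rw [mem_monicsOfDegree] at hb
    have h1 : IsCoprime (b + ((g - 1) * b) %ₘ M) M ↔ IsCoprime b M := by
      rw [𝒟.isCoprime_modulus_congr (hcong b), IsCoprime.mul_left_iff, and_iff_right hgc]
    refine 𝒟.twist_eq_mul c a h1.symm fun hbM ↦ ?_
    have hr := hrdeg b
    have h2 (i : Fin m) : 𝒟.symbol i (algebraMap F[X] (RatFunc F) (b + ((g - 1) * b) %ₘ M)) =
        𝒟.symbol i (algebraMap F[X] (RatFunc F) g) + 𝒟.symbol i (algebraMap F[X] (RatFunc F) b) := by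
      rw [𝒟.symbol_congr_modulus i (h1.2 hbM) (hcong b), map_mul,
        𝒟.symbol_mul i (algebraMap_ratFunc_ne_zero hg0) (algebraMap_ratFunc_ne_zero hb.1.ne_zero)]
    rw [phase, phase, 𝒟.symbolInf_add_of_lt hb.1 (by omega)]
    simp only [h2, mul_add, Finset.sum_add_distrib]
    rw [Finset.sum_eq_single j (fun i _ hi ↦ by rw [hgi i hi, mul_zero])
      (fun h ↦ (h (Finset.mem_univ j)).elim)]
    ring

theorem coeff_lSeries_twist_of_not_dvd [CharP F p] (hc : ∀ j, a + c j = 0) (ha : a ≠ 0)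
    (hf : ¬ p ∣ 𝒟.f.natDegree) {n : ℕ} (hn : 𝒟.modulus.natDegree + 𝒟.f.natDegree < n) :
    PowerSeries.coeff n (lSeries (𝒟.twist c a)) = 0 := by
  set M := 𝒟.modulus with hM
  have hMm : M.Monic := 𝒟.modulus_monic
  set d := 𝒟.f.natDegree with hd
  have hd0 : d ≠ 0 := fun h ↦ hf (h ▸ dvd_zero p)
  have hdF : (d : F) ≠ 0 := fun h ↦ hf ((CharP.cast_eq_zero_iff F p _).1 h)
  have hf0 : 𝒟.f.leadingCoeff ≠ 0 := leadingCoeff_ne_zero.2 fun h ↦ hd0 (by rw [hd, h]; simp)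
  obtain ⟨y, hy⟩ := Algebra.trace_surjective (ZMod p) F 1
  set s : F := y / (- d * 𝒟.f.leadingCoeff) with hs
  set r : F[X] := C s * (X ^ (n - d - M.natDegree) * M) with hr
  have hXM : (X ^ (n - d - M.natDegree) * M : F[X]).Monic := (monic_X_pow _).mul hMm
  have hXMd : (X ^ (n - d - M.natDegree) * M : F[X]).natDegree = n - d := by
    rw [(monic_X_pow _).natDegree_mul hMm, natDegree_X_pow]; omega
  have hrd : r.natDegree ≤ n - d := (natDegree_C_mul_le _ _).trans hXMd.le
  have hrc : r.coeff (n - d) = s := by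
    have h := hXM.coeff_natDegree
    rw [hXMd] at h
    rw [hr, coeff_C_mul, h, mul_one]
  rw [lSeries, PowerSeries.coeff_mk]
  have hπ (b : F[X]) (hb : b.Monic ∧ b.natDegree = n) :
      (b + r).Monic ∧ (b + r).natDegree = n :=
    ⟨hb.1.add_of_left (degree_lt_degree (by omega)),
      (natDegree_add_eq_left_of_natDegree_lt (by omega)).trans hb.2⟩
  refine sum_eq_zero_of_twist (stdAddChar_ne_one (t := a) ha) (fun b ↦ b + r) ?_ ?_ ?_
  · intro b hb
    rw [mem_monicsOfDegree] at hb ⊢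
    exact hπ b hb
  · exact fun b _ b' _ h ↦ add_right_cancel h
  · intro b hb
    rw [mem_monicsOfDegree] at hb
    have hcong : M ∣ b - (b + r) := by
      rw [sub_add_cancel_left, hr]
      exact ((dvd_mul_left _ _).mul_left _).neg_right
    refine 𝒟.twist_eq_mul c a (𝒟.isCoprime_modulus_congr hcong) fun _ ↦ ?_
    obtain ⟨hm', hn'⟩ := hπ b hb
    have hE : ((b + r) * b).natDegree = n + n := by rw [hm'.natDegree_mul hb.1, hn', hb.2]
    have h1 := natDegree_wronskian_le b r
    have h2 : (𝒟.f * (derivative r * b - r * derivative b)).natDegree ≤ _ := natDegree_mul_le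
    have h3 : (𝒟.f * (derivative r * b - r * derivative b)).coeff (n + n - 1) = y := by
      rw [show n + n - 1 = d + (n - d + n - 1) by omega,
        coeff_mul_add_eq_of_natDegree_le hd.ge (by omega), coeff_sub,
        show n - d + n - 1 = (n - d - 1) + n by omega,
        coeff_mul_add_eq_of_natDegree_le ((natDegree_derivative_le r).trans (by omega)) hb.2.le,
        show n - d - 1 + n = (n - d) + (n - 1) by omega,
        coeff_mul_add_eq_of_natDegree_le hrd ((natDegree_derivative_le b).trans (by omega)),
        coeff_derivative, coeff_derivative, hrc]
      have e1 : n - d - 1 + 1 = n - d := by omega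
      have e2 : n - 1 + 1 = n := by omega
      have e3 : b.coeff n = 1 := by rw [← hb.2, coeff_natDegree, hb.1.leadingCoeff]
      have e4 : ((n - d - 1 : ℕ) : F) + 1 = n - d := by
        rw [← Nat.cast_succ, Nat.succ_eq_add_one, e1, Nat.cast_sub (by omega)]
      have e5 : ((n - 1 : ℕ) : F) + 1 = n := by rw [← Nat.cast_succ, Nat.succ_eq_add_one, e2]
      rw [e1, e2, e3, e4, e5, hrc, hd, coeff_natDegree, ← hd, hs]
      field_simp
      ring
    have h4 := 𝒟.symbolInf_add hb.1 hm'
    rw [(modByMonic_eq_self_iff (hm'.mul hb.1)).2 (degree_lt_degree (by omega)), hE, h3, hy] at h4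
    simp only [phase, hc, zero_mul, Finset.sum_const_zero, zero_add, h4]
    ring

end ArtinSchreierData

end CharacterSums

section Independence

open Polynomial

theorem sum_monicsOfDegree_succ {F : Type*} [Field F] [Fintype F] {M : F[X]} (hM : M.Monic) {n : ℕ}
    (hn : M.natDegree ≤ n) {χ : F[X] → ℂ} {ω : ℂ}
    (h : ∀ b b' : F[X], b.Monic → b'.Monic → b.natDegree = n → b'.natDegree = n + 1 →
      M ∣ b' - b → χ b' = ω * χ b) :
    ∑ b ∈ monicsOfDegree F (n + 1), χ b = Fintype.card F * ω * ∑ b ∈ monicsOfDegree F n, χ b := by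
  have hdiv (s r : F[X]) (hr : r.degree < M.degree) : (s * M + r) /ₘ M = s ∧ (s * M + r) %ₘ M = r :=
    div_modByMonic_unique s r hM ⟨by ring, hr⟩
  have hmod (b : F[X]) : (b %ₘ M).degree < M.degree := degree_modByMonic_lt _ hM
  have heq (b : F[X]) : (b /ₘ M) * M + b %ₘ M = b := by
    rw [mul_comm, add_comm, modByMonic_add_div]
  have hq (b : F[X]) (hb : b.Monic) (hd : M.natDegree ≤ b.natDegree) : (b /ₘ M).Monic :=
    (leadingCoeff_divByMonic_of_monic hM
      (by rw [degree_eq_natDegree hM.ne_zero, degree_eq_natDegree hb.ne_zero]; exact_mod_cast hd)).trans hb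
  have hmon (s r : F[X]) (hs : s.Monic) (hr : r.degree < M.degree) :
      (s * M + r).Monic ∧ (s * M + r).natDegree = s.natDegree + M.natDegree := by
    have h1 : r.degree < (s * M).degree := by
      refine hr.trans_le ?_
      rw [degree_eq_natDegree hM.ne_zero, degree_eq_natDegree (hs.mul hM).ne_zero,
        hs.natDegree_mul hM]
      exact_mod_cast Nat.le_add_left _ _
    exact ⟨(hs.mul hM).add_of_left h1,
      (natDegree_eq_of_degree_eq (degree_add_eq_left_of_degree_lt h1)).trans (hs.natDegree_mul hM)⟩
  have hX (s : F[X]) (x : F) (hs : s.Monic) :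
      (s * X + C x).Monic ∧ (s * X + C x).natDegree = s.natDegree + 1 := by
    have h1 : (C x).degree < (s * X).degree := by
      rw [degree_eq_natDegree (hs.mul monic_X).ne_zero, hs.natDegree_mul monic_X, natDegree_X]
      exact degree_C_le.trans_lt (by exact_mod_cast Nat.succ_pos _)
    refine ⟨(hs.mul monic_X).add_of_left h1, ?_⟩
    rw [natDegree_eq_of_degree_eq (degree_add_eq_left_of_degree_lt h1), hs.natDegree_mul monic_X,
      natDegree_X]
  have hi (x : F) (b : F[X]) (hb : b.Monic) (hbn : b.natDegree = n) :
      (((b /ₘ M) * X + C x) * M + b %ₘ M).Monic ∧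
      (((b /ₘ M) * X + C x) * M + b %ₘ M).natDegree = n + 1 := by
    obtain ⟨h1, h2⟩ := hX (b /ₘ M) x (hq b hb (by omega))
    obtain ⟨h3, h4⟩ := hmon _ (b %ₘ M) h1 (hmod b)
    rw [h2, natDegree_divByMonic _ hM] at h4
    exact ⟨h3, by omega⟩
  have hdX (s : F[X]) (hs : s.Monic) (hd : 1 ≤ s.natDegree) : s.divX.Monic := by
    rw [Monic, leadingCoeff, natDegree_divX_eq_natDegree_tsub_one, coeff_divX,
      Nat.sub_add_cancel hd]
    exact hs.coeff_natDegree
  have key : ∑ y ∈ (Finset.univ : Finset F) ×ˢ monicsOfDegree F n, ω * χ y.2 =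
      ∑ b ∈ monicsOfDegree F (n + 1), χ b := by
    refine Finset.sum_nbij' (fun y ↦ ((y.2 /ₘ M) * X + C y.1) * M + y.2 %ₘ M)
      (fun b ↦ ((b /ₘ M).coeff 0, (b /ₘ M).divX * M + b %ₘ M)) ?_ ?_ ?_ ?_ ?_
    · rintro ⟨x, b⟩ hy
      simp only [Finset.mem_product, Finset.mem_univ, true_and, mem_monicsOfDegree] at hy ⊢
      exact hi x b hy.1 hy.2
    · intro b hb
      simp only [Finset.mem_product, Finset.mem_univ, true_and, mem_monicsOfDegree] at hb ⊢
      have h1 := hq b hb.1 (by omega)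
      have h2 : (b /ₘ M).natDegree = n + 1 - M.natDegree := by rw [natDegree_divByMonic _ hM, hb.2]
      obtain ⟨h3, h4⟩ := hmon _ (b %ₘ M) (hdX _ h1 (by omega)) (hmod b)
      rw [natDegree_divX_eq_natDegree_tsub_one] at h4
      exact ⟨h3, by omega⟩
    · rintro ⟨x, b⟩ hy
      obtain ⟨h1, h2⟩ := hdiv ((b /ₘ M) * X + C x) (b %ₘ M) (hmod b)
      simp only [h1, h2]
      have h3 : ((b /ₘ M) * X + C x).divX = b /ₘ M := by
        ext k
        rw [coeff_divX, coeff_add, coeff_mul_X, coeff_C_succ, add_zero]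
      rw [h3, heq]
      simp
    · intro b _
      obtain ⟨h1, h2⟩ := hdiv (b /ₘ M).divX (b %ₘ M) (hmod b)
      simp only [h1, h2]
      rw [divX_mul_X_add, heq]
    · rintro ⟨x, b⟩ hy
      simp only [Finset.mem_product, Finset.mem_univ, true_and, mem_monicsOfDegree] at hy ⊢
      obtain ⟨h1, h2⟩ := hi x b hy.1 hy.2
      refine (h b _ hy.1 h1 hy.2 h2 ⟨(b /ₘ M) * X + C x - b /ₘ M, ?_⟩).symm
      linear_combination heq b
  rw [← key, Finset.sum_product]
  simp only [← Finset.mul_sum]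
  rw [Finset.sum_const, Finset.card_univ, nsmul_eq_mul]
  ring

namespace ArtinSchreierData

variable {F : Type*} [Field F] {p m : ℕ} (𝒟 : ArtinSchreierData F p m)
  [Fact p.Prime] [Fintype F] [Algebra (ZMod p) F]

theorem symbolInf_of_const {c₀ : F} (hf : 𝒟.f = C c₀) {b : F[X]} (hb : b.Monic) :
    𝒟.symbolInf (algebraMap F[X] (RatFunc F) b) = b.natDegree * Algebra.trace (ZMod p) F c₀ := by
  rw [symbolInf, ratLogDeriv_algebraMap, ← mul_div_assoc, ← map_mul, coeffInv_div _ hb, hf]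
  have h1 : (C c₀ * derivative b).coeff (b.natDegree - 1) = b.natDegree • c₀ := by
    rw [coeff_C_mul, coeff_derivative]
    rcases Nat.eq_zero_or_pos b.natDegree with h | h
    · rw [eq_C_of_natDegree_eq_zero h]
      simp
    · rw [← Nat.cast_succ, Nat.succ_eq_add_one, Nat.sub_add_cancel h, hb.coeff_natDegree, one_mul,
        nsmul_eq_mul, mul_comm]
  rw [(modByMonic_eq_self_iff hb).2, h1, map_nsmul, nsmul_eq_mul]
  rcases Nat.eq_zero_or_pos b.natDegree with h | h
  · rw [eq_one_of_monic_natDegree_zero hb h]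
    simp
  · refine degree_lt_degree ((natDegree_C_mul_le _ _).trans_lt (natDegree_derivative_lt h.ne'))

theorem exists_coe_eq_lSeries_mul {c : Fin m → ZMod p} {a : ZMod p} (hc : ∀ j, a + c j = 0) {c₀ : F}
    (hf : 𝒟.f = C c₀) : ∃ g : ℂ[X], (g : PowerSeries ℂ) = lSeries (𝒟.twist c a) *
      (1 - PowerSeries.C (Fintype.card F * ZMod.stdAddChar (a * Algebra.trace (ZMod p) F c₀)) *
        PowerSeries.X) := by
  refine exists_coe_eq_of_coeff_eq_zero _ (𝒟.modulus.natDegree + 1) fun n hn ↦ ?_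
  obtain ⟨n, rfl⟩ : ∃ k, n = k + 1 := ⟨n - 1, by omega⟩
  rw [mul_sub, mul_one, map_sub, mul_left_comm, PowerSeries.coeff_C_mul,
    PowerSeries.coeff_succ_mul_X, lSeries, PowerSeries.coeff_mk, PowerSeries.coeff_mk, sub_eq_zero]
  refine sum_monicsOfDegree_succ 𝒟.modulus_monic (by omega) fun b b' hb hb' hbn hbn' h ↦ ?_
  refine 𝒟.twist_eq_mul c a (𝒟.isCoprime_modulus_congr h).symm fun _ ↦ ?_
  simp only [phase, hc, zero_mul, Finset.sum_const_zero, zero_add, 𝒟.symbolInf_of_const hf hb,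
    𝒟.symbolInf_of_const hf hb', hbn, hbn', Nat.cast_succ]
  ring

theorem sum_twist_pow (c : Fin m → ZMod p) {Q : F[X]} (hQ : IsCoprime Q 𝒟.modulus) (k : ℕ) :
    ∑ a, 𝒟.twist c a Q ^ k =
      ZMod.stdAddChar ((k : ZMod p) * ∑ j, c j * 𝒟.symbol j (algebraMap F[X] (RatFunc F) Q)) *
      if (k : ZMod p) * (∑ j, 𝒟.symbol j (algebraMap F[X] (RatFunc F) Q) +
        𝒟.symbolInf (algebraMap F[X] (RatFunc F) Q)) = 0 then (p : ℂ) else 0 := by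
  have h := AddChar.sum_mulShift ((k : ZMod p) * (∑ j, 𝒟.symbol j (algebraMap F[X] (RatFunc F) Q) +
        𝒟.symbolInf (algebraMap F[X] (RatFunc F) Q))) (ZMod.isPrimitive_stdAddChar p)
  rw [ZMod.card] at h
  rw [Nat.cast_ite, Nat.cast_zero] at h
  rw [← h, Finset.mul_sum]
  refine Finset.sum_congr rfl fun a _ ↦ ?_
  rw [twist, if_pos hQ, ← AddChar.map_nsmul_eq_pow, ← AddChar.map_add_eq_mul, phase, nsmul_eq_mul]
  congr 1
  simp only [add_mul, Finset.sum_add_distrib, ← Finset.mul_sum]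
  ring

open scoped ComplexOrder in
theorem eq_of_symbol_relation [CharP F p]
    (hf : 𝒟.f = 0 ∨ (∃ c : F, c ≠ 0 ∧ 𝒟.f = C c ∧ ¬ ∃ x : F, x ^ p - x = c) ∨
      ((¬ ∃ c : F, 𝒟.f = C c) ∧ ¬ p ∣ 𝒟.f.natDegree)) {c : Fin m → ZMod p}
    (hc : ∀ Q : FinitePlace F, (∀ i, 𝒟.P i ≠ Q) →
      ∑ j, 𝒟.symbol j (algebraMap F[X] (RatFunc F) Q.1) +
        𝒟.symbolInf (algebraMap F[X] (RatFunc F) Q.1) = 0 →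
      ∑ j, c j * 𝒟.symbol j (algebraMap F[X] (RatFunc F) Q.1) = 0) :
    (𝒟.f ≠ 0 → c = 0) ∧ (𝒟.f = 0 → ∀ i j, c i = c j) := by
  by_contra hcon
  have hp0 : (0 : ℂ) < p := by exact_mod_cast (Fact.out : p.Prime).pos
  have hbad : ∀ a, (∀ j, a + c j = 0) → a ≠ 0 ∧ 𝒟.f ≠ 0 := by
    intro a ha
    have hca (j : Fin m) : c j = - a := eq_neg_of_add_eq_zero_right (ha j)
    refine ⟨fun h ↦ hcon ⟨fun _ ↦ funext fun j ↦ by rw [hca, h, neg_zero]; rfl,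
      fun _ i j ↦ by rw [hca, hca]⟩, fun h ↦ hcon ⟨fun h' ↦ (h' h).elim,
      fun _ i j ↦ by rw [hca, hca]⟩⟩
  obtain ⟨j₀⟩ : Nonempty (Fin m) := by
    by_contra h
    rw [not_nonempty_iff] at h
    exact hcon ⟨fun _ ↦ Subsingleton.elim _ _, fun _ i ↦ isEmptyElim i⟩
  have hcop {Q : F[X]} (hQ : Q.Monic) (hQ' : Irreducible Q) (i : Fin m) :
      𝒟.P i = ⟨Q, hQ, hQ'⟩ ↔ (𝒟.P i).1 ∣ Q :=
    ⟨fun h ↦ h ▸ dvd_rfl, fun h ↦ by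
      by_contra h'; exact FinitePlace.not_dvd_of_ne h' h⟩
  have hmain : ∀ z : ℂ, ¬ 0 < z → ∀ g : ℂ[X], (∏ a, lSeries (𝒟.twist c a)) *
      (1 - PowerSeries.C z * PowerSeries.X) ≠ (g : PowerSeries ℂ) := by
    refine prod_lSeries_mul_ne_coe _ (fun a b c' hb hc' ↦ 𝒟.twist_mul c a hb hc')
      (fun a ↦ 𝒟.twist_one c a) ?_ ?_
    · intro Q k hQ hQ'
      by_cases hQM : IsCoprime Q 𝒟.modulus
      · rw [𝒟.sum_twist_pow c hQM]
        split_ifs with h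
        · have h2 : (k : ZMod p) * ∑ j, c j * 𝒟.symbol j (algebraMap F[X] (RatFunc F) Q) = 0 := by
            rcases mul_eq_zero.1 h with h | h
            · rw [h, zero_mul]
            · rw [hc ⟨Q, hQ, hQ'⟩ (fun i h ↦ 𝒟.isCoprime_modulus_iff.1 hQM i
                ((hcop hQ hQ' i).1 h)) h,
                mul_zero]
          rw [h2, AddChar.map_zero_eq_one, one_mul]
          exact hp0.le
        · rw [mul_zero]
      · refine Finset.sum_nonneg fun a _ ↦ ?_
        rw [twist, if_neg hQM]
        exact pow_nonneg le_rfl k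
    · have h1 : ¬ IsUnit (X * 𝒟.modulus + 1) := by
        refine not_isUnit_of_natDegree_pos _ ?_
        have h2 : (X * 𝒟.modulus).natDegree = 1 + 𝒟.modulus.natDegree := by
          rw [monic_X.natDegree_mul 𝒟.modulus_monic, natDegree_X]
        rw [natDegree_add_eq_left_of_natDegree_lt (by rw [h2, natDegree_one]; omega), h2]
        omega
      obtain ⟨Q, hQ, hQ', hQd⟩ := exists_monic_irreducible_factor _ h1
      have hQM : IsCoprime Q 𝒟.modulus := by
        obtain ⟨s, hs⟩ := hQd
        exact ⟨s, - X, by linear_combination - hs⟩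
      refine ⟨Q, p, hQ, hQ', (Fact.out : p.Prime).pos, fun k ↦ ?_⟩
      rw [𝒟.sum_twist_pow c hQM, if_pos (by simp)]
      simpa using hp0
  have hgood (a : ZMod p) (ha : ¬ ((∀ j, a + c j = 0) ∧ ∃ c₀, 𝒟.f = C c₀)) :
      ∃ g : ℂ[X], (g : PowerSeries ℂ) = lSeries (𝒟.twist c a) := by
    refine exists_coe_eq_of_coeff_eq_zero _ (𝒟.modulus.natDegree + 𝒟.f.natDegree + 2) fun n hn ↦ ?_
    by_cases h : ∀ j, a + c j = 0
    · rcases hf with h0 | ⟨c₀, -, h0, -⟩ | ⟨-, h0⟩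
      · exact ((hbad a h).2 h0).elim
      · exact (ha ⟨h, c₀, h0⟩).elim
      · exact 𝒟.coeff_lSeries_twist_of_not_dvd h (hbad a h).1 h0 (by omega)
    · obtain ⟨j, hj⟩ := not_forall.1 h
      exact 𝒟.coeff_lSeries_twist_of_ne hj (by omega)
  by_cases hex : ∃ a, (∀ j, a + c j = 0) ∧ ∃ c₀, 𝒟.f = C c₀
  · obtain ⟨a, ha, c₀, hc₀⟩ := hex
    obtain ⟨ha0, hf0⟩ := hbad a ha
    have hT : Algebra.trace (ZMod p) F c₀ ≠ 0 := by
      intro hT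
      obtain ⟨x, hx⟩ := exists_pow_sub_eq_of_trace_eq_zero hT
      rcases hf with h0 | ⟨c₁, -, h0, h1⟩ | ⟨h0, -⟩
      · exact hf0 h0
      · exact h1 ⟨x, by rw [hx, C_injective (hc₀.symm.trans h0)]⟩
      · exact h0 ⟨c₀, hc₀⟩
    obtain ⟨g, hg⟩ := 𝒟.exists_coe_eq_lSeries_mul ha hc₀
    choose! G hG using hgood
    refine hmain (Fintype.card F * ZMod.stdAddChar (a * Algebra.trace (ZMod p) F c₀)) ?_
      (g * ∏ a' ∈ Finset.univ.erase a, G a') ?_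
    · intro hpos
      have hcard : (0 : ℂ) < Fintype.card F := by exact_mod_cast Fintype.card_pos
      set ω : ℂ := ZMod.stdAddChar (a * Algebra.trace (ZMod p) F c₀) with hω
      have h1 : (0 : ℂ) < ω := (pos_iff_pos_of_mul_pos hpos).1 hcard
      have h2 : ‖ω‖ = 1 := Circle.norm_coe _
      refine stdAddChar_ne_one (mul_ne_zero ha0 hT) (?_ : ω = 1)
      rw [← Complex.norm_of_nonneg' h1.le, h2, Complex.ofReal_one]
    · rw [coe_mul, hg, ← Finset.mul_prod_erase _ _ (Finset.mem_univ a), mul_right_comm]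
      congr 1
      rw [← coeToPowerSeries.ringHom_apply, map_prod]
      refine Finset.prod_congr rfl fun a' ha' ↦ (hG a' fun h ↦ ?_).symm
      refine Finset.ne_of_mem_erase ha' ?_
      exact add_right_cancel ((h.1 j₀).trans (ha j₀).symm)
  · choose G hG using fun a ↦ hgood a fun h ↦ hex ⟨a, h⟩
    refine hmain 0 (lt_irrefl _) (∏ a, G a) ?_
    rw [map_zero, zero_mul, sub_zero, mul_one, ← coeToPowerSeries.ringHom_apply, map_prod]
    exact Finset.prod_congr rfl fun a _ ↦ (hG a).symm

end ArtinSchreierData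

end Independence

section GaloisAction

open FractionalIdeal

variable {A k K O : Type*} [CommRing A] [IsDomain A] [Field k] [Field K] [CommRing O]
  [IsDedekindDomain O] [Algebra A k] [IsFractionRing A k] [Algebra k K]
  [Algebra A K] [IsScalarTower A k K] [Algebra A O] [Algebra O K] [IsScalarTower A O K]
  [IsFractionRing O K] [IsIntegralClosure O A K] [FiniteDimensional k K]

theorem image_span_subset (A : Type*) {k K O : Type*} [CommRing A] [IsDomain A] [Field k] [Field K]
    [CommRing O]
    [Algebra A k] [IsFractionRing A k] [Algebra k K] [Algebra A K] [IsScalarTower A k K]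
    [Algebra A O] [Algebra O K] [IsScalarTower A O K] [IsIntegralClosure O A K]
    [FiniteDimensional k K] (σ : K ≃ₐ[k] K) (S : Set K) :
    σ '' (Submodule.span O S : Set K) ⊆ Submodule.span O (σ '' S) := by
  rintro _ ⟨x, hx, rfl⟩
  induction hx using Submodule.span_induction with
  | mem x hx => exact Submodule.subset_span ⟨x, hx, rfl⟩
  | zero => rw [map_zero]; exact Submodule.zero_mem _
  | add x y _ _ hx hy => rw [map_add]; exact Submodule.add_mem _ hx hy
  | smul a x _ hx =>
    rw [Algebra.smul_def, map_mul, ← algebraMap_galRestrict_apply A, ← Algebra.smul_def]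
    exact Submodule.smul_mem _ _ hx

/-- A function on fractional ideals is induced by `σ` if it maps `J` to the image of `J` under `σ`. -/
def IsInducedBy (σ : K ≃ₐ[k] K) (s : (FractionalIdeal O⁰ K)ˣ ≃* (FractionalIdeal O⁰ K)ˣ) : Prop :=
  ∀ J, ((s J : FractionalIdeal O⁰ K) : Set K) = σ '' ((J : FractionalIdeal O⁰ K) : Set K)

theorem IsInducedBy.coe_eq_span {σ : K ≃ₐ[k] K}
    {s : (FractionalIdeal O⁰ K)ˣ ≃* (FractionalIdeal O⁰ K)ˣ} (hs : IsInducedBy σ s) (A : Type*)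
      [CommRing A] [IsDomain A]
    [Algebra A k] [IsFractionRing A k] [Algebra A K] [IsScalarTower A k K]
    [Algebra A O] [IsScalarTower A O K] [IsIntegralClosure O A K]
    {J : (FractionalIdeal O⁰ K)ˣ} {S : Set K}
    (hJ : ((J : FractionalIdeal O⁰ K) : Submodule O K) = Submodule.span O S) :
    ((s J : FractionalIdeal O⁰ K) : Submodule O K) = Submodule.span O (σ '' S) := by
  have h : (((s J : FractionalIdeal O⁰ K) : Submodule O K) : Set K) =
      σ '' (Submodule.span O S : Set K) := by
    rw [← hJ]; exact hs J
  apply SetLike.coe_injective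
  rw [h]
  refine (image_span_subset A σ S).antisymm fun x hx ↦ ?_
  have := image_span_subset A (O := O) σ.symm (σ '' S) ⟨x, hx, rfl⟩
  rw [Set.image_image] at this
  simp only [AlgEquiv.symm_apply_apply, Set.image_id'] at this
  exact ⟨_, this, AlgEquiv.apply_symm_apply σ x⟩

theorem IsInducedBy.apply_toPrincipalIdeal {σ : K ≃ₐ[k] K}
    {s : (FractionalIdeal O⁰ K)ˣ ≃* (FractionalIdeal O⁰ K)ˣ} (hs : IsInducedBy σ s) (A : Type*)
      [CommRing A] [IsDomain A]
    [Algebra A k] [IsFractionRing A k] [Algebra A K] [IsScalarTower A k K]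
    [Algebra A O] [IsScalarTower A O K] [IsIntegralClosure O A K] (x : Kˣ) :
    s (toPrincipalIdeal O K x) = toPrincipalIdeal O K (Units.map (σ : K →* K) x) := by
  refine Units.ext (coeToSubmodule_injective ?_)
  change ((_ : FractionalIdeal O⁰ K) : Submodule O K) = ((_ : FractionalIdeal O⁰ K) : Submodule O K)
  rw [hs.coe_eq_span A (S := {(x : K)}), coe_toPrincipalIdeal, coe_spanSingleton,
    Set.image_singleton]
  · rfl
  · rw [coe_toPrincipalIdeal, coe_spanSingleton]

theorem IsInducedBy.iterate_apply_toPrincipalIdeal {σ : K ≃ₐ[k] K}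
    {s : (FractionalIdeal O⁰ K)ˣ ≃* (FractionalIdeal O⁰ K)ˣ} (hs : IsInducedBy σ s) (A : Type*)
      [CommRing A] [IsDomain A]
    [Algebra A k] [IsFractionRing A k] [Algebra A K] [IsScalarTower A k K]
    [Algebra A O] [IsScalarTower A O K] [IsIntegralClosure O A K] (x : Kˣ) (i : ℕ) :
    s^[i] (toPrincipalIdeal O K x) = toPrincipalIdeal O K (Units.map
      ((σ ^ i : K ≃ₐ[k] K) : K →* K) x) := by
  induction i with
  | zero => simp only [Function.iterate_zero, id, pow_zero]; congr 1
  | succ i ih =>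
    rw [Function.iterate_succ_apply', ih, hs.apply_toPrincipalIdeal A]
    congr 1
    ext
    simp [pow_succ']

/-- If `σ` generates the Galois group, of order `p`, this is the ideal norm, extended to `O`. -/
noncomputable def orbitProd (s : (FractionalIdeal O⁰ K)ˣ ≃* (FractionalIdeal O⁰ K)ˣ) (p : ℕ) :
    (FractionalIdeal O⁰ K)ˣ →* (FractionalIdeal O⁰ K)ˣ where
  toFun J := ∏ i ∈ Finset.range p, s^[i] J
  map_one' := Finset.prod_eq_one fun i _ ↦ iterate_map_one s i
  map_mul' J J' := by
    rw [← Finset.prod_mul_distrib]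
    exact Finset.prod_congr rfl fun i _ ↦ iterate_map_mul s i J J'

theorem orbitProd_apply (s : (FractionalIdeal O⁰ K)ˣ ≃* (FractionalIdeal O⁰ K)ˣ) (p : ℕ)
    (J : (FractionalIdeal O⁰ K)ˣ) : orbitProd s p J = ∏ i ∈ Finset.range p, s^[i] J := rfl

theorem orbitProd_of_eq {s : (FractionalIdeal O⁰ K)ˣ ≃* (FractionalIdeal O⁰ K)ˣ} {p : ℕ}
    {J : (FractionalIdeal O⁰ K)ˣ} (hJ : s J = J) : orbitProd s p J = J ^ p := by
  rw [orbitProd_apply, Finset.prod_eq_pow_card (b := J), Finset.card_range]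
  exact fun i _ ↦ Function.iterate_fixed hJ i

theorem orbitProd_map {s : (FractionalIdeal O⁰ K)ˣ ≃* (FractionalIdeal O⁰ K)ˣ} {p : ℕ}
    {J : (FractionalIdeal O⁰ K)ˣ} (hJ : s^[p] J = J) : orbitProd s p (s J) = orbitProd s p J := by
  rw [orbitProd_apply, orbitProd_apply]
  have h1 := Finset.prod_range_succ (fun i ↦ s^[i] J) p
  rw [Finset.prod_range_succ', hJ] at h1
  exact mul_right_cancel h1

theorem prod_range_pow_eq_norm [IsGalois k K] {σ : K ≃ₐ[k] K}
    (hσ : ∀ τ : K ≃ₐ[k] K, τ ∈ Subgroup.zpowers σ) (x : K) :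
    ∏ i ∈ Finset.range (Module.finrank k K), (σ ^ i : K ≃ₐ[k] K) x =
      algebraMap k K (Algebra.norm k x) := by
  classical
  have ho : orderOf σ = Module.finrank k K := by
    rw [← IsGalois.card_aut_eq_finrank k K, orderOf_eq_card_of_forall_mem_zpowers hσ]
  rw [Algebra.norm_eq_prod_automorphisms, ← ho]
  symm
  rw [← IsCyclic.image_range_orderOf hσ, Finset.prod_image]
  intro i hi j hj h
  exact pow_injOn_Iio_orderOf (by simpa using hi) (by simpa using hj) h

theorem IsInducedBy.iterate_finrank [IsGalois k K] {σ : K ≃ₐ[k] K}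
    (hσ : ∀ τ : K ≃ₐ[k] K, τ ∈ Subgroup.zpowers σ)
    {s : (FractionalIdeal O⁰ K)ˣ ≃* (FractionalIdeal O⁰ K)ˣ} (hs : IsInducedBy σ s)
    (J : (FractionalIdeal O⁰ K)ˣ) : s^[Module.finrank k K] J = J := by
  have ho : orderOf σ = Module.finrank k K := by
    rw [← IsGalois.card_aut_eq_finrank k K, orderOf_eq_card_of_forall_mem_zpowers hσ]
  have h : ∀ i, ((s^[i] J : (FractionalIdeal O⁰ K)ˣ) : Set K) =
      (σ ^ i : K ≃ₐ[k] K) '' ((J : FractionalIdeal O⁰ K) : Set K) := by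
    intro i
    induction i with
    | zero => exact (Set.image_id _).symm
    | succ i ih =>
      rw [Function.iterate_succ_apply', hs, ih, Set.image_image, pow_succ']
      rfl
  apply Units.ext
  apply SetLike.coe_injective
  rw [h, ← ho, pow_orderOf_eq_one]
  exact Set.image_id _

theorem IsInducedBy.orbitProd_principal [IsGalois k K] {σ : K ≃ₐ[k] K}
    (hσ : ∀ τ : K ≃ₐ[k] K, τ ∈ Subgroup.zpowers σ)
    {s : (FractionalIdeal O⁰ K)ˣ ≃* (FractionalIdeal O⁰ K)ˣ} (hs : IsInducedBy σ s) (A : Type*)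
      [CommRing A] [IsDomain A]
    [Algebra A k] [IsFractionRing A k] [Algebra A K] [IsScalarTower A k K]
    [Algebra A O] [IsScalarTower A O K] [IsIntegralClosure O A K] (x : Kˣ) :
    orbitProd s (Module.finrank k K) (toPrincipalIdeal O K x) =
      toPrincipalIdeal O K (Units.map (algebraMap k K : k →* K) (Units.map (Algebra.norm k) x)) := by
  rw [orbitProd_apply, Finset.prod_congr rfl fun i _ ↦ hs.iterate_apply_toPrincipalIdeal A x i,
    ← map_prod]
  congr 1
  ext
  simp only [Units.coe_prod, Units.coe_map, MonoidHom.coe_coe]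
  exact prod_range_pow_eq_norm hσ _

end GaloisAction

section OrbitProd

open FractionalIdeal

variable {A k K O : Type*} [CommRing A] [IsDomain A] [Field k] [Field K] [CommRing O]
  [IsDedekindDomain O] [Algebra A k] [IsFractionRing A k] [Algebra k K]
  [Algebra A K] [IsScalarTower A k K] [Algebra A O] [Algebra O K] [IsScalarTower A O K]
  [IsFractionRing O K] [IsIntegralClosure O A K] [FiniteDimensional k K]

/-- In a Galois extension, the ideal norm is the product of the conjugates. -/
theorem map_relNorm_eq_prod {A : Type*} [CommRing A] [Algebra A k] [IsFractionRing A k]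
    [Algebra A K] [IsScalarTower A k K] [Algebra A O] [IsScalarTower A O K]
      [IsIntegralClosure O A K]
    [IsDedekindDomain A] [Module.Finite A O] [Module.IsTorsionFree A O]
    [IsGalois k K] {σ : K ≃ₐ[k] K} (hσ : ∀ τ : K ≃ₐ[k] K, τ ∈ Subgroup.zpowers σ) {I : Ideal O}
    (hI : I ≠ ⊥) :
    (Ideal.relNorm A I).map (algebraMap A O) =
      ∏ i ∈ Finset.range (Module.finrank k K), I.map (galRestrict A k K O (σ ^ i)) := by
  have hdvd : ∏ i ∈ Finset.range (Module.finrank k K), I.map (galRestrict A k K O (σ ^ i)) ∣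
      (Ideal.relNorm A I).map (algebraMap A O) := by
    rw [Ideal.dvd_iff_le, Ideal.relNorm_apply, Ideal.map_span, Ideal.span_le]
    rintro _ ⟨_, ⟨x, hx, rfl⟩, rfl⟩
    have : algebraMap A O (Algebra.intNorm A O x) =
        ∏ i ∈ Finset.range (Module.finrank k K), galRestrict A k K O (σ ^ i) x := by
      apply IsIntegralClosure.algebraMap_injective O A K
      rw [← IsScalarTower.algebraMap_apply, IsScalarTower.algebraMap_apply A k K,
        Algebra.algebraMap_intNorm (A := A) (K := k) (L := K) (B := O), map_prod,
        ← prod_range_pow_eq_norm hσ]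
      exact Finset.prod_congr rfl fun i _ ↦ (algebraMap_galRestrict_apply ..).symm
    rw [this]
    exact Ideal.prod_mem_prod fun i _ ↦ Ideal.mem_map_of_mem _ hx
  obtain ⟨U, hU⟩ := hdvd
  have hfr : Module.finrank A O = Module.finrank k K :=
    (IsFractionRing.finrank_eq A k O K).symm
  have h1 := congrArg (Ideal.relNorm A) hU
  rw [Ideal.relNorm_algebraMap, map_mul, map_prod, hfr] at h1
  simp only [Ideal.relNorm_map_algEquiv, Finset.prod_const, Finset.card_range] at h1
  have h2 : Ideal.relNorm A U = 1 := by
    have : (Ideal.relNorm A I) ^ Module.finrank k K ≠ 0 := pow_ne_zero _ (by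
      simpa [Ideal.zero_eq_bot] using hI)
    exact mul_left_cancel₀ this (by rw [← h1, mul_one])
  have h3 : U = ⊤ := by
    have := Ideal.relNorm_le_comap (R := A) U
    rw [h2, Ideal.one_eq_top, top_le_iff, Ideal.comap_eq_top_iff] at this
    exact this
  rw [hU, h3, Ideal.mul_top]

theorem exists_orbitProd_eq [IsPrincipalIdealRing A] [Module.Finite A O] [Module.IsTorsionFree A O]
    [IsGalois k K] {σ : K ≃ₐ[k] K} (hσ : ∀ τ : K ≃ₐ[k] K, τ ∈ Subgroup.zpowers σ)
    {s : (FractionalIdeal O⁰ K)ˣ ≃* (FractionalIdeal O⁰ K)ˣ} (hs : IsInducedBy σ s)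
    (J : (FractionalIdeal O⁰ K)ˣ) :
    ∃ b : kˣ, orbitProd s (Module.finrank k K) J =
      toPrincipalIdeal O K (Units.map (algebraMap k K : k →* K) b) := by
  obtain ⟨a, I, ha, hJ⟩ := exists_eq_spanSingleton_mul (J : FractionalIdeal O⁰ K)
  have ha' : algebraMap O K a ≠ 0 := by simpa using ha
  let y : Kˣ := Units.mk0 _ ha'
  have hI : (I : FractionalIdeal O⁰ K) = ((toPrincipalIdeal O K y * J :
    (FractionalIdeal O⁰ K)ˣ) : FractionalIdeal O⁰ K) := by
    rw [Units.val_mul, coe_toPrincipalIdeal, hJ, ← mul_assoc, spanSingleton_mul_spanSingleton]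
    simp [y, ha']
  have hIbot : I ≠ ⊥ := by
    rintro rfl
    rw [coeIdeal_bot] at hI
    exact Units.ne_zero _ hI.symm
  have hA : IsDedekindDomain A := inferInstance
  obtain ⟨g, hg⟩ := IsPrincipalIdealRing.principal (Ideal.relNorm A I)
  rw [Ideal.submodule_span_eq] at hg
  have hg0 : algebraMap A k g ≠ 0 := by
    intro h
    rw [FaithfulSMul.algebraMap_eq_zero_iff] at h
    rw [h, Ideal.span_singleton_eq_bot.2 rfl, Ideal.relNorm_eq_bot_iff] at hg
    exact hIbot hg
  have key : orbitProd s (Module.finrank k K) (toPrincipalIdeal O K y * J) =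
      toPrincipalIdeal O K (Units.map (algebraMap k K : k →* K) (Units.mk0 _ hg0)) := by
    apply Units.ext
    have h0 : ∀ i, ((s^[i] (toPrincipalIdeal O K y * J) :
      (FractionalIdeal O⁰ K)ˣ) : FractionalIdeal O⁰ K) =
        (I.map (galRestrict A k K O (σ ^ i)) : Ideal O) := by
      intro i
      induction i with
      | zero =>
        rw [Function.iterate_zero, id, ← hI, pow_zero, map_one]
        congr 1
        exact (Ideal.map_id I).symm
      | succ i ih =>
        rw [Function.iterate_succ_apply']
        apply coeToSubmodule_injective
        change ((_ : FractionalIdeal O⁰ K) : Submodule O K) = _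
        rw [hs.coe_eq_span A (S := algebraMap O K '' (galRestrict A k K O (σ ^ i) '' I))]
        · change _ = (((_ : Ideal O) : FractionalIdeal O⁰ K) : Submodule O K)
          rw [coe_coeIdeal, Ideal.map, IsLocalization.coeSubmodule_span]
          congr 1
          rw [Set.image_image, Set.image_image, Set.image_image]
          refine Set.image_congr fun x _ ↦ ?_
          change σ _ = algebraMap O K _
          erw [algebraMap_galRestrict_apply, algebraMap_galRestrict_apply, pow_succ']
          rfl
        · rw [ih, coe_coeIdeal, Ideal.map, IsLocalization.coeSubmodule_span]
    rw [orbitProd_apply, Units.coe_prod, Finset.prod_congr rfl fun i _ ↦ h0 i,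
      coe_toPrincipalIdeal]
    have h2 := map_relNorm_eq_prod (A := A) (O := O) hσ hIbot
    rw [hg, Ideal.map_span, Set.image_singleton] at h2
    have h3 := congrArg (fun T : Ideal O ↦ (T : FractionalIdeal O⁰ K)) h2
    simp only [coeIdeal_span_singleton] at h3
    rw [← IsScalarTower.algebraMap_apply] at h3
    have h4 : ∀ (t : Finset ℕ) (G : ℕ → Ideal O), ((∏ i ∈ t,
      G i : Ideal O) : FractionalIdeal O⁰ K) =
        ∏ i ∈ t, (G i : FractionalIdeal O⁰ K) := fun t G ↦ map_prod (coeIdealHom O⁰ K) G t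
    rw [h4] at h3
    rw [← h3, Units.coe_map, Units.val_mk0]
    simp only [MonoidHom.coe_coe]
    rw [← IsScalarTower.algebraMap_apply]
  rw [map_mul, hs.orbitProd_principal hσ A] at key
  refine ⟨(Units.map (Algebra.norm k) y)⁻¹ * Units.mk0 _ hg0, ?_⟩
  rw [map_mul, map_mul, ← key, map_inv, map_inv, inv_mul_cancel_left]

theorem fractionalIdeal_pow_injective {J J' : (FractionalIdeal O⁰ K)ˣ} {n : ℕ} (hn : n ≠ 0)
    (h : J ^ n = J' ^ n) : J = J' := by
  have hc : ∀ v : IsDedekindDomain.HeightOneSpectrum O,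
      count K v (J : FractionalIdeal O⁰ K) = count K v (J' : FractionalIdeal O⁰ K) := by
    intro v
    have := congrArg (fun I : (FractionalIdeal O⁰ K)ˣ ↦ count K v (I : FractionalIdeal O⁰ K)) h
    simp only [Units.val_pow_eq_pow_val, count_pow] at this
    exact mul_left_cancel₀ (Int.natCast_ne_zero.2 hn) this
  apply Units.ext
  rw [← finprod_heightOneSpectrum_factorization' K J.ne_zero,
    ← finprod_heightOneSpectrum_factorization' K J'.ne_zero]
  exact finprod_congr fun v ↦ by rw [hc]

theorem exists_unit_of_toPrincipalIdeal_eq_one {x : Kˣ} (h : toPrincipalIdeal O K x = 1) :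
    ∃ u : Oˣ, algebraMap O K u = x := by
  have hmem : ∀ y : Kˣ, toPrincipalIdeal O K y = 1 → ∃ a : O, algebraMap O K a = y := by
    intro y hy
    rw [toPrincipalIdeal_eq_iff, Units.val_one] at hy
    have : (y : K) ∈ (1 : FractionalIdeal O⁰ K) := by rw [← hy]; exact mem_spanSingleton_self _ _
    exact (mem_one_iff O⁰).1 this
  obtain ⟨a, ha⟩ := hmem x h
  obtain ⟨b, hb⟩ := hmem x⁻¹ (by rw [map_inv, h, inv_one])
  have hab : a * b = 1 := by
    apply IsFractionRing.injective O K
    rw [map_mul, ha, hb, map_one, Units.mul_inv]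
  exact ⟨⟨a, b, hab, by rw [mul_comm, hab]⟩, ha⟩

theorem exists_unit_of_toPrincipalIdeal_map_eq_one [IsIntegrallyClosed A] {b : kˣ}
    (h : toPrincipalIdeal O K (Units.map (algebraMap k K : k →* K) b) = 1) :
    ∃ u : Aˣ, algebraMap A k u = b := by
  have hmem : ∀ y : kˣ, toPrincipalIdeal O K (Units.map (algebraMap k K : k →* K) y) = 1 →
      ∃ a : A, algebraMap A k a = y := by
    intro y hy
    obtain ⟨u, hu⟩ := exists_unit_of_toPrincipalIdeal_eq_one hy
    apply IsIntegrallyClosed.isIntegral_iff.1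
    rw [← isIntegral_algebraMap_iff (algebraMap k K).injective]
    change IsIntegral A (Units.map (algebraMap k K : k →* K) y : K)
    rw [← hu]
    exact (IsIntegralClosure.isIntegral A K (u : O)).algebraMap
  obtain ⟨a, ha⟩ := hmem b h
  obtain ⟨c, hc⟩ := hmem b⁻¹ (by rw [map_inv, map_inv, h, inv_one])
  have hac : a * c = 1 := by
    apply IsFractionRing.injective A k
    rw [map_mul, ha, hc, map_one, Units.mul_inv]
  exact ⟨⟨a, c, hac, by rw [mul_comm, hac]⟩, ha⟩

theorem toPrincipalIdeal_unit (u : Oˣ) {x : Kˣ} (h : algebraMap O K u = x) :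
    toPrincipalIdeal O K x = 1 := by
  have h1 : ∀ y : Kˣ, (∃ a : O, algebraMap O K a = y) →
      (toPrincipalIdeal O K y : FractionalIdeal O⁰ K) ≤ 1 := by
    rintro y ⟨a, ha⟩
    rw [coe_toPrincipalIdeal, spanSingleton_le_iff_mem, mem_one_iff]
    exact ⟨a, ha⟩
  apply Units.ext
  refine le_antisymm (h1 x ⟨u, h⟩) ?_
  have h2 := h1 x⁻¹ ⟨(u⁻¹ : Oˣ), by
    rw [Units.val_inv_eq_inv_val, ← mul_eq_one_iff_eq_inv₀ x.ne_zero, ← h, ← map_mul,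
      Units.inv_mul, map_one]⟩
  have h3 := mul_le_mul_right h2 (toPrincipalIdeal O K x : FractionalIdeal O⁰ K)
  simpa [-coe_toPrincipalIdeal, ← Units.val_mul, ← map_mul] using h3

end OrbitProd

section ArtinSchreierGenerator

open Polynomial

variable {p : ℕ} [Fact p.Prime]

theorem natCast_pow_char {R : Type*} [CommRing R] [CharP R p] (n : ℕ) : (n : R) ^ p = n := by
  have := map_natCast (frobenius R p) n
  rwa [frobenius_def] at this

theorem prod_range_add_mul_natCast {R : Type*} [CommRing R] [CharP R p] (y : R) {n : ℕ}
    (hn : ¬ p ∣ n) : ∏ i ∈ Finset.range p, (y + i * n) = y ^ p - y := by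
  have h1 : ∏ a : ZMod p, (X - C a) = (X ^ p - X : (ZMod p)[X]) := by
    have hroots : (X ^ p - X : (ZMod p)[X]).roots = Finset.univ.val := by
      have := FiniteField.roots_X_pow_card_sub_X (ZMod p)
      rwa [ZMod.card] at this
    have hp1 := (Fact.out : p.Prime).one_lt
    have hmonic : (X ^ p - X : (ZMod p)[X]).Monic :=
      monic_X_pow_sub (by rw [degree_X]; exact_mod_cast hp1)
    have := prod_multiset_X_sub_C_of_monic_of_roots_card_eq hmonic (by
      rw [hroots, FiniteField.X_pow_card_sub_X_natDegree_eq _ hp1]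
      simp [ZMod.card])
    rw [hroots] at this
    exact this
  have h2 : ∏ a : ZMod p, (y + ZMod.castHom dvd_rfl R a) = y ^ p - y := by
    have := congrArg (eval₂ (ZMod.castHom dvd_rfl R) y) h1
    rw [eval₂_finsetProd] at this
    simp only [eval₂_sub, eval₂_X, eval₂_C, eval₂_pow] at this
    rw [← this, ← Equiv.prod_comp (Equiv.neg _)]
    refine Finset.prod_congr rfl fun a _ ↦ ?_
    rw [Equiv.neg_apply, map_neg, sub_eq_add_neg]
  rw [← h2]
  have hn' : (n : ZMod p) ≠ 0 := by rwa [Ne, ZMod.natCast_eq_zero_iff]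
  have hinj : Set.InjOn (fun i : ℕ ↦ (i * n : ZMod p)) (Finset.range p) := by
    intro i hi j hj h
    have h3 := mul_right_cancel₀ hn' h
    rw [ZMod.natCast_eq_natCast_iff'] at h3
    rwa [Nat.mod_eq_of_lt (by simpa using hi), Nat.mod_eq_of_lt (by simpa using hj)] at h3
  have himg : (Finset.range p).image (fun i : ℕ ↦ (i * n : ZMod p)) = Finset.univ := by
    apply Finset.eq_univ_of_card
    rw [Finset.card_image_of_injOn hinj, Finset.card_range, ZMod.card]
  rw [← himg, Finset.prod_image hinj]
  simp

/-- A generator of the Galois group of an Artin-Schreier extension is a translation. -/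
theorem exists_apply_eq_add_natCast {k K : Type*} [Field k] [Field K] [Algebra k K] [CharP K p]
    {α : K} {D : k} (hα : α ^ p - α = algebraMap k K D) (hadj : Algebra.adjoin k {α} = ⊤)
    {σ : K ≃ₐ[k] K} (hσ : σ ≠ 1) : ∃ n : ℕ, ¬ p ∣ n ∧ σ α = α + n := by
  have h1 : (σ α - α) ^ p - (σ α - α) = 0 := by
    have := congrArg σ hα
    rw [map_sub, map_pow, AlgEquiv.commutes, ← hα] at this
    rw [sub_pow_char]
    linear_combination this
  have hp1 : ¬ p ∣ 1 := (Fact.out : p.Prime).one_lt.ne' ∘ Nat.dvd_one.1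
  rw [← neg_eq_zero, neg_sub, ← neg_sub, neg_eq_zero, ← prod_range_add_mul_natCast _ hp1,
    Finset.prod_eq_zero_iff] at h1
  obtain ⟨i, hi, h⟩ := h1
  have hchar : (p : K) = 0 := CharP.cast_eq_zero K p
  have hip : i < p := by simpa using hi
  refine ⟨p - i, fun hd ↦ ?_, ?_⟩
  · have h0 : i = 0 := by
      have := (Nat.dvd_sub_iff_right hip.le dvd_rfl).1 hd
      exact Nat.eq_zero_of_dvd_of_lt this hip
    subst h0
    refine hσ (AlgEquiv.ext fun x ↦ ?_)
    have hx : x ∈ Algebra.adjoin k {α} := hadj ▸ Algebra.mem_top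
    have hle : Algebra.adjoin k {α} ≤ AlgHom.equalizer (σ : K →ₐ[k] K) (AlgHom.id k K) := by
      rw [Algebra.adjoin_le_iff, Set.singleton_subset_iff]
      change σ α = α
      simpa [sub_eq_zero] using h
    exact hle hx
  · rw [Nat.cast_sub hip.le, hchar]
    push_cast at h
    linear_combination h

theorem pow_apply_eq_add {k K : Type*} [Field k] [Field K] [Algebra k K] {α : K}
    {σ : K ≃ₐ[k] K} {n : ℕ} (hσ : σ α = α + n) (i : ℕ) :
    (σ ^ i : K ≃ₐ[k] K) α = α + i * n := by
  induction i with
  | zero => simp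
  | succ i ih =>
    rw [pow_succ', AlgEquiv.mul_apply, ih, map_add, hσ]
    simp
    ring

end ArtinSchreierGenerator

section IntegralGenerator

open Polynomial

variable {F : Type*} [Field F] {p m : ℕ} (𝒟 : ArtinSchreierData F p m)

namespace ArtinSchreierData

/-- The common denominator of the Artin-Schreier data. -/
noncomputable def denom : F[X] := ∏ i, (𝒟.P i).1 ^ 𝒟.e i

theorem denom_ne_zero : 𝒟.denom ≠ 0 := by
  rw [denom]
  exact (monic_prod_of_monic _ _ fun i _ ↦ (𝒟.P i).2.1.pow _).ne_zero

/-- The prime-to-`P i` part of the common denominator. -/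
noncomputable def codenom (i : Fin m) : F[X] :=
  ∏ j ∈ Finset.univ.erase i, (𝒟.P j).1 ^ 𝒟.e j

theorem pow_mul_codenom (i : Fin m) : (𝒟.P i).1 ^ 𝒟.e i * 𝒟.codenom i = 𝒟.denom := by
  rw [codenom, denom]
  exact Finset.mul_prod_erase Finset.univ (fun j ↦ (𝒟.P j).1 ^ 𝒟.e j) (Finset.mem_univ i)

theorem not_dvd_denom {P : FinitePlace F} (h : ∀ i, 𝒟.P i ≠ P) : ¬ P.1 ∣ 𝒟.denom := by
  rw [denom, P.2.2.prime.dvd_finsetProd_iff]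
  rintro ⟨i, _, hi⟩
  exact FinitePlace.not_dvd_of_ne (h i).symm (P.2.2.prime.dvd_of_dvd_pow hi)

theorem not_dvd_codenom (i : Fin m) : ¬ (𝒟.P i).1 ∣ 𝒟.codenom i := by
  rw [codenom, (𝒟.P i).2.2.prime.dvd_finsetProd_iff]
  rintro ⟨j, hj, hd⟩
  exact FinitePlace.not_dvd_of_ne (𝒟.injective.ne (Finset.ne_of_mem_erase hj).symm)
    ((𝒟.P i).2.2.prime.dvd_of_dvd_pow hd)

/-- The numerator of `D` over the common denominator. -/
noncomputable def num : F[X] :=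
  ∑ i, 𝒟.codenom i * 𝒟.Q i + 𝒟.denom * 𝒟.f

theorem denom_mul_D : algebraMap F[X] (RatFunc F) 𝒟.denom * 𝒟.D =
    algebraMap F[X] (RatFunc F) 𝒟.num := by
  rw [D, num, map_add, map_mul, map_sum, mul_add, Finset.mul_sum]
  congr 1
  refine Finset.sum_congr rfl fun i _ ↦ ?_
  rw [polar, ← 𝒟.pow_mul_codenom i, map_mul, map_mul]
  have := algebraMap_ratFunc_ne_zero (pow_ne_zero (𝒟.e i) (𝒟.P i).2.2.ne_zero)
  field_simp

theorem not_dvd_num (i : Fin m) : ¬ (𝒟.P i).1 ∣ 𝒟.num := by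
  have hP := (𝒟.P i).2.2.prime
  have hdvd : ∀ j, j ≠ i → (𝒟.P i).1 ∣ 𝒟.codenom j := fun j hj ↦
    (dvd_pow_self _ (𝒟.e_pos i).ne').trans (Finset.dvd_prod_of_mem (fun l ↦ (𝒟.P l).1 ^ 𝒟.e l)
      (Finset.mem_erase.2 ⟨hj.symm, Finset.mem_univ i⟩))
  have h1 : (𝒟.P i).1 ∣ 𝒟.denom * 𝒟.f := by
    rw [← 𝒟.pow_mul_codenom i, mul_assoc]
    exact (dvd_pow_self _ (𝒟.e_pos i).ne').mul_right _
  rw [num, dvd_add_left h1, ← Finset.add_sum_erase _ _ (Finset.mem_univ i), dvd_add_left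
    (Finset.dvd_sum fun j hj ↦ (hdvd j (Finset.ne_of_mem_erase hj)).mul_right _)]
  intro h
  rcases hP.dvd_or_dvd h with h | h
  · exact 𝒟.not_dvd_codenom i h
  · exact (𝒟.P i).2.2.coprime_iff_not_dvd.1 (𝒟.coprime i) h

end ArtinSchreierData
end IntegralGenerator

section SpanPair

theorem span_singleton_mul_span_pair_pow_le {R : Type*} [CommRing R] {a b z : R} (n : ℕ) :
    ∀ c : R, (∀ i j, i + j = n → z ∣ c * a ^ i * b ^ j) →
      Ideal.span {c} * Ideal.span {a, b} ^ n ≤ Ideal.span {z} := by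
  induction n with
  | zero =>
    intro c h
    rw [pow_zero, mul_one, Ideal.span_singleton_le_span_singleton]
    simpa using h 0 0 rfl
  | succ n ih =>
    intro c h
    have h1 := ih (c * a) fun i j hij ↦ by
      have := h (i + 1) j (by omega)
      rwa [pow_succ', ← mul_assoc] at this
    have h2 := ih (c * b) fun i j hij ↦ by
      have := h i (j + 1) (by omega)
      rwa [pow_succ', ← mul_assoc, mul_right_comm c] at this
    rw [pow_succ', ← mul_assoc, Ideal.span_insert, Ideal.mul_sup,
      Ideal.span_singleton_mul_span_singleton, Ideal.span_singleton_mul_span_singleton,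
        Ideal.sup_mul,
      ← Ideal.span_insert]
    exact sup_le h1 h2

theorem prod_span_pair_le {R ι : Type*} [CommRing R] (q : R) (s : Finset ι) (a : ι → R) :
    ∏ i ∈ s, Ideal.span {q, a i} ≤ Ideal.span {q, ∏ i ∈ s, a i} := by
  classical
  induction s using Finset.induction_on with
  | empty =>
    rw [Finset.prod_empty, Finset.prod_empty, Ideal.one_eq_top]
    exact ((Ideal.eq_top_iff_one _).2 (Ideal.subset_span
      (Set.mem_insert_of_mem _ (Set.mem_singleton _)))).ge
  | insert i t hi ih =>
    rw [Finset.prod_insert hi, Finset.prod_insert hi]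
    refine (Ideal.mul_mono_right ih).trans ?_
    rw [Ideal.mul_le]
    intro x hx y hy
    obtain ⟨x1, x2, hx⟩ := Ideal.mem_span_pair.1 hx
    obtain ⟨y1, y2, hy⟩ := Ideal.mem_span_pair.1 hy
    rw [← hx, ← hy, Ideal.mem_span_pair]
    exact ⟨x1 * (y1 * q + y2 * ∏ i ∈ t, a i) + x2 * a i * y1, x2 * y2, by ring⟩

theorem le_prod_span_pair {R ι : Type*} [CommRing R] {q : R} {s : Finset ι} {a : ι → R}
    (hs : (s : Set ι).Pairwise fun i j ↦ IsCoprime q (a i - a j)) :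
    Ideal.span {q} ≤ ∏ i ∈ s, Ideal.span {q, a i} := by
  classical
  induction s using Finset.induction_on with
  | empty =>
    rw [Finset.prod_empty, Ideal.one_eq_top]
    exact le_top
  | insert i t hi ih =>
    rw [Finset.prod_insert hi, Ideal.mul_eq_inf_of_coprime]
    · refine le_inf ?_ (ih (hs.mono (Finset.coe_subset.2 (Finset.subset_insert _ _))))
      exact Ideal.span_mono (Set.singleton_subset_iff.2 (Set.mem_insert _ _))
    · refine Ideal.sup_prod_eq_top fun j hj ↦ ?_
      obtain ⟨u, v, huv⟩ := hs (Finset.mem_insert_self i t) (Finset.mem_insert_of_mem hj)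
        (fun h ↦ hi (h ▸ hj))
      rw [Ideal.eq_top_iff_one, ← huv]
      refine Submodule.mem_sup.2 ⟨u * q + v * a i, Ideal.mem_span_pair.2 ⟨u, v, rfl⟩,
        -v * a j, Ideal.mul_mem_left _ _ (Ideal.subset_span (Or.inr rfl)), by ring⟩

theorem prod_span_pair_eq {R ι : Type*} [CommRing R] {q : R} {s : Finset ι} {a : ι → R}
    (hs : (s : Set ι).Pairwise fun i j ↦ IsCoprime q (a i - a j)) (hd : q ∣ ∏ i ∈ s, a i) :
    ∏ i ∈ s, Ideal.span {q, a i} = Ideal.span {q} := by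
  refine ((prod_span_pair_le q s a).trans (Ideal.span_le.2 ?_)).antisymm (le_prod_span_pair hs)
  intro x hx
  rcases hx with hx | hx
  · exact hx ▸ Ideal.mem_span_singleton_self _
  · exact hx ▸ Ideal.mem_span_singleton.2 hd

end SpanPair

section IntegralClosureOfPolynomial

open Polynomial FractionalIdeal

theorem sum_range_pow_eq_trace {k K : Type*} [Field k] [Field K] [Algebra k K]
    [FiniteDimensional k K] [IsGalois k K] {σ : K ≃ₐ[k] K}
    (hσ : ∀ τ : K ≃ₐ[k] K, τ ∈ Subgroup.zpowers σ) (x : K) :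
    ∑ i ∈ Finset.range (Module.finrank k K), (σ ^ i : K ≃ₐ[k] K) x =
      algebraMap k K (Algebra.trace k K x) := by
  classical
  have ho : orderOf σ = Module.finrank k K := by
    rw [← IsGalois.card_aut_eq_finrank k K, orderOf_eq_card_of_forall_mem_zpowers hσ]
  rw [trace_eq_sum_automorphisms, ← ho]
  symm
  rw [← IsCyclic.image_range_orderOf hσ, Finset.sum_image]
  intro i hi j hj h
  exact pow_injOn_Iio_orderOf (by simpa using hi) (by simpa using hj) h

theorem algebraMap_dvd_iff {F : Type*} [Field F] (K : Type*) [Field K] [Algebra (RatFunc F) K]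
    [Algebra F[X] K] [IsScalarTower F[X] (RatFunc F) K] {O : Type*} [CommRing O]
      [IsDedekindDomain O]
    [Algebra F[X] O] [Algebra O K] [IsScalarTower F[X] O K] [IsIntegralClosure O F[X] K]
    {a b : F[X]} (ha : a ≠ 0) : algebraMap F[X] O a ∣ algebraMap F[X] O b ↔ a ∣ b := by
  refine ⟨?_, map_dvd _⟩
  rintro ⟨c, hc⟩
  have ha' := algebraMap_ratFunc_ne_zero ha
  have h1 : algebraMap (RatFunc F) K (algebraMap F[X] _ b / algebraMap F[X] _ a) =
    algebraMap O K c := by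
    have h2 := congrArg (algebraMap O K) hc
    rw [map_mul, ← IsScalarTower.algebraMap_apply, ← IsScalarTower.algebraMap_apply,
      IsScalarTower.algebraMap_apply F[X] (RatFunc F) K,
      IsScalarTower.algebraMap_apply F[X] (RatFunc F) K a] at h2
    rw [map_div₀, h2, mul_div_cancel_left₀]
    exact (_root_.map_ne_zero _).2 ha'
  have h3 : IsIntegral F[X] (algebraMap F[X] (RatFunc F) b / algebraMap F[X] (RatFunc F) a) := by
    rw [← isIntegral_algebraMap_iff (algebraMap (RatFunc F) K).injective, h1]
    exact (IsIntegralClosure.isIntegral F[X] K c).algebraMap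
  obtain ⟨d, hd⟩ := IsIntegrallyClosed.isIntegral_iff.1 h3
  refine ⟨d, IsFractionRing.injective F[X] (RatFunc F) ?_⟩
  rw [map_mul, hd, mul_div_cancel₀ _ ha']

variable {F : Type*} [Field F] {p m : ℕ} (𝒟 : ArtinSchreierData F p m)
  {K : Type*} [Field K] [Algebra (RatFunc F) K] [Algebra F[X] K] [IsScalarTower F[X] (RatFunc F) K]
  [FiniteDimensional (RatFunc F) K]
  {O : Type*} [CommRing O] [IsDedekindDomain O] [Algebra F[X] O] [Algebra O K]
  [IsScalarTower F[X] O K] [IsFractionRing O K] [IsIntegralClosure O F[X] K]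
  [Fact p.Prime]

theorem dvd_sum_conj_of_dvd_pow [CharP O p] [IsGalois (RatFunc F) K] {σ : K ≃ₐ[RatFunc F] K}
    (hσ : ∀ τ : K ≃ₐ[RatFunc F] K, τ ∈ Subgroup.zpowers σ)
    (hdeg : Module.finrank (RatFunc F) K = p) {Q : F[X]} (hQ : Irreducible Q) {w : O}
    (hw : algebraMap F[X] O Q ∣ w ^ p) :
    algebraMap F[X] O Q ∣ ∑ i ∈ Finset.range p, galRestrict F[X] (RatFunc F) K O (σ ^ i) w := by
  obtain ⟨a, ha⟩ : ∃ a : F[X], algebraMap F[X] (RatFunc F) a =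
      Algebra.trace (RatFunc F) K (algebraMap O K w) :=
    IsIntegrallyClosed.isIntegral_iff.1 (Algebra.isIntegral_trace
      (IsIntegralClosure.isIntegral F[X] K w).algebraMap)
  have h1 : ∑ i ∈ Finset.range p, galRestrict F[X] (RatFunc F) K O (σ ^ i) w =
    algebraMap F[X] O a := by
    apply IsIntegralClosure.algebraMap_injective O F[X] K
    rw [← IsScalarTower.algebraMap_apply, IsScalarTower.algebraMap_apply F[X] (RatFunc F) K, ha,
      ← sum_range_pow_eq_trace hσ, hdeg, map_sum]
    exact Finset.sum_congr rfl fun i _ ↦ algebraMap_galRestrict_apply ..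
  rw [h1, algebraMap_dvd_iff K hQ.ne_zero]
  refine hQ.prime.dvd_of_dvd_pow (n := p) ?_
  rw [← algebraMap_dvd_iff K (O := O) hQ.ne_zero, map_pow, ← h1, sum_pow_char]
  refine Finset.dvd_sum fun i _ ↦ ?_
  rw [← map_pow]
  have := map_dvd (galRestrict F[X] (RatFunc F) K O (σ ^ i)) hw
  rwa [AlgEquiv.commutes] at this

theorem dvd_sum_conj_mul_sub_pow [CharP O p] [IsGalois (RatFunc F) K] {σ : K ≃ₐ[RatFunc F] K}
    (hσ : ∀ τ : K ≃ₐ[RatFunc F] K, τ ∈ Subgroup.zpowers σ)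
    (hdeg : Module.finrank (RatFunc F) K = p) {Q : F[X]} (hQ : Irreducible Q) (t : O) (j : ℕ)
      {w : O}
    (hw : algebraMap F[X] O Q ∣ w ^ p) :
    algebraMap F[X] O Q ∣ ∑ i ∈ Finset.range p, galRestrict F[X] (RatFunc F) K O (σ ^ i) w *
      (galRestrict F[X] (RatFunc F) K O (σ ^ i) t - t) ^ j := by
  induction j generalizing w with
  | zero => simpa only [pow_zero, mul_one] using dvd_sum_conj_of_dvd_pow hσ hdeg hQ hw
  | succ j ih =>
    have h1 : algebraMap F[X] O Q ∣ (w * t) ^ p := by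
      rw [mul_pow]
      exact hw.mul_right _
    have h2 := dvd_sub (ih h1) ((ih hw).mul_left t)
    rw [Finset.mul_sum, ← Finset.sum_sub_distrib] at h2
    refine h2.trans (Finset.sum_congr rfl fun i _ ↦ ?_).dvd
    rw [map_mul]
    ring

namespace ArtinSchreierData

theorem exists_integral_generator {α : K} (hα : α ^ p - α = algebraMap (RatFunc F) K 𝒟.D) :
    ∃ t : O, algebraMap O K t = algebraMap F[X] K 𝒟.denom * α ∧
      t ^ p - algebraMap F[X] O 𝒟.denom ^ (p - 1) * t =
        algebraMap F[X] O (𝒟.denom ^ (p - 1) * 𝒟.num) := by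
  have hp : 1 ≤ p := (Fact.out : p.Prime).one_le
  have hnum := congrArg (algebraMap (RatFunc F) K) 𝒟.denom_mul_D
  rw [map_mul, ← IsScalarTower.algebraMap_apply, ← IsScalarTower.algebraMap_apply, ← hα] at hnum
  have heq : (algebraMap F[X] K 𝒟.denom * α) ^ p -
      algebraMap F[X] K 𝒟.denom ^ (p - 1) * (algebraMap F[X] K 𝒟.denom * α) =
        algebraMap F[X] K (𝒟.denom ^ (p - 1) * 𝒟.num) := by
    rw [map_mul, map_pow, ← hnum, ← mul_assoc, ← mul_assoc, ← pow_succ, Nat.sub_add_cancel hp]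
    ring
  have hint : IsIntegral F[X] (algebraMap F[X] K 𝒟.denom * α) := by
    refine ⟨X ^ p - (C (𝒟.denom ^ (p - 1)) * X + C (𝒟.denom ^ (p - 1) * 𝒟.num)),
      monic_X_pow_sub ?_, ?_⟩
    · refine degree_linear_le.trans_lt ?_
      exact_mod_cast (Fact.out : p.Prime).one_lt
    · simp only [eval₂_sub, eval₂_add, eval₂_mul, eval₂_pow, eval₂_X, eval₂_C]
      rw [map_pow, ← heq]
      ring
  obtain ⟨t, ht⟩ := IsIntegralClosure.isIntegral_iff (A := O).1 hint
  refine ⟨t, ht, IsIntegralClosure.algebraMap_injective O F[X] K ?_⟩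
  rw [map_sub, map_mul, map_pow, map_pow, ht, ← IsScalarTower.algebraMap_apply,
    ← IsScalarTower.algebraMap_apply, heq]

theorem galRestrict_pow_integral_generator {α : K} {t : O}
    (ht : algebraMap O K t = algebraMap F[X] K 𝒟.denom * α) {σ : K ≃ₐ[RatFunc F] K} {n : ℕ}
    (hσ : σ α = α + n) (i : ℕ) :
    galRestrict F[X] (RatFunc F) K O (σ ^ i) t = t + i * n * algebraMap F[X] O 𝒟.denom := by
  apply IsIntegralClosure.algebraMap_injective O F[X] K
  rw [algebraMap_galRestrict_apply, ht, map_mul, pow_apply_eq_add hσ, map_add, ht,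
    IsScalarTower.algebraMap_apply F[X] (RatFunc F) K, AlgEquiv.commutes, map_mul, map_mul,
    map_natCast, map_natCast, ← IsScalarTower.algebraMap_apply F[X] O K,
    IsScalarTower.algebraMap_apply F[X] (RatFunc F) K]
  ring

theorem natCast_mul_pow_sub_one [CharP O p] {n i : ℕ} (hn : ¬ p ∣ n) (hi : i < p) (hi0 : i ≠ 0) :
    ((i : O) * n) ^ (p - 1) = 1 := by
  have h : ¬ p ∣ i * n := fun h ↦ by
    rcases (Fact.out : p.Prime).dvd_mul.1 h with h | h
    · exact hi0 (Nat.eq_zero_of_dvd_of_lt h hi)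
    · exact hn h
  have h1 : ((i * n : ℕ) : O) ≠ 0 := by rwa [Ne, CharP.cast_eq_zero_iff O p]
  apply mul_right_cancel₀ h1
  rw [← Nat.cast_mul, ← pow_succ, Nat.sub_add_cancel (Fact.out : p.Prime).one_le, natCast_pow_char,
    one_mul]

theorem dvd_of_dvd_pow [CharP O p] [IsGalois (RatFunc F) K] {σ : K ≃ₐ[RatFunc F] K}
    (hσ : ∀ τ : K ≃ₐ[RatFunc F] K, τ ∈ Subgroup.zpowers σ)
    (hdeg : Module.finrank (RatFunc F) K = p)
    {α : K} (hα : α ^ p - α = algebraMap (RatFunc F) K 𝒟.D) {n : ℕ} (hn : ¬ p ∣ n)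
    (hσα : σ α = α + n) {Q : FinitePlace F} (hQ : ∀ i, 𝒟.P i ≠ Q) {x : O}
    (hx : algebraMap F[X] O Q.1 ∣ x ^ p) : algebraMap F[X] O Q.1 ∣ x := by
  obtain ⟨t, ht, -⟩ := 𝒟.exists_integral_generator (O := O) hα
  have h0 : 0 < p := (Fact.out : p.Prime).pos
  have h1 := dvd_sum_conj_mul_sub_pow hσ hdeg Q.2.2 t (p - 1) hx
  have h2 := dvd_sub h1 ((dvd_sum_conj_of_dvd_pow hσ hdeg Q.2.2 hx).mul_right
    (algebraMap F[X] O 𝒟.denom ^ (p - 1)))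
  rw [Finset.sum_mul, ← Finset.sum_sub_distrib,
    Finset.sum_eq_single_of_mem 0 (Finset.mem_range.2 h0)]
    at h2
  · have hp1 : p - 1 ≠ 0 := by have := (Fact.out : p.Prime).two_le; omega
    rw [𝒟.galRestrict_pow_integral_generator ht hσα, pow_zero, map_one, AlgEquiv.one_apply,
      Nat.cast_zero, zero_mul, zero_mul, add_zero, sub_self, zero_pow hp1, mul_zero, zero_sub,
        dvd_neg]
      at h2
    refine IsCoprime.dvd_of_dvd_mul_right ?_ h2
    rw [← map_pow]
    exact ((Q.2.2.coprime_iff_not_dvd.2 (𝒟.not_dvd_denom hQ)).pow_right).map (algebraMap F[X] O)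
  · intro i hi hi0
    rw [𝒟.galRestrict_pow_integral_generator ht hσα, add_sub_cancel_left, mul_pow,
      natCast_mul_pow_sub_one hn (Finset.mem_range.1 hi) hi0, one_mul, sub_self]

end ArtinSchreierData
end IntegralClosureOfPolynomial

section SplitPlaces

open Polynomial FractionalIdeal

theorem IsInducedBy.coe_eq_span_galRestrict {A k K O : Type*} [CommRing A] [IsDomain A] [Field k]
    [Field K] [CommRing O] [IsDedekindDomain O] [Algebra A k] [IsFractionRing A k] [Algebra k K]
    [Algebra A K] [IsScalarTower A k K] [Algebra A O] [Algebra O K] [IsScalarTower A O K]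
    [IsFractionRing O K] [IsIntegralClosure O A K] [FiniteDimensional k K] {σ : K ≃ₐ[k] K}
    {s : (FractionalIdeal O⁰ K)ˣ ≃* (FractionalIdeal O⁰ K)ˣ} (hs : IsInducedBy σ s)
    {J : (FractionalIdeal O⁰ K)ˣ} {S : Set O}
    (hJ : (J : FractionalIdeal O⁰ K) = (Ideal.span S : Ideal O)) :
    (s J : FractionalIdeal O⁰ K) = (Ideal.span (galRestrict A k K O σ '' S) : Ideal O) := by
  apply coeToSubmodule_injective
  change ((s J : FractionalIdeal O⁰ K) : Submodule O K) =
    ((Ideal.span (galRestrict A k K O σ '' S) : Ideal O) : FractionalIdeal O⁰ K)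
  rw [hs.coe_eq_span A (S := algebraMap O K '' S), coe_coeIdeal, IsLocalization.coeSubmodule_span,
    Set.image_image, Set.image_image]
  · simp_rw [algebraMap_galRestrict_apply]
  · rw [hJ, coe_coeIdeal, IsLocalization.coeSubmodule_span]

theorem IsInducedBy.iterate_coe_eq_span {A k K O : Type*} [CommRing A] [IsDomain A] [Field k]
    [Field K] [CommRing O] [IsDedekindDomain O] [Algebra A k] [IsFractionRing A k] [Algebra k K]
    [Algebra A K] [IsScalarTower A k K] [Algebra A O] [Algebra O K] [IsScalarTower A O K]
    [IsFractionRing O K] [IsIntegralClosure O A K] [FiniteDimensional k K] {σ : K ≃ₐ[k] K}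
    {s : (FractionalIdeal O⁰ K)ˣ ≃* (FractionalIdeal O⁰ K)ˣ} (hs : IsInducedBy σ s)
    {J : (FractionalIdeal O⁰ K)ˣ} {S : Set O}
    (hJ : (J : FractionalIdeal O⁰ K) = (Ideal.span S : Ideal O)) (i : ℕ) :
    ((s^[i] J : (FractionalIdeal O⁰ K)ˣ) : FractionalIdeal O⁰ K) =
      (Ideal.span (galRestrict A k K O (σ ^ i) '' S) : Ideal O) := by
  induction i with
  | zero => rw [pow_zero, map_one, show ⇑(1 : O ≃ₐ[A] O) = id from rfl, Set.image_id,
    Function.iterate_zero, id, hJ]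
  | succ i ih =>
    rw [Function.iterate_succ_apply', hs.coe_eq_span_galRestrict (A := A) ih, ← Set.image_comp,
      pow_succ', map_mul]
    rfl

theorem exists_coe_eq_ideal {K O : Type*} [Field K] [CommRing O] [IsDedekindDomain O] [Algebra O K]
    [IsFractionRing O K] {I : Ideal O} (hI : I ≠ ⊥) :
    ∃ J : (FractionalIdeal O⁰ K)ˣ, (J : FractionalIdeal O⁰ K) = I :=
  ⟨Units.mk0 (I : FractionalIdeal O⁰ K) (coeIdeal_ne_zero.2 hI), rfl⟩

variable {F : Type*} [Field F] {p m : ℕ} (𝒟 : ArtinSchreierData F p m)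
  {K : Type*} [Field K] [Algebra (RatFunc F) K] [Algebra F[X] K] [IsScalarTower F[X] (RatFunc F) K]
  [FiniteDimensional (RatFunc F) K]
  {O : Type*} [CommRing O] [IsDedekindDomain O] [Algebra F[X] O] [Algebra O K]
  [IsScalarTower F[X] O K] [IsFractionRing O K] [IsIntegralClosure O F[X] K]
  [Fact p.Prime]

theorem algebraMap_injective_integralClosure (K : Type*) [Field K] [Algebra (RatFunc F) K]
    [Algebra F[X] K] [IsScalarTower F[X] (RatFunc F) K] [Algebra O K] [IsScalarTower F[X] O K] :
    Function.Injective (algebraMap F[X] O) := by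
  have h : Function.Injective (algebraMap F[X] K) := by
    rw [IsScalarTower.algebraMap_eq F[X] (RatFunc F) K]
    exact (algebraMap (RatFunc F) K).injective.comp (IsFractionRing.injective F[X] (RatFunc F))
  rw [IsScalarTower.algebraMap_eq F[X] O K, RingHom.coe_comp] at h
  exact h.of_comp

namespace ArtinSchreierData

theorem exists_dvd_denom_mul_sub_num {Q : FinitePlace F} (hQ : ∀ i, 𝒟.P i ≠ Q) :
    ∃ c, Q.1 ∣ 𝒟.denom * c - 𝒟.num := by
  obtain ⟨u, v, huv⟩ := Q.2.2.coprime_iff_not_dvd.2 (𝒟.not_dvd_denom hQ)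
  exact ⟨v * 𝒟.num, -u * 𝒟.num, by linear_combination 𝒟.num * huv⟩

theorem exists_dvd_pow_sub_sub_num [Fintype F] [Algebra (ZMod p) F] {Q : FinitePlace F}
    (hQ : ∀ i, 𝒟.P i ≠ Q)
    (h : ∑ j, 𝒟.symbol j (algebraMap F[X] (RatFunc F) Q.1) +
      𝒟.symbolInf (algebraMap F[X] (RatFunc F) Q.1) = 0) :
    ∃ y, Q.1 ∣ 𝒟.denom * (y ^ p - y) - 𝒟.num := by
  obtain ⟨c, hc⟩ := 𝒟.exists_dvd_denom_mul_sub_num hQ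
  have hc' : (𝒟.D - algebraMap F[X] (RatFunc F) c) / algebraMap F[X]
    (RatFunc F) Q.1 ∈ localRing Q := by
    obtain ⟨d, hd⟩ := hc
    refine mem_localRing.2 ⟨-d, 𝒟.denom, 𝒟.not_dvd_denom hQ, ?_⟩
    have h1 := algebraMap_ratFunc_ne_zero Q.2.2.ne_zero
    have h2 := 𝒟.denom_mul_D
    have h3 := congrArg (algebraMap F[X] (RatFunc F)) hd
    rw [map_sub, map_mul, map_mul] at h3
    field_simp
    rw [map_neg]
    linear_combination h2 - h3
  rw [𝒟.sum_symbol_add_symbolInf Q hQ hc'] at h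
  obtain ⟨y, hy⟩ := exists_dvd_pow_sub_sub Q h
  refine ⟨y, ?_⟩
  have := dvd_add (hy.mul_left 𝒟.denom) hc
  convert this using 1
  ring

theorem exists_orbitProd_eq_place [Fintype F] [Algebra (ZMod p) F] [CharP O p] [CharP K p]
    {σ : K ≃ₐ[RatFunc F] K}
    {α : K} (hα : α ^ p - α = algebraMap (RatFunc F) K 𝒟.D) {n : ℕ} (hn : ¬ p ∣ n)
    (hσα : σ α = α + n)
    {s : (FractionalIdeal O⁰ K)ˣ ≃* (FractionalIdeal O⁰ K)ˣ} (hs : IsInducedBy σ s)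
    {Q : FinitePlace F} (hQ : ∀ i, 𝒟.P i ≠ Q)
    (h : ∑ j, 𝒟.symbol j (algebraMap F[X] (RatFunc F) Q.1) +
      𝒟.symbolInf (algebraMap F[X] (RatFunc F) Q.1) = 0)
    {b : (RatFunc F)ˣ} (hb : (b : RatFunc F) = algebraMap F[X] (RatFunc F) Q.1) :
    ∃ J, orbitProd s p J =
      toPrincipalIdeal O K (Units.map (algebraMap (RatFunc F) K : RatFunc F →* K) b) := by
  obtain ⟨t, ht, -⟩ := 𝒟.exists_integral_generator (O := O) hα
  obtain ⟨y, hy⟩ := 𝒟.exists_dvd_pow_sub_sub_num hQ h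
  have hQ0 : algebraMap F[X] O Q.1 ≠ 0 := by
    have hinj := algebraMap_injective_integralClosure (F := F) (O := O) K
    exact (map_ne_zero_iff _ hinj).2 Q.2.2.ne_zero
  obtain ⟨J, hJ⟩ := exists_coe_eq_ideal (K := K)
    (I := Ideal.span {algebraMap F[X] O Q.1, t - algebraMap F[X] O (𝒟.denom * y)})
    (fun h0 ↦ hQ0 (by
      have := Ideal.subset_span (Set.mem_insert (algebraMap F[X] O Q.1)
        {t - algebraMap F[X] O (𝒟.denom * y)})
      rwa [h0] at this))
  refine ⟨J, Units.ext ?_⟩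
  have hcop : IsCoprime (algebraMap F[X] O Q.1) (algebraMap F[X] O 𝒟.denom) :=
    (Q.2.2.coprime_iff_not_dvd.2 (𝒟.not_dvd_denom hQ)).map (algebraMap F[X] O)
  set a : ℕ → O := fun i ↦ t - algebraMap F[X] O (𝒟.denom * y) + i * n * algebraMap F[X] O 𝒟.denom
    with ha
  have hprod : algebraMap F[X] O Q.1 ∣ ∏ i ∈ Finset.range p, a i := by
    have h1 : ∏ i ∈ Finset.range p, a i =
        algebraMap F[X] O (𝒟.denom ^ (p - 1) * (𝒟.num - 𝒟.denom * (y ^ p - y))) := by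
      apply IsIntegralClosure.algebraMap_injective O F[X] K
      have h2 : ∀ i, algebraMap O K (a i) =
          algebraMap F[X] K 𝒟.denom * ((α - algebraMap F[X] K y) + i * n) := fun i ↦ by
        rw [ha, map_add, map_sub, ht, ← IsScalarTower.algebraMap_apply, map_mul, map_mul, map_mul,
          ← IsScalarTower.algebraMap_apply, map_natCast, map_natCast]
        ring
      rw [map_prod, Finset.prod_congr rfl fun i _ ↦ h2 i, Finset.prod_mul_distrib,
        Finset.prod_const, Finset.card_range, prod_range_add_mul_natCast _ hn,
        ← IsScalarTower.algebraMap_apply, map_mul, map_pow, map_sub, sub_pow_char, map_mul, map_sub,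
        map_pow]
      have h3 := congrArg (algebraMap (RatFunc F) K) 𝒟.denom_mul_D
      rw [map_mul, ← hα, ← IsScalarTower.algebraMap_apply, ← IsScalarTower.algebraMap_apply] at h3
      rw [← h3]
      obtain ⟨r, hr⟩ : ∃ r, p = r + 1 := ⟨p - 1,
        (Nat.sub_add_cancel (Fact.out : p.Prime).one_le).symm⟩
      rw [show p - 1 = r by omega, show algebraMap F[X] K 𝒟.denom ^ p =
        algebraMap F[X] K 𝒟.denom ^ r * algebraMap F[X] K 𝒟.denom by rw [← pow_succ, ← hr]]
      ring
    rw [h1]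
    refine map_dvd _ (Dvd.dvd.mul_left ?_ _)
    rwa [← neg_sub, dvd_neg]
  have hpair : ((Finset.range p : Finset ℕ) : Set ℕ).Pairwise fun i j ↦
      IsCoprime (algebraMap F[X] O Q.1) (a i - a j) := by
    intro i hi j hj hij
    have hunit : IsUnit ((i : O) * n - j * n) := by
      have hne : ((i : ℤ) * n - j * n : ZMod p) ≠ 0 := by
        push_cast
        rw [← sub_mul]
        refine mul_ne_zero (fun h0 ↦ hij ?_) (by rwa [Ne, ZMod.natCast_eq_zero_iff])
        rw [sub_eq_zero, ZMod.natCast_eq_natCast_iff'] at h0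
        rwa [Nat.mod_eq_of_lt (by simpa using hi), Nat.mod_eq_of_lt (by simpa using hj)] at h0
      have := (IsUnit.mk0 _ hne).map (ZMod.castHom (dvd_refl p) O)
      simpa using this
    have : a i - a j = ((i : O) * n - j * n) * algebraMap F[X] O 𝒟.denom := by
      simp only [ha]
      ring
    rw [this]
    exact (isCoprime_mul_unit_left_right hunit _ _).2 hcop
  have hi : ∀ i, ((s^[i] J : (FractionalIdeal O⁰ K)ˣ) : FractionalIdeal O⁰ K) =
      ((Ideal.span {algebraMap F[X] O Q.1, a i} : Ideal O) : FractionalIdeal O⁰ K) := fun i ↦ by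
    rw [hs.iterate_coe_eq_span (A := F[X]) hJ i, Set.image_pair, AlgEquiv.commutes, map_sub,
      AlgEquiv.commutes, 𝒟.galRestrict_pow_integral_generator ht hσα]
    congr 3
    simp only [ha]
    ring_nf
  rw [orbitProd_apply, Units.coe_prod, Finset.prod_congr rfl fun i _ ↦ hi i, coe_toPrincipalIdeal,
    Units.coe_map, hb]
  change _ = spanSingleton O⁰ (algebraMap (RatFunc F) K (algebraMap F[X] (RatFunc F) Q.1))
  rw [← IsScalarTower.algebraMap_apply, IsScalarTower.algebraMap_apply F[X] O K,
    ← coeIdeal_span_singleton, ← prod_span_pair_eq hpair hprod]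
  exact (map_prod (coeIdealHom O⁰ K) _ _).symm

end ArtinSchreierData
end SplitPlaces

section RamifiedPlaces

open Polynomial FractionalIdeal

/-- A finite place, as a unit of the rational function field. -/
noncomputable def FinitePlace.unit {F : Type*} [Field F] (Q : FinitePlace F) : (RatFunc F)ˣ :=
  Units.mk0 (algebraMap F[X] (RatFunc F) Q.1) (algebraMap_ratFunc_ne_zero Q.2.2.ne_zero)

/-- The principal fractional ideal of `O` generated by an element of the base field. -/
noncomputable def baseIdeal (k O K : Type*) [Field k] [Field K] [Algebra k K] [CommRing O]
    [IsDomain O] [Algebra O K] [IsFractionRing O K] : kˣ →* (FractionalIdeal O⁰ K)ˣ :=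
  (toPrincipalIdeal O K).comp (Units.map (algebraMap k K : k →* K))

theorem coe_baseIdeal {k O K : Type*} [Field k] [Field K] [Algebra k K] [CommRing O]
    [IsDomain O] [Algebra O K] [IsFractionRing O K] (b : kˣ) :
    (baseIdeal k O K b : FractionalIdeal O⁰ K) = spanSingleton O⁰ (algebraMap k K b) :=
  coe_toPrincipalIdeal _

theorem IsInducedBy.apply_baseIdeal {k K O : Type*} [Field k] [Field K] [CommRing O]
    [IsDedekindDomain O] [Algebra k K] [Algebra O K] [IsFractionRing O K] (A : Type*) [CommRing A]
    [IsDomain A] [Algebra A k] [IsFractionRing A k] [Algebra A K] [IsScalarTower A k K]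
    [Algebra A O] [IsScalarTower A O K] [IsIntegralClosure O A K] [FiniteDimensional k K]
    {σ : K ≃ₐ[k] K} {s : (FractionalIdeal O⁰ K)ˣ ≃* (FractionalIdeal O⁰ K)ˣ}
    (hs : IsInducedBy σ s) (b : kˣ) : s (baseIdeal k O K b) = baseIdeal k O K b := by
  rw [baseIdeal, MonoidHom.comp_apply, hs.apply_toPrincipalIdeal A]
  congr 1
  ext
  exact AlgEquiv.commutes σ _

theorem dvd_of_dvd_pow_mul {O : Type*} [CommRing O] [IsDedekindDomain O] {P t c : O} {e p : ℕ}
    (hp : p ≠ 0) (ht : t ^ p = P ^ (e * (p - 1)) * c) {i j : ℕ} (hij : i + j = p) :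
    P ^ (e * (p - 1)) ∣ (P ^ e) ^ i * t ^ j := by
  rw [← IsIntegrallyClosed.pow_dvd_pow_iff hp, mul_pow, ← pow_mul t, mul_comm j, pow_mul t, ht,
    mul_pow, ← mul_assoc, ← pow_mul, ← pow_mul, ← pow_mul, ← pow_mul, ← pow_add]
  refine Dvd.dvd.mul_right (pow_dvd_pow _ ?_) _
  obtain ⟨q, rfl⟩ : ∃ q, p = q + 1 := ⟨p - 1, by omega⟩
  rw [Nat.add_sub_cancel]
  obtain ⟨d, hd⟩ : ∃ d, q + 1 = j + d := ⟨i, by omega⟩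
  obtain rfl : i = d := by omega
  zify at hd ⊢
  rw [show (j : ℤ) = q + 1 - i by linarith]
  have : (0 : ℤ) ≤ e * i := by positivity
  nlinarith

theorem span_pair_pow_eq {O : Type*} [CommRing O] [IsDedekindDomain O] {P t c d : O} {e p : ℕ}
    (hp : p ≠ 0) (ht : t ^ p = P ^ (e * (p - 1)) * (c * (t + d))) (hcop : IsCoprime (P ^ e)
      (c * d)) :
    Ideal.span {P ^ e, t} ^ p = Ideal.span {P ^ (e * (p - 1))} := by
  apply le_antisymm
  · have := span_singleton_mul_span_pair_pow_le (a := P ^ e) (b := t) (z := P ^ (e * (p - 1))) p 1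
      fun i j hij ↦ by rw [one_mul]; exact dvd_of_dvd_pow_mul hp ht hij
    rwa [Ideal.span_singleton_one, Ideal.top_mul] at this
  · rw [Ideal.span_singleton_le_iff_mem]
    obtain ⟨u, v, huv⟩ := hcop
    have hP : P ^ e ∈ Ideal.span {P ^ e, t} := Ideal.subset_span (Set.mem_insert _ _)
    have ht' : t ∈ Ideal.span {P ^ e, t} := Ideal.subset_span (Set.mem_insert_of_mem _ rfl)
    obtain ⟨q, rfl⟩ : ∃ q, p = q + 1 := ⟨p - 1, by omega⟩
    rw [Nat.add_sub_cancel] at *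
    have h1 : P ^ (e * q) * t ∈ Ideal.span {P ^ e, t} ^ (q + 1) := by
      rw [pow_succ, pow_mul]
      exact Ideal.mul_mem_mul (Ideal.pow_mem_pow hP q) ht'
    have h2 : P ^ (e * q) * P ^ e ∈ Ideal.span {P ^ e, t} ^ (q + 1) := by
      rw [pow_mul, ← pow_succ]
      exact Ideal.pow_mem_pow hP _
    have h3 := Ideal.pow_mem_pow ht' (q + 1)
    have h4 : P ^ (e * q) = u * (P ^ (e * q) * P ^ e) + (v * t ^ (q + 1) - v * c * (P ^
      (e * q) * t)) := by
      rw [ht]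
      linear_combination (- P ^ (e * q)) * huv
    rw [h4]
    exact add_mem (Ideal.mul_mem_left _ _ h2)
      (sub_mem (Ideal.mul_mem_left _ _ h3) (Ideal.mul_mem_left _ _ h1))

variable {F : Type*} [Field F] {p m : ℕ} (𝒟 : ArtinSchreierData F p m)
  {K : Type*} [Field K] [Algebra (RatFunc F) K] [Algebra F[X] K] [IsScalarTower F[X] (RatFunc F) K]
  [FiniteDimensional (RatFunc F) K]
  {O : Type*} [CommRing O] [IsDedekindDomain O] [Algebra F[X] O] [Algebra O K]
  [IsScalarTower F[X] O K] [IsFractionRing O K] [IsIntegralClosure O F[X] K]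
  [Fact p.Prime]

namespace ArtinSchreierData

theorem exists_pow_eq_place {α : K} (hα : α ^ p - α = algebraMap (RatFunc F) K 𝒟.D) (i : Fin m) :
    ∃ J : (FractionalIdeal O⁰ K)ˣ, J ^ p = baseIdeal (RatFunc F) O K (𝒟.P i).unit := by
  obtain ⟨t, -, ht⟩ := 𝒟.exists_integral_generator (O := O) hα
  have hp := (Fact.out : p.Prime)
  have hinj := algebraMap_injective_integralClosure (F := F) (O := O) K
  have ht' : t ^ p = algebraMap F[X] O (𝒟.P i).1 ^ (𝒟.e i * (p - 1)) *
      (algebraMap F[X] O (𝒟.codenom i) ^ (p - 1) * (t + algebraMap F[X] O 𝒟.num)) := by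
    rw [sub_eq_iff_eq_add, map_mul, map_pow] at ht
    rw [ht, ← 𝒟.pow_mul_codenom i, map_mul, map_pow, mul_pow, ← pow_mul]
    ring
  have hcop : IsCoprime (algebraMap F[X] O (𝒟.P i).1 ^ 𝒟.e i)
      (algebraMap F[X] O (𝒟.codenom i) ^ (p - 1) * algebraMap F[X] O 𝒟.num) := by
    rw [← map_pow, ← map_pow, ← map_mul]
    refine IsCoprime.map (IsCoprime.pow_left ?_) _
    refine IsCoprime.mul_right (IsCoprime.pow_right ?_) ?_
    · exact (𝒟.P i).2.2.coprime_iff_not_dvd.2 (𝒟.not_dvd_codenom i)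
    · exact (𝒟.P i).2.2.coprime_iff_not_dvd.2 (𝒟.not_dvd_num i)
  have hpow := span_pair_pow_eq hp.ne_zero ht' hcop
  have hP0 : algebraMap F[X] O (𝒟.P i).1 ≠ 0 := (map_ne_zero_iff _ hinj).2 (𝒟.P i).2.2.ne_zero
  obtain ⟨J, hJ⟩ := exists_coe_eq_ideal (K := K)
    (I := Ideal.span {algebraMap F[X] O (𝒟.P i).1 ^ 𝒟.e i, t})
    (fun h0 ↦ pow_ne_zero (𝒟.e i) hP0 (by
      have := Ideal.subset_span (Set.mem_insert (algebraMap F[X] O (𝒟.P i).1 ^ 𝒟.e i) {t})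
      rwa [h0] at this))
  have hJp : J ^ p = baseIdeal (RatFunc F) O K (𝒟.P i).unit ^ (𝒟.e i * (p - 1)) := by
    apply Units.ext
    rw [Units.val_pow_eq_pow_val, hJ, ← coeIdeal_pow, hpow, coeIdeal_span_singleton,
      ← map_pow (baseIdeal (RatFunc F) O K)]
    rw [coe_baseIdeal, Units.val_pow_eq_pow_val, FinitePlace.unit, Units.val_mk0, map_pow, map_pow,
      ← IsScalarTower.algebraMap_apply, ← IsScalarTower.algebraMap_apply]
  have hcopr : IsCoprime ((𝒟.e i * (p - 1) : ℕ) : ℤ) p := by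
    rw [Nat.isCoprime_iff_coprime]
    refine Nat.Coprime.mul_left ?_ ?_
    · exact ((hp.coprime_iff_not_dvd).2 (𝒟.not_dvd i)).symm
    · have := Nat.coprime_self_sub_right hp.one_le
      exact (this.2 (Nat.coprime_one_right p)).symm
  obtain ⟨a, b, hab⟩ := hcopr
  refine ⟨J ^ a * baseIdeal (RatFunc F) O K (𝒟.P i).unit ^ b, ?_⟩
  rw [mul_pow, ← zpow_natCast, ← zpow_mul, mul_comm a, zpow_mul, zpow_natCast, hJp,
    ← zpow_natCast, ← zpow_natCast, ← zpow_mul, ← zpow_mul, ← zpow_add]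
  nth_rewrite 2 [← zpow_one (baseIdeal (RatFunc F) O K (𝒟.P i).unit)]
  rw [← hab, mul_comm a]

end ArtinSchreierData

theorem IsInducedBy.apply_eq_of_pow_eq {σ : K ≃ₐ[RatFunc F] K}
    {s : (FractionalIdeal O⁰ K)ˣ ≃* (FractionalIdeal O⁰ K)ˣ} (hs : IsInducedBy σ s)
    {J : (FractionalIdeal O⁰ K)ˣ} {b : (RatFunc F)ˣ} {n : ℕ} (hn : n ≠ 0)
    (h : J ^ n = baseIdeal (RatFunc F) O K b) : s J = J := by
  apply fractionalIdeal_pow_injective hn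
  rw [← map_pow, h, hs.apply_baseIdeal F[X]]

end RamifiedPlaces

section AmbiguousIdeals

open Polynomial FractionalIdeal

theorem exists_finitePlace_dvd {F : Type*} [Field F] {g : F[X]} (hg : ¬ IsUnit g) (hg0 : g ≠ 0) :
    ∃ Q : FinitePlace F, Q.1 ∣ g := by
  obtain ⟨q, hq, hqg⟩ := WfDvdMonoid.exists_irreducible_factor hg hg0
  refine ⟨⟨q * C q.leadingCoeff⁻¹, monic_mul_leadingCoeff_inv hq.ne_zero, ?_⟩, ?_⟩
  · exact irreducible_mul_leadingCoeff_inv.2 hq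
  · refine (Associated.dvd ?_).trans hqg
    refine (associated_mul_unit_left q _ ?_)
    exact isUnit_C.2 (isUnit_iff_ne_zero.2 (inv_ne_zero (leadingCoeff_ne_zero.2 hq.ne_zero)))

variable {F : Type*} [Field F] {p m : ℕ} (𝒟 : ArtinSchreierData F p m)
  {K : Type*} [Field K] [Algebra (RatFunc F) K] [Algebra F[X] K] [IsScalarTower F[X] (RatFunc F) K]
  [FiniteDimensional (RatFunc F) K]
  {O : Type*} [CommRing O] [IsDedekindDomain O] [Algebra F[X] O] [Algebra O K]
  [IsScalarTower F[X] O K] [IsFractionRing O K] [IsIntegralClosure O F[X] K]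
  [Fact p.Prime]

namespace ArtinSchreierData

theorem le_baseIdeal_of_pow_eq [CharP O p] [IsGalois (RatFunc F) K] {σ : K ≃ₐ[RatFunc F] K}
    (hσ : ∀ τ : K ≃ₐ[RatFunc F] K, τ ∈ Subgroup.zpowers σ)
    (hdeg : Module.finrank (RatFunc F) K = p)
    {α : K} (hα : α ^ p - α = algebraMap (RatFunc F) K 𝒟.D) {n : ℕ} (hn : ¬ p ∣ n)
    (hσα : σ α = α + n) {Q : FinitePlace F} (hQ : ∀ i, 𝒟.P i ≠ Q) {g : F[X]} (hg : Q.1 ∣ g)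
    {b : (RatFunc F)ˣ} (hb : (b : RatFunc F) = algebraMap F[X] (RatFunc F) g)
    {J : (FractionalIdeal O⁰ K)ˣ} (hJ : J ^ p = baseIdeal (RatFunc F) O K b) :
    (J : FractionalIdeal O⁰ K) ≤ baseIdeal (RatFunc F) O K Q.unit := by
  intro x hx
  have hxp : x ^ p ∈ ((J ^ p : (FractionalIdeal O⁰ K)ˣ) : FractionalIdeal O⁰ K) := by
    rw [Units.val_pow_eq_pow_val, ← mem_coe, FractionalIdeal.coe_pow]
    exact Submodule.pow_mem_pow _ hx p
  rw [hJ, coe_baseIdeal, mem_spanSingleton] at hxp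
  obtain ⟨z, hz⟩ := hxp
  rw [hb, ← IsScalarTower.algebraMap_apply, Algebra.smul_def,
    IsScalarTower.algebraMap_apply F[X] O K,
    ← map_mul] at hz
  have hp := (Fact.out : p.Prime)
  have hint : IsIntegral F[X] x := by
    refine IsIntegral.of_pow hp.pos ?_
    rw [← hz]
    exact (IsIntegralClosure.isIntegral F[X] K _).algebraMap
  obtain ⟨y, hy⟩ := IsIntegralClosure.isIntegral_iff (A := O).1 hint
  have h1 : algebraMap F[X] O Q.1 ∣ y ^ p := by
    have : y ^ p = z * algebraMap F[X] O g := by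
      apply IsIntegralClosure.algebraMap_injective O F[X] K
      rw [map_pow, hy, hz]
    rw [this]
    exact (_root_.map_dvd _ hg).mul_left _
  obtain ⟨w, hw⟩ := 𝒟.dvd_of_dvd_pow hσ hdeg hα hn hσα hQ h1
  rw [coe_baseIdeal, mem_spanSingleton]
  refine ⟨w, ?_⟩
  rw [FinitePlace.unit, Units.val_mk0, ← hy, hw, map_mul, ← IsScalarTower.algebraMap_apply,
    ← IsScalarTower.algebraMap_apply, Algebra.smul_def, mul_comm]

theorem baseIdeal_eq_one_of_isUnit {g : F[X]} (hg : IsUnit g) {b : (RatFunc F)ˣ}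
    (hb : (b : RatFunc F) = algebraMap F[X] (RatFunc F) g) : baseIdeal (RatFunc F) O K b = 1 := by
  obtain ⟨u, rfl⟩ := hg
  refine toPrincipalIdeal_unit (Units.map (algebraMap F[X] O : F[X] →* O) u) ?_
  change algebraMap O K (algebraMap F[X] O u) = algebraMap (RatFunc F) K b
  rw [hb, ← IsScalarTower.algebraMap_apply, ← IsScalarTower.algebraMap_apply]

theorem exists_eq_algebraMap_of_baseIdeal_le_one {b : (RatFunc F)ˣ}
    (hb : (baseIdeal (RatFunc F) O K b : FractionalIdeal O⁰ K) ≤ 1) :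
    ∃ g : F[X], (b : RatFunc F) = algebraMap F[X] (RatFunc F) g := by
  rw [coe_baseIdeal, spanSingleton_le_iff_mem, mem_one_iff] at hb
  obtain ⟨x, hx⟩ := hb
  have h : IsIntegral F[X] (b : RatFunc F) := by
    rw [← isIntegral_algebraMap_iff (algebraMap (RatFunc F) K).injective, ← hx]
    exact (IsIntegralClosure.isIntegral F[X] K x).algebraMap
  obtain ⟨g, hg⟩ := IsIntegrallyClosed.isIntegral_iff.1 h
  exact ⟨g, hg.symm⟩

theorem exists_eq_baseIdeal_mul_prod_of_pow_eq [CharP O p] [IsGalois (RatFunc F) K]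
    {σ : K ≃ₐ[RatFunc F] K} (hσ : ∀ τ : K ≃ₐ[RatFunc F] K, τ ∈ Subgroup.zpowers σ)
    (hdeg : Module.finrank (RatFunc F) K = p)
    {α : K} (hα : α ^ p - α = algebraMap (RatFunc F) K 𝒟.D) {n : ℕ} (hn : ¬ p ∣ n)
    (hσα : σ α = α + n) {𝔓 : Fin m → (FractionalIdeal O⁰ K)ˣ}
    (h𝔓 : ∀ i, 𝔓 i ^ p = baseIdeal (RatFunc F) O K (𝒟.P i).unit) {b : (RatFunc F)ˣ}
    {J : (FractionalIdeal O⁰ K)ˣ} (hJ : J ^ p = baseIdeal (RatFunc F) O K b) :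
    ∃ (c : (RatFunc F)ˣ) (a : Fin m → ℤ), J = baseIdeal (RatFunc F) O K c * ∏ i, 𝔓 i ^ a i := by
  classical
  have hp := (Fact.out : p.Prime)
  have key : ∀ (d : ℕ) (g : F[X]), g.natDegree = d →
    ∀ (b : (RatFunc F)ˣ) (J : (FractionalIdeal O⁰ K)ˣ),
      (b : RatFunc F) = algebraMap F[X] (RatFunc F) g → J ^ p = baseIdeal (RatFunc F) O K b →
      ∃ (c : (RatFunc F)ˣ) (a : Fin m → ℤ), J = baseIdeal (RatFunc F) O K c * ∏ i, 𝔓 i ^ a i := by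
    intro d
    induction d using Nat.strong_induction_on with
    | _ d ih =>
    intro g hgd b J hb hJ
    have hg0 : g ≠ 0 := fun h ↦ b.ne_zero (by rw [hb, h, map_zero])
    by_cases hu : IsUnit g
    · rw [baseIdeal_eq_one_of_isUnit hu hb] at hJ
      refine ⟨1, 0, ?_⟩
      have : J = 1 := fractionalIdeal_pow_injective hp.ne_zero (hJ.trans (one_pow p).symm)
      simp [this]
    obtain ⟨Q, hQg⟩ := exists_finitePlace_dvd hu hg0
    have hQpos : 0 < Q.1.natDegree := Q.2.2.natDegree_pos
    by_cases hQ : ∀ i, 𝒟.P i ≠ Q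
    · have hle := 𝒟.le_baseIdeal_of_pow_eq hσ hdeg hα hn hσα hQ hQg hb hJ
      have hle' : ((J * (baseIdeal (RatFunc F) O K Q.unit)⁻¹ : (FractionalIdeal O⁰ K)ˣ) :
          FractionalIdeal O⁰ K) ≤ 1 := by
        have := mul_le_mul_left hle
          (((baseIdeal (RatFunc F) O K Q.unit)⁻¹ : (FractionalIdeal O⁰ K)ˣ) : FractionalIdeal O⁰ K)
        rwa [Units.mul_inv, ← Units.val_mul] at this
      have hpow : (J * (baseIdeal (RatFunc F) O K Q.unit)⁻¹) ^ p =
          baseIdeal (RatFunc F) O K (b * (Q.unit ^ p)⁻¹) := by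
        rw [mul_pow, hJ, map_mul, map_inv, map_pow, inv_pow]
      obtain ⟨g', hg'⟩ := exists_eq_algebraMap_of_baseIdeal_le_one (K := K) (O := O)
        (b := b * (Q.unit ^ p)⁻¹) (by
          rw [← hpow, Units.val_pow_eq_pow_val]
          exact pow_le_one' hle' p)
      have hgg : g = g' * Q.1 ^ p := by
        apply IsFractionRing.injective F[X] (RatFunc F)
        rw [map_mul, map_pow, ← hg', ← hb]
        change (b : RatFunc F) = ((b * (Q.unit ^ p)⁻¹ : (RatFunc F)ˣ) : RatFunc F) *
          (Q.unit : RatFunc F) ^ p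
        rw [← Units.val_pow_eq_pow_val, ← Units.val_mul, inv_mul_cancel_right]
      have hg'0 : g' ≠ 0 := fun h ↦ hg0 (by rw [hgg, h, zero_mul])
      have hlt : g'.natDegree < d := by
        rw [← hgd, hgg, natDegree_mul hg'0 (pow_ne_zero _ Q.2.2.ne_zero), natDegree_pow]
        have := Nat.mul_pos hp.pos hQpos
        omega
      obtain ⟨c, a, h⟩ := ih _ hlt g' rfl _ _ hg' hpow
      refine ⟨c * Q.unit, a, ?_⟩
      rw [mul_inv_eq_iff_eq_mul] at h
      rw [h, map_mul, mul_right_comm]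
    · push Not at hQ
      obtain ⟨i, rfl⟩ := hQ
      obtain ⟨g', hgg⟩ := hQg
      have hg'0 : g' ≠ 0 := fun h ↦ hg0 (by rw [hgg, h, mul_zero])
      have hg' : ((b * ((𝒟.P i).unit)⁻¹ : (RatFunc F)ˣ) : RatFunc F) =
        algebraMap F[X] (RatFunc F) g' := by
        rw [Units.val_mul, Units.val_inv_eq_inv_val, hb, hgg, map_mul, FinitePlace.unit,
          Units.val_mk0,
          mul_comm, inv_mul_cancel_left₀ (algebraMap_ratFunc_ne_zero (𝒟.P i).2.2.ne_zero)]
      have hlt : g'.natDegree < d := by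
        rw [← hgd, hgg, natDegree_mul (𝒟.P i).2.2.ne_zero hg'0]
        omega
      obtain ⟨c, a, h⟩ := ih _ hlt g' rfl _ (J * (𝔓 i)⁻¹) hg' (by
        rw [mul_pow, hJ, inv_pow, h𝔓, map_mul, map_inv])
      refine ⟨c, a + Pi.single i 1, ?_⟩
      rw [mul_inv_eq_iff_eq_mul] at h
      have hsingle : ∏ j, 𝔓 j ^ (Pi.single i (1 : ℤ) : Fin m → ℤ) j = 𝔓 i := by
        rw [Finset.prod_eq_single_of_mem i (Finset.mem_univ i), Pi.single_eq_same, zpow_one]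
        intro j _ hj
        rw [Pi.single_eq_of_ne hj, zpow_zero]
      simp only [Pi.add_apply, zpow_add, Finset.prod_mul_distrib]
      rw [h, hsingle, mul_assoc]
  obtain ⟨x, y, hy, hxy⟩ := IsFractionRing.div_surjective (A := F[X]) (b : RatFunc F)
  have hy0 := nonZeroDivisors.ne_zero hy
  have hy0' := algebraMap_ratFunc_ne_zero hy0
  obtain ⟨r, hr⟩ : ∃ r, p = r + 1 := ⟨p - 1, (Nat.sub_add_cancel hp.one_le).symm⟩
  obtain ⟨c, a, h⟩ := key _ (x * y ^ r) rfl (b * Units.mk0 _ hy0' ^ p)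
    (J * baseIdeal (RatFunc F) O K (Units.mk0 _ hy0')) (by
      rw [Units.val_mul, Units.val_pow_eq_pow_val, Units.val_mk0, ← hxy, map_mul, map_pow, hr,
        pow_succ,
        mul_comm (_ ^ r), ← mul_assoc, div_mul_cancel₀ _ hy0'])
    (by rw [mul_pow, hJ, map_mul, map_pow])
  refine ⟨c * (Units.mk0 _ hy0')⁻¹, a, ?_⟩
  rw [map_mul, map_inv, mul_right_comm, ← h, mul_inv_cancel_right]

end ArtinSchreierData
end AmbiguousIdeals

section GroupTheory

theorem ker_eq_range_of_card_le {G H : Type*} [CommGroup G] [Finite G] [CommGroup H] {δ : G →* G}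
    {X : G →* H} (hX : ∀ x, X (δ x) = 1) (hcard : Nat.card δ.ker ≤ Nat.card X.range) :
    X.ker = δ.range ∧ Nat.card δ.ker = Nat.card X.range := by
  have hle : δ.range ≤ X.ker := by
    rintro _ ⟨x, rfl⟩
    exact hX x
  have h1 := X.ker.card_mul_index
  have h2 := δ.ker.card_mul_index
  rw [Subgroup.index_ker] at h1 h2
  have h3 := Subgroup.card_le_of_le hle
  have h4 : Nat.card X.ker ≤ Nat.card δ.range := by
    have : 0 < Nat.card δ.ker := Nat.card_pos
    refine le_of_mul_le_mul_left ?_ this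
    rw [h2, ← h1, mul_comm]
    exact Nat.mul_le_mul_left _ hcard
  have h5 : δ.range = X.ker := Subgroup.eq_of_le_of_card_ge hle h4
  refine ⟨h5.symm, ?_⟩
  rw [← h2, h5, mul_comm] at h1
  exact (Nat.eq_of_mul_eq_mul_right Nat.card_pos h1).symm

theorem map_primaryComponent {G : Type*} [CommGroup G] [Finite G] (p : ℕ) [Fact p.Prime]
    (δ : G →* G) :
    (CommGroup.primaryComponent G p).map δ = CommGroup.primaryComponent G p ⊓ δ.range := by
  apply le_antisymm
  · rintro _ ⟨x, hx, rfl⟩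
    obtain ⟨k, hk⟩ := CommGroup.mem_primaryComponent.1 hx
    exact ⟨CommGroup.mem_primaryComponent.2 ⟨k, by rw [← map_pow, hk, map_one]⟩, x, rfl⟩
  · rintro _ ⟨hy, x, rfl⟩
    obtain ⟨k, hk⟩ := CommGroup.mem_primaryComponent.1 hy
    obtain ⟨a, n, hn, hcard⟩ := Nat.exists_eq_pow_mul_and_not_dvd (Nat.card_pos (α := G)).ne' p
      (Fact.out : p.Prime).ne_one
    have hcop : IsCoprime (n : ℤ) ((p ^ (a + k) : ℕ) : ℤ) := by
      rw [Nat.isCoprime_iff_coprime]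
      exact ((Fact.out : p.Prime).coprime_iff_not_dvd.2 hn).symm.pow_right _
    obtain ⟨u, v, huv⟩ := hcop
    refine ⟨x ^ ((n : ℤ) * u), CommGroup.mem_primaryComponent.2 ⟨a, ?_⟩, ?_⟩
    · rw [← zpow_natCast, ← zpow_mul, mul_right_comm, zpow_mul, ← Nat.cast_mul, zpow_natCast,
        mul_comm n,
        ← hcard, pow_card_eq_one', one_zpow]
    · have h1 : δ x ^ p ^ (a + k) = 1 := by rw [pow_add, mul_comm, pow_mul, hk, one_pow]
      rw [map_zpow]
      calc δ x ^ ((n : ℤ) * u) = δ x ^ ((n : ℤ) * u) * (δ x ^ p ^ (a + k)) ^ v := by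
            rw [h1, one_zpow, mul_one]
        _ = δ x ^ (u * (n : ℤ) + v * ((p ^ (a + k) : ℕ) : ℤ)) := by
            rw [zpow_add, ← zpow_natCast, ← zpow_mul, mul_comm u, mul_comm v]
        _ = δ x := by rw [huv, zpow_one]

theorem card_map_eq_pow_rank {G : Type*} [CommGroup G] {p m : ℕ} [Fact p.Prime]
    (X : G →* Multiplicative (Fin m → ZMod p)) (H : Subgroup G) {g : Fin m → G} (hg : ∀ i, g i ∈ H)
    (hH : ∀ x ∈ H, ∃ a : Fin m → ℤ, x = ∏ i, g i ^ a i) {R : Matrix (Fin m) (Fin m) (ZMod p)}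
    (hR : ∀ i, X (g i) = Multiplicative.ofAdd (R i)) : Nat.card (H.map X) = p ^ R.rank := by
  have h1 : Nat.card (Submodule.span (ZMod p) (Set.range R.row)) = p ^ R.rank := by
    rw [Module.natCard_eq_pow_finrank (K := ZMod p), Matrix.rank_eq_finrank_span_row, Nat.card_zmod]
  rw [← h1]
  refine Nat.card_congr (Equiv.setCongr (α := Fin m → ZMod p) ?_)
  have hmem : ∀ y ∈ H, Multiplicative.toAdd (X y) ∈ Submodule.span (ZMod p) (Set.range R.row) := by
    intro y hy
    obtain ⟨a, rfl⟩ := hH y hy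
    rw [map_prod, toAdd_prod]
    refine Submodule.sum_mem _ fun i _ ↦ ?_
    rw [map_zpow, toAdd_zpow, hR]
    exact zsmul_mem (Submodule.subset_span (Set.mem_range_self (f := R.row) i)) _
  have hmap : ∀ x ∈ Submodule.span (ZMod p) (Set.range R.row), Multiplicative.ofAdd x ∈ H.map X := by
    intro x hx
    induction hx using Submodule.span_induction with
    | mem x hx =>
      obtain ⟨i, rfl⟩ := hx
      exact ⟨g i, hg i, hR i⟩
    | zero => exact one_mem _
    | add x y _ _ hx hy => exact mul_mem hx hy
    | smul c x _ hx =>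
      obtain ⟨n, rfl⟩ := ZMod.natCast_zmod_surjective c
      rw [Nat.cast_smul_eq_nsmul, ofAdd_nsmul]
      exact pow_mem hx n
  ext x
  constructor
  · rintro ⟨y, hy, rfl⟩
    exact hmem y hy
  · exact hmap x

theorem card_quotient_eq_pow {G : Type*} [CommGroup G] [Finite G] {p m M : ℕ} [Fact p.Prime]
    {δ : G →* G} {X : G →* Multiplicative (Fin m → ZMod p)} (hX : ∀ x, X (δ x) = 1) {g : Fin m → G}
    (hg : ∀ i, g i ∈ δ.ker) (hgp : ∀ i, g i ^ p = 1)
    (hker : ∀ x ∈ δ.ker, ∃ a : Fin m → ℤ, x = ∏ i, g i ^ a i) {R : Matrix (Fin m) (Fin m) (ZMod p)}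
    (hR : ∀ i, X (g i) = Multiplicative.ofAdd (R i)) (hcard : Nat.card δ.ker ≤ p ^ M)
    (hrange : p ^ M ≤ Nat.card X.range) {C : Subgroup G}
    (hC : C = (CommGroup.primaryComponent G p).map δ) :
    Nat.card (C ⧸ (C.map δ).subgroupOf C) = p ^ (M - R.rank) := by
  obtain ⟨h1, h2⟩ := ker_eq_range_of_card_le hX (hcard.trans hrange)
  have hM : Nat.card δ.ker = p ^ M := hcard.antisymm (hrange.trans h2.ge)
  have hkp : δ.ker ≤ CommGroup.primaryComponent G p := by
    intro x hx
    obtain ⟨a, rfl⟩ := hker x hx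
    refine prod_mem fun i _ ↦ zpow_mem (CommGroup.mem_primaryComponent.2 ⟨1, ?_⟩) _
    rw [pow_one, hgp]
  have hle : C.map δ ≤ C := by
    rw [hC]
    refine Subgroup.map_mono ?_
    rw [map_primaryComponent]
    exact inf_le_left
  have hinf : δ.ker ⊓ C = X.ker ⊓ δ.ker := by
    rw [hC, map_primaryComponent, ← inf_assoc, inf_eq_left.2 hkp, h1, inf_comm]
  have h3 : Nat.card C = Nat.card (C.map δ) * Nat.card (X.ker ⊓ δ.ker : Subgroup G) := by
    rw [← hinf, ← Subgroup.relIndex_ker, mul_comm, Subgroup.relIndex, ← Subgroup.card_mul_index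
      (δ.ker.subgroupOf C)]
    congr 1
    rw [← Subgroup.inf_subgroupOf_right]
    exact Nat.card_congr (Subgroup.subgroupOfEquivOfLe inf_le_right).toEquiv
  have h4 : Nat.card δ.ker = p ^ R.rank * Nat.card (X.ker ⊓ δ.ker : Subgroup G) := by
    rw [← card_map_eq_pow_rank X δ.ker hg hker hR, ← Subgroup.relIndex_ker, mul_comm,
      Subgroup.relIndex,
      ← Subgroup.card_mul_index (X.ker.subgroupOf δ.ker)]
    congr 1
    rw [← Subgroup.inf_subgroupOf_right]
    exact Nat.card_congr (Subgroup.subgroupOfEquivOfLe inf_le_right).toEquiv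
  have h5 : Nat.card (C ⧸ (C.map δ).subgroupOf C) = Nat.card (X.ker ⊓ δ.ker : Subgroup G) := by
    have h6 := Subgroup.card_eq_card_quotient_mul_card_subgroup ((C.map δ).subgroupOf C)
    rw [Nat.card_congr (Subgroup.subgroupOfEquivOfLe hle).toEquiv, h3, mul_comm] at h6
    exact (Nat.eq_of_mul_eq_mul_right Nat.card_pos h6).symm
  have hp := (Fact.out : p.Prime)
  have h7 : R.rank ≤ M := by
    rw [← Nat.pow_dvd_pow_iff_le_right hp.one_lt, ← hM, h4]
    exact dvd_mul_right _ _
  rw [h5]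
  refine Nat.eq_of_mul_eq_mul_left (pow_pos hp.pos R.rank) ?_
  rw [← h4, hM, ← pow_add, Nat.add_sub_cancel' h7]

end GroupTheory

section AmbiguousClasses

open Polynomial FractionalIdeal

variable {F : Type*} [Field F] {p m : ℕ} (𝒟 : ArtinSchreierData F p m)
  {K : Type*} [Field K] [Algebra (RatFunc F) K] [Algebra F[X] K] [IsScalarTower F[X] (RatFunc F) K]
  [FiniteDimensional (RatFunc F) K]
  {O : Type*} [CommRing O] [IsDedekindDomain O] [Algebra F[X] O] [Algebra O K]
  [IsScalarTower F[X] O K] [IsFractionRing O K] [IsIntegralClosure O F[X] K]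
  [Fact p.Prime]

/-- Hilbert's Theorem 90, in all universes. -/
theorem exists_div_eq_of_norm_eq_one {k L : Type*} [Field k] [Field L] [Algebra k L]
    [FiniteDimensional k L] [IsGalois k L] {σ : L ≃ₐ[k] L}
    (hσ : ∀ τ : L ≃ₐ[k] L, τ ∈ Subgroup.zpowers σ) {x : L} (hx : Algebra.norm k x = 1) :
    ∃ y : Lˣ, (y : L) / σ y = x := by
  have ho : orderOf σ = Module.finrank k L := by
    rw [← IsGalois.card_aut_eq_finrank k L, orderOf_eq_card_of_forall_mem_zpowers hσ]
  have hx0 : x ≠ 0 := by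
    rintro rfl
    rw [Algebra.norm_zero] at hx
    exact zero_ne_one hx
  let a : ℕ → L := fun i ↦ ∏ j ∈ Finset.range i, (σ ^ j : L ≃ₐ[k] L) x
  have ha : a (Module.finrank k L) = 1 := by
    change ∏ j ∈ Finset.range _, _ = _
    rw [prod_range_pow_eq_norm hσ, hx, map_one]
  have ha_succ (i : ℕ) : x * σ (a i) = a (i + 1) := by
    change x * σ (∏ j ∈ _, _) = ∏ j ∈ _, _
    rw [Finset.prod_range_succ', map_prod, mul_comm]
    refine congrArg₂ _ (Finset.prod_congr rfl fun j _ ↦ ?_) rfl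
    rw [pow_succ', AlgEquiv.mul_apply]
  have hind : LinearIndependent L (fun i : Fin (Module.finrank k L) ↦
      ((σ ^ (i : ℕ) : L ≃ₐ[k] L) : L → L)) := by
    refine (linearIndependent_monoidHom L L).comp
      (fun i : Fin (Module.finrank k L) ↦ ((σ ^ (i : ℕ) : L ≃ₐ[k] L) : L →* L)) fun i j h ↦ ?_
    refine Fin.ext (pow_injOn_Iio_orderOf (x := σ) (by rw [ho]; exact i.2) (by
      rw [ho]; exact j.2) ?_)
    exact AlgEquiv.ext fun z ↦ DFunLike.congr_fun h z
  obtain ⟨z, hz⟩ : ∃ z, ∑ i ∈ Finset.range (Module.finrank k L), a i * (σ ^ i : L ≃ₐ[k] L) z ≠ 0 := by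
    by_contra! H
    have h0 : 0 < Module.finrank k L := Module.finrank_pos
    have := (Fintype.linearIndependent_iff.1 hind) (fun i ↦ a i) (by
      ext z
      rw [Finset.sum_apply, Pi.zero_apply, ← H z, Finset.sum_range]
      rfl) ⟨0, h0⟩
    simp [a] at this
  refine ⟨Units.mk0 _ hz, ?_⟩
  have hβ : x * σ (∑ i ∈ Finset.range (Module.finrank k L), a i * (σ ^ i : L ≃ₐ[k] L) z) =
      ∑ i ∈ Finset.range (Module.finrank k L), a i * (σ ^ i : L ≃ₐ[k] L) z := by
    have h1 : ∀ i, x * σ (a i * (σ ^ i : L ≃ₐ[k] L) z) = a (i + 1) * (σ ^ (i + 1) : L ≃ₐ[k] L) z := by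
      intro i
      rw [map_mul, ← mul_assoc, ha_succ, pow_succ', AlgEquiv.mul_apply]
    rw [map_sum, Finset.mul_sum, Finset.sum_congr rfl fun i _ ↦ h1 i]
    have h2 := Finset.sum_range_succ (fun i ↦ a i * (σ ^ i : L ≃ₐ[k] L) z) (Module.finrank k L)
    rw [Finset.sum_range_succ', ha, ← ho, pow_orderOf_eq_one, ho] at h2
    simpa [a] using h2
  rw [Units.val_mk0, div_eq_iff ((map_ne_zero_iff σ σ.injective).2 hz), hβ]

theorem exists_const_of_baseIdeal_eq_one {b : (RatFunc F)ˣ} (h : baseIdeal (RatFunc F) O K b = 1) :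
    ∃ c : F, c ≠ 0 ∧ (b : RatFunc F) = algebraMap F[X] (RatFunc F) (C c) := by
  obtain ⟨u, hu⟩ := exists_unit_of_toPrincipalIdeal_map_eq_one (A := F[X]) h
  obtain ⟨c, hc, hcu⟩ := Polynomial.isUnit_iff.1 u.isUnit
  exact ⟨c, hc.ne_zero, by rw [hcu, hu]⟩

/-- Hilbert 90 for elements whose norm is constant. -/
theorem exists_eq_const_mul_of_baseIdeal_norm [Fintype F] [CharP F p] [IsGalois (RatFunc F) K]
    {σ : K ≃ₐ[RatFunc F] K} (hσ : ∀ τ : K ≃ₐ[RatFunc F] K, τ ∈ Subgroup.zpowers σ)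
    (hdeg : Module.finrank (RatFunc F) K = p) {x : Kˣ}
    (h : baseIdeal (RatFunc F) O K (Units.map (Algebra.norm (RatFunc F)) x) = 1) :
    ∃ (w : (RatFunc F)ˣ) (y : Kˣ), baseIdeal (RatFunc F) O K w = 1 ∧
      (∃ c : F, (w : RatFunc F) = algebraMap F[X] (RatFunc F) (C c)) ∧
      x = Units.map (algebraMap (RatFunc F) K : RatFunc F →* K) w *
        (Units.map (σ : K →* K) y * y⁻¹) := by
  obtain ⟨c, hc, hcx⟩ := exists_const_of_baseIdeal_eq_one h
  obtain ⟨w, rfl⟩ : ∃ w : F, w ^ p = c := (frobeniusEquiv F p).surjective c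
  have hw : w ≠ 0 := fun h ↦ hc (by rw [h, zero_pow (Fact.out : p.Prime).ne_zero])
  have hCw : (C w : F[X]) ≠ 0 := by rwa [Ne, C_eq_zero]
  let W : (RatFunc F)ˣ := Units.mk0 _ (algebraMap_ratFunc_ne_zero hCw)
  have hWx : Algebra.norm (RatFunc F) ((W⁻¹ : (RatFunc F)ˣ) • (x : K)) = 1 := by
    rw [Units.smul_def, Algebra.smul_def, map_mul, Algebra.norm_algebraMap, hdeg]
    change _ * ((Units.map (Algebra.norm (RatFunc F)) x : (RatFunc F)ˣ) : RatFunc F) = 1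
    rw [hcx, C_pow, map_pow, ← mul_pow, Units.val_inv_eq_inv_val, Units.val_mk0,
      inv_mul_cancel₀ (algebraMap_ratFunc_ne_zero hCw), one_pow]
  obtain ⟨y, hy⟩ := exists_div_eq_of_norm_eq_one hσ hWx
  refine ⟨W, y⁻¹, ?_, ⟨w, rfl⟩, ?_⟩
  · exact ArtinSchreierData.baseIdeal_eq_one_of_isUnit (isUnit_C.2 (isUnit_iff_ne_zero.2 hw)) rfl
  · apply Units.ext
    rw [inv_inv, map_inv, Units.val_mul, Units.val_mul, Units.val_inv_eq_inv_val,
      mul_comm _ (y : K)]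
    change (x : K) = algebraMap (RatFunc F) K (W : RatFunc F) * (y * (σ y)⁻¹)
    rw [← div_eq_mul_inv, hy, Units.smul_def, Algebra.smul_def, ← mul_assoc, ← map_mul,
      Units.mul_inv, map_one, one_mul]

namespace ArtinSchreierData

theorem exists_eq_baseIdeal_mul_prod_of_apply_eq [CharP O p] [IsGalois (RatFunc F) K]
    {σ : K ≃ₐ[RatFunc F] K} (hσ : ∀ τ : K ≃ₐ[RatFunc F] K, τ ∈ Subgroup.zpowers σ)
    (hdeg : Module.finrank (RatFunc F) K = p)
    {α : K} (hα : α ^ p - α = algebraMap (RatFunc F) K 𝒟.D) {n : ℕ} (hn : ¬ p ∣ n)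
    (hσα : σ α = α + n) {s : (FractionalIdeal O⁰ K)ˣ ≃* (FractionalIdeal O⁰ K)ˣ}
    (hs : IsInducedBy σ s) {𝔓 : Fin m → (FractionalIdeal O⁰ K)ˣ}
    (h𝔓 : ∀ i, 𝔓 i ^ p = baseIdeal (RatFunc F) O K (𝒟.P i).unit)
    [Module.Finite F[X] O] [Module.IsTorsionFree F[X] O]
    {J : (FractionalIdeal O⁰ K)ˣ} (hJ : s J = J) :
    ∃ (c : (RatFunc F)ˣ) (a : Fin m → ℤ), J = baseIdeal (RatFunc F) O K c * ∏ i, 𝔓 i ^ a i := by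
  obtain ⟨b, hb⟩ := exists_orbitProd_eq (A := F[X]) hσ hs J
  rw [hdeg, orbitProd_of_eq hJ] at hb
  exact 𝒟.exists_eq_baseIdeal_mul_prod_of_pow_eq hσ hdeg hα hn hσα h𝔓 (b := b) hb

/-- Ambiguous ideal classes are represented by products of ramified primes. -/
theorem exists_eq_principal_mul_prod [Fintype F] [CharP F p] [CharP O p] [IsGalois (RatFunc F) K]
    {σ : K ≃ₐ[RatFunc F] K} (hσ : ∀ τ : K ≃ₐ[RatFunc F] K, τ ∈ Subgroup.zpowers σ)
    (hdeg : Module.finrank (RatFunc F) K = p)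
    {α : K} (hα : α ^ p - α = algebraMap (RatFunc F) K 𝒟.D) {n : ℕ} (hn : ¬ p ∣ n)
    (hσα : σ α = α + n) {s : (FractionalIdeal O⁰ K)ˣ ≃* (FractionalIdeal O⁰ K)ˣ}
    (hs : IsInducedBy σ s) {𝔓 : Fin m → (FractionalIdeal O⁰ K)ˣ}
    (h𝔓 : ∀ i, 𝔓 i ^ p = baseIdeal (RatFunc F) O K (𝒟.P i).unit)
    [Module.Finite F[X] O] [Module.IsTorsionFree F[X] O]
    {J : (FractionalIdeal O⁰ K)ˣ} {x : Kˣ} (hJ : s J = J * toPrincipalIdeal O K x) :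
    ∃ (y : Kˣ) (a : Fin m → ℤ), J = toPrincipalIdeal O K y * ∏ i, 𝔓 i ^ a i := by
  have h1 : baseIdeal (RatFunc F) O K (Units.map (Algebra.norm (RatFunc F)) x) = 1 := by
    have h2 := congrArg (orbitProd s (Module.finrank (RatFunc F) K)) hJ
    rw [orbitProd_map (hs.iterate_finrank hσ J), map_mul, hs.orbitProd_principal hσ F[X]] at h2
    exact (mul_eq_left.1 h2.symm)
  obtain ⟨w, y, hw, -, rfl⟩ := exists_eq_const_mul_of_baseIdeal_norm hσ hdeg h1
  have h3 : s (J * (toPrincipalIdeal O K y)⁻¹) = J * (toPrincipalIdeal O K y)⁻¹ := by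
    rw [map_mul, map_inv, hJ, hs.apply_toPrincipalIdeal F[X], map_mul, map_mul, map_inv]
    change J * (baseIdeal (RatFunc F) O K w * _) * _ = _
    rw [hw, one_mul, mul_comm (toPrincipalIdeal O K (Units.map (σ : K →* K) y)), ← mul_assoc,
      mul_inv_cancel_right]
  obtain ⟨c, a, h⟩ := 𝒟.exists_eq_baseIdeal_mul_prod_of_apply_eq hσ hdeg hα hn hσα hs h𝔓 h3
  refine ⟨Units.map (algebraMap (RatFunc F) K : RatFunc F →* K) c * y, a, ?_⟩
  rw [mul_inv_eq_iff_eq_mul] at h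
  rw [h, map_mul, baseIdeal, MonoidHom.comp_apply, mul_right_comm]

end ArtinSchreierData

end AmbiguousClasses

section InfinitePlace

open Polynomial IsDedekindDomain

/-- In a Dedekind domain with finite class group, every nonzero nonunit lies in a maximal ideal
some power of which is principal. -/
theorem exists_heightOneSpectrum_pow_eq_span {B : Type*} [CommRing B] [IsDedekindDomain B]
    [Finite (ClassGroup B)] {x : B} (hx0 : x ≠ 0) (hx : ¬ IsUnit x) :
    ∃ (v : HeightOneSpectrum B) (y : B) (h : ℕ), h ≠ 0 ∧ v.asIdeal ^ h = Ideal.span {y} ∧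
      x ∈ v.asIdeal := by
  obtain ⟨M, hM, hxM⟩ := exists_max_ideal_of_mem_nonunits hx
  have hM0 : M ≠ ⊥ := by
    rintro rfl
    exact hx0 (by simpa using hxM)
  have : Fintype (ClassGroup B) := Fintype.ofFinite _
  have hmem : M ∈ (Ideal B)⁰ := mem_nonZeroDivisors_of_ne_zero hM0
  have h1 : ClassGroup.mk0 (⟨M, hmem⟩ ^ Fintype.card (ClassGroup B) : (Ideal B)⁰) = 1 := by
    rw [map_pow, pow_card_eq_one]
  rw [ClassGroup.mk0_eq_one_iff] at h1
  obtain ⟨y, hy⟩ := h1.principal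
  exact ⟨⟨M, hM.isPrime, hM0⟩, y, _, Fintype.card_ne_zero, by simpa using hy, hxM⟩

/-- A function field with constants `F` has a place over `∞` (i.e. where `X` vanishes), a power of
which is generated, up to the integral closure of `F[X]`, by an element `y`. -/
theorem exists_valuation_of_finite (F : Type*) [Field F] [Fintype F] {L : Type*} [Field L]
    [Algebra (RatFunc F) L] [FiniteDimensional (RatFunc F) L]
    [Algebra.IsSeparable (RatFunc F) L] [Algebra F[X] L] [IsScalarTower F[X] (RatFunc F) L] :
    ∃ (v : Valuation L (WithZero (Multiplicative ℤ))) (y : L) (N : ℕ),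
      (∀ z, IsIntegral F[X] z → v z ≤ 1) ∧ v (algebraMap F[X] L X) < 1 ∧ v y < 1 ∧ y ≠ 0 ∧
      IsIntegral F[X] y ∧ IsIntegral F[X] (algebraMap F[X] L X ^ N / y) ∧
      ∀ σ : L ≃+* L, (∀ a, σ (algebraMap F[X] L a) = algebraMap F[X] L a) →
        v (σ y) < 1 → ∀ z, v z < 1 → v (σ z) < 1 := by
  classical
  let B := integralClosure F[X] L
  have : IsDedekindDomain B := IsIntegralClosure.isDedekindDomain F[X] (RatFunc F) L B
  have : IsFractionRing B L :=
    IsIntegralClosure.isFractionRing_of_finite_extension F[X] (RatFunc F) L B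
  have : Finite (ClassGroup B) :=
    @Finite.of_fintype _ (ClassGroup.fintypeOfAdmissibleOfFinite (RatFunc F) L
      (Polynomial.cardPowDegreeIsAdmissible :
        AbsoluteValue.IsAdmissible (Polynomial.cardPowDegree : AbsoluteValue F[X] ℤ)))
  have hinj : Function.Injective (algebraMap F[X] L) := by
    rw [IsScalarTower.algebraMap_eq F[X] (RatFunc F) L]
    exact (algebraMap (RatFunc F) L).injective.comp (IsFractionRing.injective F[X] (RatFunc F))
  have hinjB : Function.Injective (algebraMap F[X] B) :=
    algebraMap_injective_integralClosure (F := F) (O := B) L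
  have hx0 : algebraMap F[X] B X ≠ 0 := (map_ne_zero_iff _ hinjB).2 X_ne_zero
  have hxu : ¬ IsUnit (algebraMap F[X] B X) := by
    intro h
    have : IsLocalHom (algebraMap F[X] B) :=
      RingHom.IsIntegral.isLocalHom (algebraMap_isIntegral_iff.2 inferInstance) hinjB
    exact Polynomial.not_isUnit_X (isUnit_of_map_unit (algebraMap F[X] B) _ h)
  obtain ⟨v, y, h, h0, hy, hx⟩ := exists_heightOneSpectrum_pow_eq_span hx0 hxu
  have hymem : y ∈ v.asIdeal := by
    have : y ∈ v.asIdeal ^ h := by rw [hy]; exact Ideal.mem_span_singleton_self y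
    exact Ideal.pow_le_self h0 this
  have hy0 : y ≠ 0 := by
    rintro rfl
    rw [Ideal.span_singleton_zero] at hy
    exact v.ne_bot ((pow_eq_zero_iff h0).1 hy)
  have hdvd : y ∣ algebraMap F[X] B X ^ h := by
    rw [← Ideal.mem_span_singleton, ← hy]
    exact Ideal.pow_mem_pow hx h
  have hval : ∀ z : B, v.valuation L (z : L) < 1 ↔ z ∈ v.asIdeal := fun z ↦
    v.valuation_lt_one_iff_mem z
  refine ⟨v.valuation L, (y : L), h, fun z hz ↦ v.valuation_le_one (K := L) (⟨z, hz⟩ : B), 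
    (hval (algebraMap F[X] B X)).2 hx, (hval y).2 hymem, fun h ↦ hy0 (Subtype.ext h), y.2, ?_, ?_⟩
  · obtain ⟨c, hc⟩ := hdvd
    have : algebraMap F[X] L X ^ h = (y : L) * (c : L) := congrArg (Subtype.val : B → L) hc
    rw [this, mul_div_cancel_left₀ _ (fun h ↦ hy0 (Subtype.ext h))]
    exact c.2
  · intro σ hσ hσy z hz
    have hσint : ∀ z : B, IsIntegral F[X] (σ (z : L)) := fun z ↦ by
      let σ' : L →ₐ[F[X]] L := { (σ : L →+* L) with commutes' := hσ }
      exact IsIntegral.map σ' z.2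
    let τ : B →+* B := 
      { toFun := fun z ↦ ⟨σ (z : L), hσint z⟩
        map_one' := Subtype.ext (map_one σ)
        map_mul' := fun a b ↦ Subtype.ext (map_mul σ _ _)
        map_zero' := Subtype.ext (map_zero σ)
        map_add' := fun a b ↦ Subtype.ext (map_add σ _ _) }
    have hτ : ∀ z : B, ((τ z : B) : L) = σ z := fun z ↦ rfl
    have hle : v.asIdeal ≤ v.asIdeal.comap τ := by
      have : (v.asIdeal.comap τ).IsPrime := Ideal.comap_isPrime τ v.asIdeal
      refine Ideal.IsPrime.le_of_pow_le (n := h) ?_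
      rw [hy, Ideal.span_singleton_le_iff_mem, Ideal.mem_comap, ← hval]
      exact hσy
    have heq : v.asIdeal = v.asIdeal.comap τ :=
      (v.isMaximal).eq_of_le (Ideal.comap_ne_top τ v.isPrime.ne_top) hle
    obtain ⟨a, b, hab⟩ := v.exists_primeCompl_mul_eq_of_integer z hz.le
    have hb : v.valuation L ((b : B) : L) = 1 := v.valuation_eq_one_iff_notMem.2 b.2
    have hσb : v.valuation L (σ ((b : B) : L)) = 1 := by
      refine v.valuation_eq_one_iff_notMem (r := τ b).2 fun h ↦ b.2 ?_
      exact heq.ge h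
    have hab' : z * ((b : B) : L) = (a : L) := hab
    have ha : a ∈ v.asIdeal := by
      rw [← hval, ← hab', map_mul, hb, mul_one]
      exact hz
    have := congrArg (v.valuation L) (congrArg σ hab')
    rw [map_mul, map_mul, hσb, mul_one] at this
    rw [this]
    exact (hval (τ a)).2 (hle ha)

end InfinitePlace

section ChangeOfVariable

open Polynomial

/-- A rational function field is finite separable over a subfield containing the constants, if
the variable is a simple root of some polynomial over that subfield. -/
theorem finite_and_isSeparable_of_aeval_eq_zero {F E k : Type*} [Field F] [Field E] [Field k]
    [Algebra F[X] E] [IsFractionRing F[X] E] [Algebra k E]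
    (hC : ∀ c : F, algebraMap F[X] E (C c) ∈ (algebraMap k E).range) {q : k[X]}
    (hq : aeval (algebraMap F[X] E X) q = 0)
    (hq' : aeval (algebraMap F[X] E X) (derivative q) ≠ 0) :
    FiniteDimensional k E ∧ Algebra.IsSeparable k E := by
  have hq0 : q ≠ 0 := by
    rintro rfl
    simp at hq'
  have hint : IsIntegral k (algebraMap F[X] E X) :=
    isAlgebraic_iff_isIntegral.1 ⟨q, hq0, hq⟩
  have hsep : IsSeparable k (algebraMap F[X] E X) := by
    refine (separable_iff_derivative_ne_zero (minpoly.irreducible hint)).2 fun h ↦ hq' ?_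
    obtain ⟨g, hg⟩ := minpoly.dvd k _ hq
    rw [hg, derivative_mul, h, zero_mul, zero_add, map_mul, minpoly.aeval, zero_mul]
  have htop : IntermediateField.adjoin k {algebraMap F[X] E X} = ⊤ := by
    have hpol : ∀ g : F[X], algebraMap F[X] E g ∈
        IntermediateField.adjoin k {algebraMap F[X] E X} := by
      intro g
      induction g using Polynomial.induction_on with
      | C c =>
        obtain ⟨b, hb⟩ := hC c
        rw [← hb]
        exact IntermediateField.algebraMap_mem _ b
      | add g h hg hh => rw [map_add]; exact add_mem hg hh
      | monomial n c ih =>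
        rw [pow_succ, ← mul_assoc, map_mul]
        exact mul_mem ih (IntermediateField.mem_adjoin_simple_self k _)
    refine eq_top_iff.2 fun z _ ↦ ?_
    obtain ⟨a, b, -, rfl⟩ := IsFractionRing.div_surjective (A := F[X]) z
    exact div_mem (hpol a) (hpol b)
  have h1 := IntermediateField.adjoin.finiteDimensional hint
  have h2 := IntermediateField.isSeparable_adjoin_simple_iff_isSeparable k E |>.2 hsep
  rw [htop] at h1 h2
  exact ⟨Module.Finite.equiv (IntermediateField.topEquiv (F := k) (E := E)).toLinearEquiv,
    AlgEquiv.Algebra.isSeparable (IntermediateField.topEquiv (F := k) (E := E))⟩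

/-- The substitution of `1 / Q` for the variable. -/
theorem exists_ringHom_X_eq_inv {F : Type*} [Field F] {Q : F[X]} (hQ : Q.natDegree ≠ 0) :
    ∃ ψ : RatFunc F →+* RatFunc F,
      ψ (algebraMap F[X] (RatFunc F) X) = (algebraMap F[X] (RatFunc F) Q)⁻¹ ∧
      ∀ c : F, ψ (algebraMap F[X] (RatFunc F) (C c)) = algebraMap F[X] (RatFunc F) (C c) := by
  have hinj : Function.Injective (aeval (R := F) (algebraMap F[X] (RatFunc F) Q)⁻¹) := by
    rw [← transcendental_iff_injective]
    have h1 : Transcendental F (algebraMap F[X] (RatFunc F) Q) :=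
      (transcendental_algebraMap_iff (IsFractionRing.injective F[X] (RatFunc F))).2
        (Q.transcendental hQ (by simpa using fun h : Q = 0 ↦ hQ (by rw [h, natDegree_zero])))
    exact fun h ↦ h1 (IsAlgebraic.inv_iff.1 h)
  refine ⟨IsFractionRing.lift (A := F[X]) (K := RatFunc F)
    (g := (aeval (R := F) (algebraMap F[X] (RatFunc F) Q)⁻¹).toRingHom) hinj, ?_, fun c ↦ ?_⟩
  · rw [IsFractionRing.lift_algebraMap]
    simp
  · rw [IsFractionRing.lift_algebraMap]
    simp

theorem finite_and_isSeparable_of_ringHom {F : Type*} [Field F] [Fintype F] {Q : F[X]}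
    (hQ : Irreducible Q) {E : Type*} [Field E] [Algebra F[X] E] [IsFractionRing F[X] E]
    [Algebra (RatFunc F) E]
    (hX : algebraMap (RatFunc F) E (algebraMap F[X] (RatFunc F) X) = (algebraMap F[X] E Q)⁻¹)
    (hC : ∀ c : F, algebraMap (RatFunc F) E (algebraMap F[X] (RatFunc F) (C c)) =
      algebraMap F[X] E (C c)) :
    FiniteDimensional (RatFunc F) E ∧ Algebra.IsSeparable (RatFunc F) E := by
  let i : F →+* RatFunc F := (algebraMap F[X] (RatFunc F)).comp C
  have key : ∀ g : F[X], aeval (algebraMap F[X] E X) (g.map i) = algebraMap F[X] E g := by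
    intro g
    rw [aeval_def, eval₂_map]
    have : (algebraMap (RatFunc F) E).comp i = (algebraMap F[X] E).comp C :=
      RingHom.ext fun c ↦ hC c
    rw [this, ← hom_eval₂, eval₂_C_X]
  have hQ' : derivative Q ≠ 0 := (separable_iff_derivative_ne_zero hQ).1
    (PerfectField.separable_of_irreducible hQ)
  refine finite_and_isSeparable_of_aeval_eq_zero (F := F) (E := E) (k := RatFunc F)
    (fun c ↦ ⟨_, hC c⟩) (q := Q.map i - C (algebraMap F[X] (RatFunc F) X)⁻¹) ?_ ?_
  · rw [map_sub, key, aeval_C, map_inv₀, hX, inv_inv, sub_self]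
  · rw [derivative_sub, derivative_C, sub_zero, derivative_map, key]
    exact (map_ne_zero_iff _ (IsFractionRing.injective F[X] E)).2 hQ'

/-- If `z` is integral over `F[1/Q]`, then some `Q ^ n * z` is integral over `F[X]`. -/
theorem exists_isIntegral_pow_mul {F L : Type*} [Field F] [Field L] [Algebra F[X] L] {Q : F[X]}
    (hQ : algebraMap F[X] L Q ≠ 0) (φ : F[X] →+* L) (hX : φ X = (algebraMap F[X] L Q)⁻¹)
    (hC : ∀ c : F, φ (C c) = algebraMap F[X] L (C c)) {z : L} (hz : φ.IsIntegralElem z) :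
    ∃ n : ℕ, IsIntegral F[X] (algebraMap F[X] L Q ^ n * z) := by
  let : Algebra (Localization.Away Q) L :=
    (IsLocalization.Away.lift (S := Localization.Away Q) Q (g := algebraMap F[X] L)
      (isUnit_iff_ne_zero.2 hQ)).toAlgebra
  have htower : IsScalarTower F[X] (Localization.Away Q) L :=
    IsScalarTower.of_algebraMap_eq fun x ↦
      (IsLocalization.Away.lift_eq Q (isUnit_iff_ne_zero.2 hQ) x).symm
  have hφ : φ = (algebraMap (Localization.Away Q) L).comp
      (eval₂RingHom ((algebraMap F[X] (Localization.Away Q)).comp C)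
        (IsLocalization.Away.invSelf Q)) := by
    refine Polynomial.ringHom_ext (fun c ↦ ?_) ?_
    · rw [hC, RingHom.comp_apply, coe_eval₂RingHom, eval₂_C, RingHom.comp_apply,
        ← IsScalarTower.algebraMap_apply]
    · rw [hX, RingHom.comp_apply, coe_eval₂RingHom, eval₂_X]
      refine inv_eq_of_mul_eq_one_right ?_
      rw [IsScalarTower.algebraMap_apply F[X] (Localization.Away Q) L, ← map_mul,
        IsLocalization.Away.mul_invSelf, map_one]
  have hz' : IsIntegral (Localization.Away Q) z := by
    obtain ⟨q, hq, h0⟩ := hz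
    refine ⟨q.map (eval₂RingHom ((algebraMap F[X] (Localization.Away Q)).comp C)
        (IsLocalization.Away.invSelf Q)), hq.map _, ?_⟩
    rw [eval₂_map, ← hφ, h0]
  obtain ⟨⟨_, n, rfl⟩, h⟩ :=
    IsIntegral.exists_multiple_integral_of_isLocalization (R := F[X]) (.powers Q) z hz'
  refine ⟨n, ?_⟩
  rwa [Submonoid.smul_def, Algebra.smul_def, map_pow] at h

/-- `exists_valuation_of_finite` for a function field given by a ring homomorphism. -/
theorem exists_valuation_of_ringHom {F E L : Type*} [Field F] [Fintype F] [Field E] [Field L]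
    [Algebra E L] [FiniteDimensional E L] [Algebra.IsSeparable E L] (ψ : RatFunc F →+* E)
    (hfin : letI := ψ.toAlgebra; FiniteDimensional (RatFunc F) E ∧
      Algebra.IsSeparable (RatFunc F) E)
    (φ : F[X] →+* L) (hφ : φ = (algebraMap E L).comp (ψ.comp (algebraMap F[X] (RatFunc F)))) :
    ∃ (v : Valuation L (WithZero (Multiplicative ℤ))) (y : L) (N : ℕ),
      (∀ z, φ.IsIntegralElem z → v z ≤ 1) ∧ v (φ X) < 1 ∧ v y < 1 ∧ y ≠ 0 ∧
      φ.IsIntegralElem y ∧ φ.IsIntegralElem (φ X ^ N / y) ∧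
      ∀ σ : L ≃ₐ[E] L, v (σ y) < 1 → ∀ z, v z < 1 → v (σ z) < 1 := by
  let := ψ.toAlgebra
  let : Algebra (RatFunc F) L := ((algebraMap E L).comp ψ).toAlgebra
  let : Algebra F[X] L := φ.toAlgebra
  have : IsScalarTower (RatFunc F) E L := IsScalarTower.of_algebraMap_eq fun _ ↦ rfl
  have : IsScalarTower F[X] (RatFunc F) L := IsScalarTower.of_algebraMap_eq fun x ↦
    DFunLike.congr_fun hφ x
  obtain ⟨h1, h2⟩ := hfin
  have : FiniteDimensional (RatFunc F) L := FiniteDimensional.trans (RatFunc F) E L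
  have : Algebra.IsSeparable (RatFunc F) L := Algebra.IsSeparable.trans (RatFunc F) E L
  obtain ⟨v, y, N, a1, a2, a3, a4, a5, a6, a7⟩ := exists_valuation_of_finite F (L := L)
  refine ⟨v, y, N, a1, a2, a3, a4, a5, a6, fun σ ↦ a7 (σ : L ≃+* L) fun a ↦ ?_⟩
  change σ (φ a) = φ a
  rw [hφ]
  exact σ.commutes _

/-- A place `v` of `K` at infinity, and an element `y` which has its zeros in `v` and is a unit
away from `v` and a given finite place `Q`. -/
theorem exists_valuation_of_finitePlace {F : Type*} [Field F] [Fintype F] {K : Type*} [Field K]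
    [Algebra (RatFunc F) K] [FiniteDimensional (RatFunc F) K] [Algebra.IsSeparable (RatFunc F) K]
    [Algebra F[X] K] [IsScalarTower F[X] (RatFunc F) K] (Q : FinitePlace F) :
    ∃ (v : Valuation K (WithZero (Multiplicative ℤ))) (y : K) (N : ℕ),
      (∀ c : F, c ≠ 0 → v (algebraMap F[X] K (C c)) = 1) ∧ 1 < v (algebraMap F[X] K X) ∧
      v y < 1 ∧ y ≠ 0 ∧ IsIntegral F[X] (algebraMap F[X] K Q.1 ^ N * y) ∧
      IsIntegral F[X] (algebraMap F[X] K Q.1 ^ N * y⁻¹) ∧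
      ∀ σ : K ≃ₐ[RatFunc F] K, v (σ y) < 1 → ∀ z, v z < 1 → v (σ z) < 1 := by
  obtain ⟨ψ, hX, hC⟩ := exists_ringHom_X_eq_inv (Q := Q.1) Q.2.2.natDegree_pos.ne'
  obtain ⟨φ, hφ⟩ : ∃ φ : F[X] →+* K, φ = (algebraMap (RatFunc F) K).comp
    (ψ.comp (algebraMap F[X] (RatFunc F))) := ⟨_, rfl⟩
  have hφX : φ X = (algebraMap F[X] K Q.1)⁻¹ := by
    rw [hφ, RingHom.comp_apply, RingHom.comp_apply, hX, map_inv₀, ← IsScalarTower.algebraMap_apply]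
  have hφC : ∀ c : F, φ (C c) = algebraMap F[X] K (C c) := fun c ↦ by
    rw [hφ, RingHom.comp_apply, RingHom.comp_apply, hC, ← IsScalarTower.algebraMap_apply]
  have hinj : Function.Injective (algebraMap F[X] K) := by
    rw [IsScalarTower.algebraMap_eq F[X] (RatFunc F) K]
    exact (algebraMap (RatFunc F) K).injective.comp (IsFractionRing.injective F[X] (RatFunc F))
  have hQ0 : algebraMap F[X] K Q.1 ≠ 0 := (map_ne_zero_iff _ hinj).2 Q.2.2.ne_zero
  obtain ⟨v, y, N, a1, a2, a3, a4, a5, a6, a7⟩ := exists_valuation_of_ringHom ψ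
    (by
      let := ψ.toAlgebra
      exact finite_and_isSeparable_of_ringHom Q.2.2 hX hC) φ hφ
  obtain ⟨n1, hn1⟩ := exists_isIntegral_pow_mul hQ0 φ hφX hφC a5
  obtain ⟨n2, hn2⟩ := exists_isIntegral_pow_mul hQ0 φ hφX hφC a6
  have hle : ∀ c : F, v (algebraMap F[X] K (C c)) ≤ 1 := fun c ↦ by
    rw [← hφC]
    exact a1 _ (φ.isIntegralElem_map)
  have hQi : IsIntegral F[X] (algebraMap F[X] K Q.1) := isIntegral_algebraMap
  have hconst : ∀ c : F, c ≠ 0 → v (algebraMap F[X] K (C c)) = 1 := by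
    intro c hc
    refine le_antisymm (hle c) ?_
    have h1 := hle c⁻¹
    have h2 : v (algebraMap F[X] K (C c)) * v (algebraMap F[X] K (C c⁻¹)) = 1 := by
      rw [← map_mul, ← map_mul, ← C_mul, mul_inv_cancel₀ hc, C_1, map_one, map_one]
    rw [← h2]
    exact mul_le_of_le_one_right' h1
  have hQv : 1 < v (algebraMap F[X] K Q.1) := by
    rw [hφX, map_inv₀] at a2
    exact (inv_lt_one₀ (zero_lt_iff.2 ((Valuation.ne_zero_iff v).2 hQ0))).1 a2
  refine ⟨v, y, n1 + (n2 + N), hconst, ?_, a3, a4, ?_, ?_, a7⟩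
  · by_contra! h
    refine hQv.not_ge ?_
    have : ∀ g : F[X], v (algebraMap F[X] K g) ≤ 1 := by
      intro g
      induction g using Polynomial.induction_on with
      | C c => exact hle c
      | add g h hg hh => rw [map_add]; exact (v.map_add _ _).trans (max_le hg hh)
      | monomial n c ih =>
        rw [pow_succ, ← mul_assoc, map_mul, map_mul]
        exact mul_le_one' ih h
    exact this _
  · rw [add_comm n1, pow_add, mul_assoc]
    exact (hQi.pow _).mul hn1
  · have : algebraMap F[X] K Q.1 ^ (n1 + (n2 + N)) * y⁻¹ = 
      algebraMap F[X] K Q.1 ^ (n1 + N + N) * (algebraMap F[X] K Q.1 ^ n2 * (φ X ^ N / y)) := by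
      generalize algebraMap F[X] K Q.1 = z at hQ0 hφX ⊢
      rw [hφX, inv_pow, div_eq_mul_inv, pow_add, pow_add, pow_add, pow_add]
      field_simp
    rw [this]
    exact (hQi.pow _).mul hn2

end ChangeOfVariable

section TotallyRamified

open Polynomial FractionalIdeal

variable {F : Type*} [Field F] {p m : ℕ} 
  {K : Type*} [Field K] [Algebra (RatFunc F) K] [Algebra F[X] K] [IsScalarTower F[X] (RatFunc F) K]
  [FiniteDimensional (RatFunc F) K]
  {O : Type*} [CommRing O] [IsDedekindDomain O] [Algebra F[X] O] [Algebra O K]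
  [IsScalarTower F[X] O K] [IsFractionRing O K] [IsIntegralClosure O F[X] K]

theorem IsInducedBy.mono {σ : K ≃ₐ[RatFunc F] K}
    {s : (FractionalIdeal O⁰ K)ˣ ≃* (FractionalIdeal O⁰ K)ˣ} (hs : IsInducedBy σ s)
    {I J : (FractionalIdeal O⁰ K)ˣ} (h : (I : FractionalIdeal O⁰ K) ≤ J) :
    (s I : FractionalIdeal O⁰ K) ≤ s J := by
  rw [← SetLike.coe_subset_coe, hs, hs]
  exact Set.image_mono h

theorem IsInducedBy.iterate_le_one {σ : K ≃ₐ[RatFunc F] K}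
    {s : (FractionalIdeal O⁰ K)ˣ ≃* (FractionalIdeal O⁰ K)ˣ} (hs : IsInducedBy σ s)
    {I : (FractionalIdeal O⁰ K)ˣ} (h : (I : FractionalIdeal O⁰ K) ≤ 1) (i : ℕ) :
    ((s^[i] I : (FractionalIdeal O⁰ K)ˣ) : FractionalIdeal O⁰ K) ≤ 1 := by
  induction i with
  | zero => exact h
  | succ i ih =>
    rw [Function.iterate_succ_apply']
    have := hs.mono (J := 1) ih
    rwa [_root_.map_one, Units.val_one] at this

theorem coe_prod_le_one {ι : Type*} (t : Finset ι) (g : ι → (FractionalIdeal O⁰ K)ˣ)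
    (h : ∀ i ∈ t, (g i : FractionalIdeal O⁰ K) ≤ 1) :
    ((∏ i ∈ t, g i : (FractionalIdeal O⁰ K)ˣ) : FractionalIdeal O⁰ K) ≤ 1 := by
  rw [Units.coe_prod]
  exact Finset.prod_le_one' h

theorem IsInducedBy.orbitProd_le {σ : K ≃ₐ[RatFunc F] K}
    {s : (FractionalIdeal O⁰ K)ˣ ≃* (FractionalIdeal O⁰ K)ˣ} (hs : IsInducedBy σ s)
    {I : (FractionalIdeal O⁰ K)ˣ} (h : (I : FractionalIdeal O⁰ K) ≤ 1) (hp : p ≠ 0) :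
    (orbitProd s p I : FractionalIdeal O⁰ K) ≤ I := by
  obtain ⟨q, rfl⟩ := Nat.exists_eq_succ_of_ne_zero hp
  rw [orbitProd_apply, Finset.prod_range_succ', Units.val_mul, Function.iterate_zero, id]
  exact mul_le_of_le_one_left' (coe_prod_le_one _ _ fun i _ ↦ hs.iterate_le_one h _)

theorem IsInducedBy.eq_one_of_orbitProd_eq_one {σ : K ≃ₐ[RatFunc F] K}
    {s : (FractionalIdeal O⁰ K)ˣ ≃* (FractionalIdeal O⁰ K)ˣ} (hs : IsInducedBy σ s)
    {I : (FractionalIdeal O⁰ K)ˣ} (h : (I : FractionalIdeal O⁰ K) ≤ 1) (hp : p ≠ 0)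
    (h1 : orbitProd s p I = 1) : I = 1 := by
  have := hs.orbitProd_le h hp
  rw [h1, Units.val_one] at this
  exact Units.ext (le_antisymm h this)

/-- An ideal whose `p`-th power is generated by a place of the base field is prime. -/
theorem IsInducedBy.exists_prime_coe_eq [IsGalois (RatFunc F) K] [Module.Finite F[X] O]
    [Module.IsTorsionFree F[X] O] {σ : K ≃ₐ[RatFunc F] K}
    (hσ : ∀ τ : K ≃ₐ[RatFunc F] K, τ ∈ Subgroup.zpowers σ)
    (hdeg : Module.finrank (RatFunc F) K = p)
    {s : (FractionalIdeal O⁰ K)ˣ ≃* (FractionalIdeal O⁰ K)ˣ} (hs : IsInducedBy σ s)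
    (hp : p ≠ 0) {Q : FinitePlace F} {J : (FractionalIdeal O⁰ K)ˣ}
    (hJ : J ^ p = baseIdeal (RatFunc F) O K Q.unit) :
    ∃ w : Ideal O, Prime w ∧ (w : FractionalIdeal O⁰ K) = J := by
  have hQK : algebraMap (RatFunc F) K Q.unit = algebraMap O K (algebraMap F[X] O Q.1) := by
    rw [FinitePlace.unit, Units.val_mk0, ← IsScalarTower.algebraMap_apply,
      ← IsScalarTower.algebraMap_apply]
  have hinj := algebraMap_injective_integralClosure (F := F) (O := O) K
  have hJ1 : (J : FractionalIdeal O⁰ K) ≤ 1 := by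
    intro x hx
    have hxp : x ^ p ∈ ((J ^ p : (FractionalIdeal O⁰ K)ˣ) : FractionalIdeal O⁰ K) := by
      rw [Units.val_pow_eq_pow_val, ← mem_coe, FractionalIdeal.coe_pow]
      exact Submodule.pow_mem_pow _ hx p
    rw [hJ, coe_baseIdeal, mem_spanSingleton] at hxp
    obtain ⟨c, hc⟩ := hxp
    rw [hQK, Algebra.smul_def, ← _root_.map_mul] at hc
    have hint : IsIntegral O (x ^ p) := by
      rw [← hc]
      exact isIntegral_algebraMap
    obtain ⟨z, hz⟩ := IsIntegrallyClosed.isIntegral_iff.1 (hint.of_pow (Nat.pos_of_ne_zero hp))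
    exact (mem_one_iff _).2 ⟨z, hz⟩
  obtain ⟨I, hI⟩ := le_one_iff_exists_coeIdeal.1 hJ1
  have hI1 : I ≠ ⊤ := by
    rintro rfl
    rw [coeIdeal_top, eq_comm, Units.val_eq_one] at hI
    rw [hI, one_pow, eq_comm] at hJ
    obtain ⟨u, hu⟩ := exists_unit_of_toPrincipalIdeal_map_eq_one (A := F[X]) (O := O) (K := K) hJ
    refine Q.2.2.not_isUnit ?_
    have : (u : F[X]) = Q.1 := IsFractionRing.injective F[X] (RatFunc F) hu
    rw [← this]
    exact u.isUnit
  obtain ⟨w, hw, hIw⟩ := Ideal.exists_le_maximal I hI1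
  have hI0 : I ≠ ⊥ := by
    rintro rfl
    rw [coeIdeal_bot] at hI
    exact J.ne_zero hI.symm
  have hw0 : w ≠ ⊥ := fun h ↦ hI0 (le_bot_iff.1 (h ▸ hIw))
  obtain ⟨W, hW⟩ := exists_coe_eq_ideal (K := K) hw0
  have hW1 : (W : FractionalIdeal O⁰ K) ≤ 1 := hW ▸ coeIdeal_le_one
  have hJW : (J : FractionalIdeal O⁰ K) ≤ W := by
    rw [← hI, hW]
    exact (coeIdeal_le_coeIdeal K).2 hIw
  have hsJ : s J = J := hs.apply_eq_of_pow_eq hp hJ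
  have hdiv : ((J * W⁻¹ : (FractionalIdeal O⁰ K)ˣ) : FractionalIdeal O⁰ K) ≤ 1 := by
    have h := mul_le_mul_left hJW ((W⁻¹ : (FractionalIdeal O⁰ K)ˣ) : FractionalIdeal O⁰ K)
    rwa [← Units.val_mul, ← Units.val_mul, mul_inv_cancel, Units.val_one] at h
  obtain ⟨b, hb⟩ := exists_orbitProd_eq (A := F[X]) hσ hs W
  rw [hdeg] at hb
  have hprod : orbitProd s p (J * W⁻¹) = baseIdeal (RatFunc F) O K (Q.unit * b⁻¹) := by
    rw [_root_.map_mul, map_inv, orbitProd_of_eq hsJ, hJ, hb, _root_.map_mul, map_inv]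
    rfl
  have hle1 : (baseIdeal (RatFunc F) O K b : FractionalIdeal O⁰ K) ≤ 1 := by
    refine le_trans ?_ hW1
    have := hs.orbitProd_le hW1 hp
    rwa [hb] at this
  have hle2 : (baseIdeal (RatFunc F) O K (Q.unit * b⁻¹) : FractionalIdeal O⁰ K) ≤ 1 := by
    rw [← hprod]
    exact (hs.orbitProd_le hdiv hp).trans hdiv
  obtain ⟨g, hg⟩ := ArtinSchreierData.exists_eq_algebraMap_of_baseIdeal_le_one (O := O) hle1
  obtain ⟨g', hg'⟩ := ArtinSchreierData.exists_eq_algebraMap_of_baseIdeal_le_one (O := O) hle2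
  have hgg : Q.1 = g * g' := by
    apply IsFractionRing.injective F[X] (RatFunc F)
    rw [_root_.map_mul, ← hg, ← hg', ← Units.val_mul, mul_comm, inv_mul_cancel_right]
    rfl
  rcases Q.2.2.isUnit_or_isUnit hgg with h | h
  · have h1 := ArtinSchreierData.baseIdeal_eq_one_of_isUnit (O := O) (K := K) h hg
    have h2 := hs.eq_one_of_orbitProd_eq_one hW1 hp (hb.trans h1)
    rw [h2, Units.val_one, eq_comm, coeIdeal_eq_one] at hW
    exact absurd (hW.trans Ideal.one_eq_top) hw.ne_top
  · have h1 := ArtinSchreierData.baseIdeal_eq_one_of_isUnit (O := O) (K := K) h hg'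
    have h2 := hs.eq_one_of_orbitProd_eq_one hdiv hp (hprod.trans h1)
    rw [mul_inv_eq_one] at h2
    exact ⟨w, Ideal.prime_of_isPrime hw0 hw.isPrime, by rw [h2, hW]⟩

theorem exists_principal_eq_zpow_mul {Q : FinitePlace F} {J : (FractionalIdeal O⁰ K)ˣ}
    (hJ : J ^ p = baseIdeal (RatFunc F) O K Q.unit) {w : Ideal O} (hw : Prime w)
    (hwJ : (w : FractionalIdeal O⁰ K) = J) {y : Kˣ} {N : ℕ}
    (h1 : IsIntegral F[X] (algebraMap F[X] K Q.1 ^ N * y))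
    (h2 : IsIntegral F[X] (algebraMap F[X] K Q.1 ^ N * (y : K)⁻¹)) :
    ∃ (r : ℤ) (b : (RatFunc F)ˣ), toPrincipalIdeal O K y = J ^ r * baseIdeal (RatFunc F) O K b := by
  obtain ⟨a, ha⟩ := IsIntegralClosure.isIntegral_iff (A := O).1 h1
  obtain ⟨a', ha'⟩ := IsIntegralClosure.isIntegral_iff (A := O).1 h2
  have haa : a * a' = algebraMap F[X] O Q.1 ^ (2 * N) := by
    apply IsFractionRing.injective O K
    rw [_root_.map_mul, ha, ha', _root_.map_pow, ← IsScalarTower.algebraMap_apply]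
    field_simp
    ring
  have hwp : w ^ p = Ideal.span {algebraMap F[X] O Q.1} := by
    apply coeIdeal_injective (R := O) (K := K)
    change ((w ^ p : Ideal O) : FractionalIdeal O⁰ K) = (Ideal.span {_} : Ideal O)
    rw [coeIdeal_pow, hwJ, ← Units.val_pow_eq_pow_val, hJ, coe_baseIdeal, coeIdeal_span_singleton]
    rw [FinitePlace.unit, Units.val_mk0, ← IsScalarTower.algebraMap_apply,
      ← IsScalarTower.algebraMap_apply]
  have hdvd : Ideal.span {a} ∣ w ^ (p * (2 * N)) := by
    rw [pow_mul, hwp, Ideal.span_singleton_pow, ← haa, ← Ideal.span_singleton_mul_span_singleton]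
    exact dvd_mul_right _ _
  obtain ⟨i, -, hi⟩ := (dvd_prime_pow hw _).1 hdvd
  rw [associated_iff_eq] at hi
  refine ⟨i, (Q.unit ^ N)⁻¹, ?_⟩
  rw [map_inv, eq_mul_inv_iff_mul_eq, zpow_natCast]
  refine Units.ext ?_
  rw [Units.val_mul, coe_toPrincipalIdeal, coe_baseIdeal, Units.val_pow_eq_pow_val J, ← hwJ,
    ← coeIdeal_pow, ← hi, coeIdeal_span_singleton, ha, spanSingleton_mul_spanSingleton, mul_comm]
  rw [FinitePlace.unit, Units.val_pow_eq_pow_val, Units.val_mk0, _root_.map_pow,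
    ← IsScalarTower.algebraMap_apply]

end TotallyRamified

section UnitDescent

open Polynomial

theorem exists_sub_one_pow_eq (p : ℕ) [Fact p.Prime] :
    ∃ h : ℤ[X], (X - 1) ^ (p - 1) = ∑ i ∈ Finset.range p, X ^ i + C (p : ℤ) * h := by
  have hp := (Fact.out : p.Prime)
  have key : ((X - 1 : ℤ[X]) ^ (p - 1) - ∑ i ∈ Finset.range p, X ^ i).map
      (Int.castRingHom (ZMod p)) = 0 := by
    have h1 : (X - 1 : (ZMod p)[X]) ≠ 0 := by
      simpa using X_sub_C_ne_zero (1 : ZMod p)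
    apply mul_right_cancel₀ h1
    simp only [Polynomial.map_sub, Polynomial.map_pow, map_X, Polynomial.map_one,
      Polynomial.map_sum, sub_mul, zero_mul, geom_sum_mul]
    rw [← pow_succ, Nat.sub_add_cancel hp.one_le, sub_pow_char, one_pow, sub_self]
  obtain ⟨h, hh⟩ : C (p : ℤ) ∣ (X - 1 : ℤ[X]) ^ (p - 1) - ∑ i ∈ Finset.range p, X ^ i := by
    rw [C_dvd_iff_dvd_coeff]
    intro i
    have := congrArg (fun q : (ZMod p)[X] ↦ q.coeff i) key
    simp only [coeff_map, coeff_zero, eq_intCast] at this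
    exact (ZMod.intCast_zmod_eq_zero_iff_dvd _ p).1 (by simpa using this)
  exact ⟨h, by linear_combination hh⟩

/-- If, up to invariant elements `C`, every element of `E` is of the form `(s - 1) u`, then every
homomorphism to `ℤ` trivial on `C` vanishes on `E`. -/
theorem eq_zero_of_forall_eq_add_sub {A : Type*} [AddCommGroup A] {p : ℕ} [Fact p.Prime]
    (s : AddMonoid.End A) {E C : AddSubgroup A} (f : A →+ ℤ) (hC : ∀ c ∈ C, f c = 0)
    (hsC : ∀ c ∈ C, s c = c) (hsE : ∀ u ∈ E, s u ∈ E)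
    (hnorm : ∀ u ∈ E, ∑ i ∈ Finset.range p, (s ^ i) u ∈ C)
    (hE : ∀ u ∈ E, ∃ c ∈ C, ∃ u' ∈ E, u = c + (s u' - u')) : ∀ u ∈ E, f u = 0 := by
  have hp := (Fact.out : p.Prime)
  obtain ⟨h, hh⟩ := exists_sub_one_pow_eq p
  have hmul : ∀ (g₁ g₂ : AddMonoid.End A) (u : A), (g₁ * g₂) u = g₁ (g₂ u) := fun _ _ _ ↦ rfl
  have hsum : ∀ (t : Finset ℕ) (g : ℕ → AddMonoid.End A) (u : A),
      (∑ i ∈ t, g i) u = ∑ i ∈ t, g i u :=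
    fun t g u ↦ map_sum (AddMonoidHom.eval u : AddMonoid.End A →+ A) g t
  have hpow : ∀ n : ℕ, ∀ u ∈ E, ∃ c ∈ C, ∃ u' ∈ E, u = c + ((s - 1) ^ (n + 1)) u' := by
    intro n
    induction n with
    | zero =>
      intro u hu
      obtain ⟨c, hc, u', hu', h⟩ := hE u hu
      exact ⟨c, hc, u', hu', by rw [h, zero_add, pow_one]; rfl⟩
    | succ n ih =>
      intro u hu
      obtain ⟨c, hc, u', hu', h⟩ := ih u hu
      obtain ⟨c', hc', u'', hu'', h'⟩ := hE u' hu'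
      refine ⟨c, hc, u'', hu'', ?_⟩
      have h0 : ((s - 1) ^ (n + 1)) c' = 0 := by
        rw [pow_succ, hmul]
        have : (s - 1) c' = 0 := by
          change s c' - c' = 0
          rw [hsC c' hc', sub_self]
        rw [this, map_zero]
      rw [h, h', map_add, h0, zero_add, pow_succ _ (n + 1), hmul]
      rfl
  have hpoly : ∀ (q : ℤ[X]), ∀ u ∈ E, (aeval s q) u ∈ E := by
    intro q
    have hs : ∀ (n : ℕ), ∀ u ∈ E, (s ^ n) u ∈ E := by
      intro n
      induction n with
      | zero => exact fun u hu ↦ hu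
      | succ n ih =>
        intro u hu
        rw [pow_succ, hmul]
        exact ih _ (hsE u hu)
    intro u hu
    rw [aeval_eq_sum_range, hsum]
    refine sum_mem fun i _ ↦ ?_
    change (q.coeff i) • ((s ^ i) u) ∈ E
    exact zsmul_mem (hs i u hu) _
  have hstep : ∀ u ∈ E, ∃ u' ∈ E, f u = p * f u' := by
    intro u hu
    obtain ⟨c, hc, u', hu', h1⟩ := hpow (p - 2) u hu
    have h2 : (s - 1) ^ (p - 2 + 1) = ∑ i ∈ Finset.range p, s ^ i + (p : ℤ) • aeval s h := by
      have := congrArg (aeval s) hh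
      rw [show p - 2 + 1 = p - 1 by have := hp.two_le; omega]
      simpa [map_sum, zsmul_eq_mul] using this
    refine ⟨aeval s h u', hpoly h u' hu', ?_⟩
    rw [h1, map_add, hC c hc, zero_add, h2]
    have h3 : (∑ i ∈ Finset.range p, s ^ i + (p : ℤ) • aeval s h) u' =
        ∑ i ∈ Finset.range p, (s ^ i) u' + (p : ℤ) • (aeval s h u') := by
      rw [← hsum]
      rfl
    rw [h3, map_add, hC _ (hnorm u' hu'), zero_add, map_zsmul, smul_eq_mul]
  have hdvd : ∀ n : ℕ, ∀ u ∈ E, (p : ℤ) ^ n ∣ f u := by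
    intro n
    induction n with
    | zero => intro u _; simp
    | succ n ih =>
      intro u hu
      obtain ⟨u', hu', h⟩ := hstep u hu
      rw [h, pow_succ']
      exact mul_dvd_mul_left _ (ih u' hu')
  intro u hu
  by_contra h0
  obtain ⟨n, hn⟩ := (Int.finiteMultiplicity_iff.2 ⟨by simpa using hp.one_lt.ne', h0⟩ :
    FiniteMultiplicity (p : ℤ) (f u))
  exact hn (hdvd _ u hu)

end UnitDescent

section RealRelation

open Polynomial FractionalIdeal

section Valuation

variable {F K : Type*} [Field F] [Field K] [Algebra F[X] K]
  {v : Valuation K (WithZero (Multiplicative ℤ))}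

theorem valuation_algebraMap_eq_pow_natDegree (hv : ∀ c : F, c ≠ 0 → v (algebraMap F[X] K (C c)) = 1)
    (hX : 1 < v (algebraMap F[X] K X)) {g : F[X]} (hg : g ≠ 0) :
    v (algebraMap F[X] K g) = v (algebraMap F[X] K X) ^ g.natDegree := by
  let : Algebra F K := ((algebraMap F[X] K).comp C).toAlgebra
  have : v.IsTrivialOn F := ⟨hv⟩
  have : IsScalarTower F F[X] K := IsScalarTower.of_algebraMap_eq fun _ ↦ rfl
  have h := valuation_aeval_eq_valuation_X_pow_natDegree_of_one_lt_valuation_X _ hX hg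
  rwa [aeval_algebraMap_apply, aeval_X_left_apply] at h

theorem valuation_algebraMap_lt (hv : ∀ c : F, c ≠ 0 → v (algebraMap F[X] K (C c)) = 1)
    (hX : 1 < v (algebraMap F[X] K X)) {g h : F[X]} (hgh : g.degree < h.degree) :
    v (algebraMap F[X] K g) < v (algebraMap F[X] K h) := by
  have hh : h ≠ 0 := by
    rintro rfl
    exact not_lt_bot hgh
  rw [valuation_algebraMap_eq_pow_natDegree hv hX hh]
  by_cases hg : g = 0
  · rw [hg, map_zero, map_zero]
    exact pow_pos (zero_lt_one.trans hX) _
  · rw [valuation_algebraMap_eq_pow_natDegree hv hX hg]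
    exact pow_lt_pow_right₀ hX (natDegree_lt_natDegree hg hgh)

/-- The logarithm of a valuation, as a homomorphism. -/
def logValuation {K : Type*} [Field K] (v : Valuation K (WithZero (Multiplicative ℤ))) :
    Additive Kˣ →+ ℤ :=
  AddMonoidHom.mk' (fun u ↦ WithZero.log (v (u.toMul : Kˣ))) fun a b ↦ by
    rw [toMul_add, Units.val_mul, map_mul]
    exact WithZero.log_mul ((Valuation.ne_zero_iff v).2 a.toMul.ne_zero)
      ((Valuation.ne_zero_iff v).2 b.toMul.ne_zero)

theorem logValuation_ofMul {K : Type*} [Field K] (v : Valuation K (WithZero (Multiplicative ℤ)))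
    (u : Kˣ) : logValuation v (Additive.ofMul u) = WithZero.log (v (u : K)) := rfl

end Valuation

variable {F : Type*} [Field F] {p m : ℕ} (𝒟 : ArtinSchreierData F p m)
  {K : Type*} [Field K] [Algebra (RatFunc F) K] [Algebra F[X] K] [IsScalarTower F[X] (RatFunc F) K]
  [FiniteDimensional (RatFunc F) K]
  {O : Type*} [CommRing O] [IsDedekindDomain O] [Algebra F[X] O] [Algebra O K]
  [IsScalarTower F[X] O K] [IsFractionRing O K] [IsIntegralClosure O F[X] K]
  [Fact p.Prime]

namespace ArtinSchreierData

theorem valuation_D_lt_one {v : Valuation K (WithZero (Multiplicative ℤ))}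
    (hv : ∀ c : F, c ≠ 0 → v (algebraMap F[X] K (C c)) = 1) (hX : 1 < v (algebraMap F[X] K X))
    (hf : 𝒟.f = 0) : v (algebraMap (RatFunc F) K 𝒟.D) < 1 := by
  rw [D, hf, map_zero, add_zero, map_sum]
  refine Valuation.map_sum_lt v one_ne_zero fun i _ ↦ ?_
  have h := valuation_algebraMap_lt hv hX (𝒟.degree_lt i)
  rw [polar, map_div₀, map_div₀, ← IsScalarTower.algebraMap_apply, ← IsScalarTower.algebraMap_apply]
  exact (div_lt_one₀ (lt_of_le_of_lt zero_le h)).2 h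

theorem one_le_valuation_apply [CharP F p] [CharP K p] {σ : K ≃ₐ[RatFunc F] K} {α : K}
    (hα : α ^ p - α = algebraMap (RatFunc F) K 𝒟.D) {n : ℕ} (hn : ¬ p ∣ n) (hσα : σ α = α + n)
    (hf : 𝒟.f = 0) {v : Valuation K (WithZero (Multiplicative ℤ))}
    (hv : ∀ c : F, c ≠ 0 → v (algebraMap F[X] K (C c)) = 1) (hX : 1 < v (algebraMap F[X] K X)) :
    ¬ ∀ z, v z < 1 → v (σ z) < 1 := by
  intro hσ
  have h1 := 𝒟.valuation_D_lt_one (K := K) hv hX hf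
  rw [← hα, ← prod_range_add_mul_natCast α hn, map_prod] at h1
  obtain ⟨i, hi, h2⟩ : ∃ i ∈ Finset.range p, v (α + i * n) < 1 := by
    by_contra! H
    exact absurd h1 (not_lt.2 (Finset.one_le_prod' H))
  have h3 := hσ _ h2
  have h4 : v (n : K) = 1 := by
    have := hv (n : F) fun h ↦ hn ((CharP.cast_eq_zero_iff F p n).1 h)
    rwa [C_eq_natCast, map_natCast] at this
  have h5 : (n : K) = σ (α + i * n) - (α + i * n) := by
    rw [map_add, hσα, map_mul, map_natCast, map_natCast]
    ring
  rw [h5] at h4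
  exact (v.map_sub_lt h3 h2).ne h4

theorem nonempty_of_apply_eq [CharP K p] {σ : K ≃ₐ[RatFunc F] K} {α : K}
    (hα : α ^ p - α = algebraMap (RatFunc F) K 𝒟.D) {n : ℕ} (hn : ¬ p ∣ n) (hσα : σ α = α + n)
    (hf : 𝒟.f = 0) : Nonempty (Fin m) := by
  by_contra h
  rw [not_nonempty_iff] at h
  rw [D, hf, map_zero, Finset.univ_eq_empty, Finset.sum_empty, add_zero, map_zero,
    ← prod_range_add_mul_natCast α hn, Finset.prod_eq_zero_iff] at hα
  obtain ⟨i, -, hi⟩ := hα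
  have h1 := congrArg σ hi
  rw [map_add, hσα, map_mul, map_natCast, map_natCast, map_zero] at h1
  exact hn ((CharP.cast_eq_zero_iff K p n).1 (by linear_combination h1 - hi))

/-- If the class group relations between the ramified primes are trivial, then every unit has
trivial valuation. -/
theorem valuation_unit_eq_one [Fintype F] [CharP F p] [CharP O p] [IsGalois (RatFunc F) K]
    {σ : K ≃ₐ[RatFunc F] K} (hσ : ∀ τ : K ≃ₐ[RatFunc F] K, τ ∈ Subgroup.zpowers σ)
    (hdeg : Module.finrank (RatFunc F) K = p)
    {α : K} (hα : α ^ p - α = algebraMap (RatFunc F) K 𝒟.D) {n : ℕ} (hn : ¬ p ∣ n)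
    (hσα : σ α = α + n) {s : (FractionalIdeal O⁰ K)ˣ ≃* (FractionalIdeal O⁰ K)ˣ}
    (hs : IsInducedBy σ s) {𝔓 : Fin m → (FractionalIdeal O⁰ K)ˣ}
    (h𝔓 : ∀ i, 𝔓 i ^ p = baseIdeal (RatFunc F) O K (𝒟.P i).unit)
    [Module.Finite F[X] O] [Module.IsTorsionFree F[X] O]
    (hrel : ∀ (a : Fin m → ℤ) (x : Kˣ), ∏ i, 𝔓 i ^ a i = toPrincipalIdeal O K x →
      ∀ i, (p : ℤ) ∣ a i)
    {v : Valuation K (WithZero (Multiplicative ℤ))}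
    (hv : ∀ c : F, c ≠ 0 → v (algebraMap F[X] K (C c)) = 1)
    {u : Kˣ} (hu : toPrincipalIdeal O K u = 1) : v u = 1 := by
  have hsp := hs.apply_toPrincipalIdeal F[X]
  let S : AddMonoid.End (Additive Kˣ) := (Units.map (σ : K →* K)).toAdditive
  let E : AddSubgroup (Additive Kˣ) := (toPrincipalIdeal O K).ker.toAddSubgroup
  let C₀ : AddSubgroup (Additive Kˣ) :=
    ((baseIdeal (RatFunc F) O K).ker.map
      (Units.map (algebraMap (RatFunc F) K : RatFunc F →* K))).toAddSubgroup
  have hS : ∀ (i : ℕ) (x : Kˣ), (((S ^ i) (Additive.ofMul x)).toMul : K) = (σ ^ i) (x : K) := by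
    intro i
    induction i with
    | zero => exact fun x ↦ rfl
    | succ i ih =>
      intro x
      rw [pow_succ, pow_succ, AlgEquiv.mul_apply]
      exact ih (Units.map (σ : K →* K) x)
  have key := eq_zero_of_forall_eq_add_sub (p := p) S (E := E) (C := C₀) (logValuation v)
    ?_ ?_ ?_ ?_ ?_ (Additive.ofMul u) hu
  · rw [logValuation_ofMul] at key
    rw [← WithZero.exp_log ((Valuation.ne_zero_iff v).2 u.ne_zero), key, WithZero.exp_zero]
  · rintro _ ⟨b, hb, rfl⟩
    obtain ⟨c, hc, hcb⟩ := exists_const_of_baseIdeal_eq_one hb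
    change WithZero.log (v (algebraMap (RatFunc F) K (b : RatFunc F))) = 0
    rw [hcb, ← IsScalarTower.algebraMap_apply, hv c hc, WithZero.log_one]
  · rintro _ ⟨b, hb, rfl⟩
    refine congrArg Additive.ofMul (Units.ext ?_)
    exact σ.commutes _
  · intro x hx
    change toPrincipalIdeal O K (Units.map (σ : K →* K) x.toMul) = 1
    rw [← hsp, show toPrincipalIdeal O K x.toMul = 1 from hx, map_one]
  · intro x hx
    have h1 : (∑ i ∈ Finset.range p, (S ^ i) x).toMul =
        Units.map (algebraMap (RatFunc F) K : RatFunc F →* K)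
          (Units.map (Algebra.norm (RatFunc F)) x.toMul) := by
      apply Units.ext
      rw [toMul_sum, Units.coe_prod, ← hdeg]
      exact (Finset.prod_congr rfl fun i _ ↦ hS i x.toMul).trans (prod_range_pow_eq_norm hσ _)
    refine ⟨_, ?_, h1.symm⟩
    have h2 := hs.orbitProd_principal hσ F[X] x.toMul
    rw [show toPrincipalIdeal O K x.toMul = 1 from hx, map_one] at h2
    exact h2.symm
  · intro x hx
    have h2 := hs.orbitProd_principal hσ F[X] x.toMul
    rw [show toPrincipalIdeal O K x.toMul = 1 from hx, map_one] at h2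
    obtain ⟨w, y, hw, -, hwy⟩ := exists_eq_const_mul_of_baseIdeal_norm hσ hdeg (x := x.toMul)
      h2.symm
    have h3 : s (toPrincipalIdeal O K y) = toPrincipalIdeal O K y := by
      have h4 := congrArg (toPrincipalIdeal O K) hwy
      rw [show toPrincipalIdeal O K x.toMul = 1 from hx, map_mul,
        show toPrincipalIdeal O K (Units.map _ w) = 1 from hw, one_mul, map_mul, map_inv] at h4
      rw [hsp]
      exact (mul_inv_eq_one.1 h4.symm)
    obtain ⟨c, a, hca⟩ := 𝒟.exists_eq_baseIdeal_mul_prod_of_apply_eq hσ hdeg hα hn hσα hs h𝔓 h3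
    have h5 := hrel a ((Units.map (algebraMap (RatFunc F) K : RatFunc F →* K) c)⁻¹ * y) (by
      rw [map_mul, hca, map_inv]
      exact (inv_mul_cancel_left _ _).symm)
    choose a' ha' using h5
    let d : (RatFunc F)ˣ := c * ∏ i, (𝒟.P i).unit ^ a' i
    have hd : toPrincipalIdeal O K y = baseIdeal (RatFunc F) O K d := by
      rw [hca, map_mul, map_prod]
      congr 1
      refine Finset.prod_congr rfl fun i _ ↦ ?_
      rw [ha', zpow_mul, zpow_natCast, h𝔓, map_zpow]
    let z : Kˣ := (Units.map (algebraMap (RatFunc F) K : RatFunc F →* K) d)⁻¹ * y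
    refine ⟨Additive.ofMul (Units.map (algebraMap (RatFunc F) K : RatFunc F →* K) w), ⟨w, hw, rfl⟩,
      Additive.ofMul z, ?_, ?_⟩
    · change toPrincipalIdeal O K z = 1
      rw [map_mul, map_inv, hd]
      exact inv_mul_cancel _
    · refine congrArg Additive.ofMul (hwy.trans ?_)
      change _ = Units.map _ w * (Units.map (σ : K →* K) z / z)
      have h6 : Units.map (σ : K →* K) (Units.map (algebraMap (RatFunc F) K : RatFunc F →* K) d) =
          Units.map (algebraMap (RatFunc F) K : RatFunc F →* K) d := Units.ext (σ.commutes _)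
      rw [map_mul, map_inv, h6, mul_div_mul_left_eq_div, div_eq_mul_inv]

/-- In the real case there is a nontrivial relation between the classes of the ramified primes. -/
theorem exists_relation [Fintype F] [CharP F p] [CharP O p] [CharP K p] [IsGalois (RatFunc F) K]
    {σ : K ≃ₐ[RatFunc F] K} (hσ : ∀ τ : K ≃ₐ[RatFunc F] K, τ ∈ Subgroup.zpowers σ)
    (hdeg : Module.finrank (RatFunc F) K = p)
    {α : K} (hα : α ^ p - α = algebraMap (RatFunc F) K 𝒟.D) {n : ℕ} (hn : ¬ p ∣ n)
    (hσα : σ α = α + n) {s : (FractionalIdeal O⁰ K)ˣ ≃* (FractionalIdeal O⁰ K)ˣ}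
    (hs : IsInducedBy σ s) {𝔓 : Fin m → (FractionalIdeal O⁰ K)ˣ}
    (h𝔓 : ∀ i, 𝔓 i ^ p = baseIdeal (RatFunc F) O K (𝒟.P i).unit)
    [Module.Finite F[X] O] [Module.IsTorsionFree F[X] O] (hf : 𝒟.f = 0) :
    ∃ (a : Fin m → ℤ) (x : Kˣ), ∏ i, 𝔓 i ^ a i = toPrincipalIdeal O K x ∧ ∃ i, ¬ (p : ℤ) ∣ a i := by
  by_contra! hrel
  obtain ⟨i₀⟩ := 𝒟.nonempty_of_apply_eq hα hn hσα hf
  obtain ⟨v, y, N, hv, hX, hy1, hy0, hN, hN', hvσ⟩ :=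
    exists_valuation_of_finitePlace (K := K) (𝒟.P i₀)
  have hσy : ¬ v (σ y) < 1 := fun h ↦ 𝒟.one_le_valuation_apply hα hn hσα hf hv hX (hvσ σ h)
  obtain ⟨w, hw, hwJ⟩ := hs.exists_prime_coe_eq hσ hdeg (Fact.out : p.Prime).ne_zero (h𝔓 i₀)
  obtain ⟨r, b, hrb⟩ := exists_principal_eq_zpow_mul (y := Units.mk0 y hy0) (h𝔓 i₀) hw hwJ hN hN'
  classical
  obtain ⟨r', hr'⟩ := hrel (Pi.single i₀ r)
    (Units.mk0 y hy0 * (Units.map (algebraMap (RatFunc F) K : RatFunc F →* K) b)⁻¹) (by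
      rw [map_mul, map_inv, hrb, Finset.prod_eq_single i₀ (fun j _ hj ↦ by
        rw [Pi.single_eq_of_ne hj, zpow_zero]) (by simp), Pi.single_eq_same]
      exact (mul_inv_cancel_right _ _).symm) i₀
  rw [Pi.single_eq_same] at hr'
  let d : (RatFunc F)ˣ := (𝒟.P i₀).unit ^ r' * b
  have hu : toPrincipalIdeal O K
      ((Units.map (algebraMap (RatFunc F) K : RatFunc F →* K) d)⁻¹ * Units.mk0 y hy0) = 1 := by
    rw [map_mul, map_inv, hrb, hr', zpow_mul, zpow_natCast, h𝔓, ← map_zpow, ← map_mul]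
    exact inv_mul_cancel _
  have hσu : toPrincipalIdeal O K (Units.map (σ : K →* K)
      ((Units.map (algebraMap (RatFunc F) K : RatFunc F →* K) d)⁻¹ * Units.mk0 y hy0)) = 1 := by
    rw [← hs.apply_toPrincipalIdeal F[X], hu, map_one]
  have h1 := 𝒟.valuation_unit_eq_one hσ hdeg hα hn hσα hs h𝔓 hrel hv hu
  have h2 := 𝒟.valuation_unit_eq_one hσ hdeg hα hn hσα hs h𝔓 hrel hv hσu
  have h3 : (((Units.map (algebraMap (RatFunc F) K : RatFunc F →* K) d)⁻¹ * Units.mk0 y hy0 : Kˣ) :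
      K) = (algebraMap (RatFunc F) K d)⁻¹ * y := by
    rw [Units.val_mul, Units.val_inv_eq_inv_val]
    rfl
  have h4 : ((Units.map (σ : K →* K) ((Units.map (algebraMap (RatFunc F) K : RatFunc F →* K) d)⁻¹ *
      Units.mk0 y hy0) : Kˣ) : K) = (algebraMap (RatFunc F) K d)⁻¹ * σ y := by
    change σ _ = _
    rw [h3, _root_.map_mul, map_inv₀, σ.commutes]
  rw [h3, _root_.map_mul] at h1
  rw [h4, _root_.map_mul, ← h1] at h2
  have hd : v (algebraMap (RatFunc F) K d)⁻¹ ≠ 0 := left_ne_zero_of_mul_eq_one h1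
  exact hσy (mul_left_cancel₀ hd h2 ▸ hy1)

end ArtinSchreierData

end RealRelation

section ElementaryAbelian

variable {G : Type*} [CommGroup G] {p m : ℕ} [Fact p.Prime]

/-- The homomorphism from an elementary abelian group given by elements killed by `p`. -/
def elementaryHom (g : Fin m → G) (hg : ∀ i, g i ^ p = 1) :
    Multiplicative (Fin m → ZMod p) →* G :=
  MonoidHom.mk' (fun a ↦ ∏ i, g i ^ (a.toAdd i).val) fun a b ↦ by
    rw [← Finset.prod_mul_distrib]
    refine Finset.prod_congr rfl fun i _ ↦ ?_
    rw [toAdd_mul, Pi.add_apply, ZMod.val_add, ← pow_eq_pow_mod _ (hg i), pow_add]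

theorem elementaryHom_intCast {g : Fin m → G} (hg : ∀ i, g i ^ p = 1) (a : Fin m → ℤ) :
    elementaryHom g hg (Multiplicative.ofAdd fun i ↦ (a i : ZMod p)) = ∏ i, g i ^ a i := by
  change ∏ i, g i ^ (ZMod.val (a i : ZMod p)) = _
  refine Finset.prod_congr rfl fun i _ ↦ ?_
  rw [← zpow_natCast, ZMod.val_intCast, ← zpow_eq_zpow_emod' _ (hg i)]

theorem natCard_multiplicative_fun (p m : ℕ) [Fact p.Prime] :
    Nat.card (Multiplicative (Fin m → ZMod p)) = p ^ m := by
  rw [Nat.card_congr Multiplicative.toAdd, Nat.card_fun, Nat.card_zmod, Nat.card_fin]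

theorem card_le_pow_of_generated {g : Fin m → G} (hg : ∀ i, g i ^ p = 1) {H : Subgroup G}
    (hH : ∀ x ∈ H, ∃ a : Fin m → ℤ, x = ∏ i, g i ^ a i) : Nat.card H ≤ p ^ m := by
  rw [← natCard_multiplicative_fun p m]
  have : Finite (elementaryHom g hg).range :=
    Finite.of_surjective _ (elementaryHom g hg).rangeRestrict_surjective
  refine (Subgroup.card_le_of_le (K := (elementaryHom g hg).range) fun x hx ↦ ?_).trans
    (Nat.card_le_card_of_surjective _ (elementaryHom g hg).rangeRestrict_surjective)
  obtain ⟨a, rfl⟩ := hH x hx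
  exact ⟨_, elementaryHom_intCast hg a⟩

theorem card_le_pow_sub_one_of_relation {g : Fin m → G} (hg : ∀ i, g i ^ p = 1) {H : Subgroup G}
    (hH : ∀ x ∈ H, ∃ a : Fin m → ℤ, x = ∏ i, g i ^ a i) {c : Fin m → ℤ}
    (hc : ∏ i, g i ^ c i = 1) {i : Fin m} (hi : ¬ (p : ℤ) ∣ c i) : Nat.card H ≤ p ^ (m - 1) := by
  have hp := (Fact.out : p.Prime)
  let Φ := elementaryHom g hg
  have h1 : Nat.card Φ.ker * Nat.card Φ.range = p ^ m := by
    rw [← Subgroup.index_ker, Subgroup.card_mul_index, natCard_multiplicative_fun]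
  have h2 : p ≤ Nat.card Φ.ker := by
    have h3 : Nat.card Φ.ker ≠ 1 := by
      rw [Ne, Subgroup.card_eq_one]
      intro h
      have h4 : Multiplicative.ofAdd (fun i ↦ (c i : ZMod p)) ∈ Φ.ker :=
        (elementaryHom_intCast hg c).trans hc
      rw [h, Subgroup.mem_bot] at h4
      exact hi ((ZMod.intCast_zmod_eq_zero_iff_dvd _ p).1 (congrFun
        (congrArg Multiplicative.toAdd h4) i))
    obtain ⟨r, -, hr⟩ := (Nat.dvd_prime_pow hp).1 (Dvd.intro _ h1)
    rw [hr] at h3 ⊢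
    exact Nat.le_self_pow (fun h ↦ h3 (by rw [h, pow_zero])) p
  have : Finite Φ.range := Finite.of_surjective _ Φ.rangeRestrict_surjective
  have hle : H ≤ Φ.range := fun x hx ↦ by
    obtain ⟨a, rfl⟩ := hH x hx
    exact ⟨_, elementaryHom_intCast hg a⟩
  refine (Subgroup.card_le_of_le hle).trans (Nat.le_of_mul_le_mul_left ?_ hp.pos)
  have hm : m ≠ 0 := fun h ↦ (h ▸ i).elim0
  rw [← pow_succ', Nat.sub_add_cancel (Nat.one_le_iff_ne_zero.2 hm), ← h1]
  exact Nat.mul_le_mul_right _ h2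

/-- A subgroup of an elementary abelian group whose annihilator is trivial is everything. -/
theorem pow_le_card_of_annihilator {W : Subgroup (Multiplicative (Fin m → ZMod p))} (d : ℕ)
    (v : Fin d → Fin m → ZMod p)
    (hW : ∀ c : Fin m → ZMod p, (∀ w ∈ W, ∑ j, c j * w.toAdd j = 0) →
      c ∈ Submodule.span (ZMod p) (Set.range v)) : p ^ (m - d) ≤ Nat.card W := by
  let S : Submodule (ZMod p) (Fin m → ZMod p) :=
    AddSubgroup.toZModSubmodule p (Subgroup.toAddSubgroup' W)
  have hS : Nat.card S = Nat.card W := Nat.card_congr (Equiv.refl _)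
  rw [← hS, Module.natCard_eq_pow_finrank (K := ZMod p), Nat.card_zmod]
  refine Nat.pow_le_pow_right (Fact.out : p.Prime).pos ?_
  have h1 := Subspace.finrank_add_finrank_dualAnnihilator_eq S
  have h2 : S.dualAnnihilator ≤
      (Submodule.span (ZMod p) (Set.range v)).map (dotProductEquiv (ZMod p) (Fin m)).toLinearMap := by
    intro φ hφ
    obtain ⟨c, rfl⟩ := (dotProductEquiv (ZMod p) (Fin m)).surjective φ
    refine ⟨c, hW c fun w hw ↦ ?_, rfl⟩
    exact (Submodule.mem_dualAnnihilator _).1 hφ w.toAdd hw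
  have h3 := (Submodule.finrank_mono h2).trans ((Submodule.finrank_map_le _ _).trans
    (finrank_range_le_card v))
  rw [Module.finrank_fin_fun] at h1
  rw [Fintype.card_fin] at h3
  omega

end ElementaryAbelian

section ClassSymbol

open Polynomial FractionalIdeal

variable {F : Type*} [Field F] {p m : ℕ} [Fact p.Prime] [Algebra (ZMod p) F]
  (𝒟 : ArtinSchreierData F p m)
  {K : Type*} [Field K] [Algebra (RatFunc F) K] [Algebra F[X] K] [IsScalarTower F[X] (RatFunc F) K]
  [FiniteDimensional (RatFunc F) K]
  {O : Type*} [CommRing O] [IsDedekindDomain O] [Algebra F[X] O] [Algebra O K]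
  [IsScalarTower F[X] O K] [IsFractionRing O K] [IsIntegralClosure O F[X] K]

namespace ArtinSchreierData

theorem symbol_eq_of_baseIdeal_eq [Fintype F] {b b' : (RatFunc F)ˣ}
    (h : baseIdeal (RatFunc F) O K b = baseIdeal (RatFunc F) O K b') (j : Fin m) :
    𝒟.symbol j (b : RatFunc F) = 𝒟.symbol j (b' : RatFunc F) := by
  have h1 : baseIdeal (RatFunc F) O K (b * b'⁻¹) = 1 := by
    rw [_root_.map_mul, map_inv, h, mul_inv_cancel]
  obtain ⟨c, -, hc⟩ := exists_const_of_baseIdeal_eq_one h1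
  have h2 : (b : RatFunc F) = algebraMap F[X] (RatFunc F) (C c) * b' := by
    rw [← hc, Units.val_mul, mul_assoc, Units.inv_mul, mul_one]
  rw [h2, 𝒟.symbol_mul j (hc ▸ Units.ne_zero _) b'.ne_zero, 𝒟.symbol_C, zero_add]

/-- The local symbols of the norm of an ideal only depend on its ideal class. -/
theorem exists_classSymbol [Fintype F] [CharP F p] [IsGalois (RatFunc F) K] [Algebra F K]
    [IsScalarTower F (RatFunc F) K] {σ : K ≃ₐ[RatFunc F] K}
    (hσ : ∀ τ : K ≃ₐ[RatFunc F] K, τ ∈ Subgroup.zpowers σ)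
    (hdeg : Module.finrank (RatFunc F) K = p)
    {α : K} (hα : α ^ p - α = algebraMap (RatFunc F) K 𝒟.D)
    (hadj : Algebra.adjoin (RatFunc F) {α} = ⊤)
    {s : (FractionalIdeal O⁰ K)ˣ ≃* (FractionalIdeal O⁰ K)ˣ}
    (hs : IsInducedBy σ s) [Module.Finite F[X] O] [Module.IsTorsionFree F[X] O]
    {G : Type*} [CommGroup G] {π : (FractionalIdeal O⁰ K)ˣ →* G} (hπ : Function.Surjective π)
    (hπk : π.ker = (toPrincipalIdeal O K).range) :
    ∃ χ : G →* Multiplicative (Fin m → ZMod p), ∀ (J : (FractionalIdeal O⁰ K)ˣ) (b : (RatFunc F)ˣ),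
      orbitProd s p J = baseIdeal (RatFunc F) O K b →
        χ (π J) = Multiplicative.ofAdd fun j ↦ 𝒟.symbol j (b : RatFunc F) := by
  have hex : ∀ J, ∃ b, orbitProd s p J = baseIdeal (RatFunc F) O K b := by
    intro J
    obtain ⟨b, hb⟩ := exists_orbitProd_eq (A := F[X]) hσ hs J
    rw [hdeg] at hb
    exact ⟨b, hb⟩
  choose b hb using hex
  let Ψ : (FractionalIdeal O⁰ K)ˣ →* Multiplicative (Fin m → ZMod p) :=
    MonoidHom.mk' (fun J ↦ Multiplicative.ofAdd fun j ↦ 𝒟.symbol j (b J : RatFunc F)) fun J J' ↦ by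
      rw [← ofAdd_add]
      refine congrArg _ (funext fun j ↦ ?_)
      rw [Pi.add_apply, ← 𝒟.symbol_mul j (b J).ne_zero (b J').ne_zero, ← Units.val_mul]
      exact 𝒟.symbol_eq_of_baseIdeal_eq (O := O) (K := K)
        ((hb _).symm.trans (((orbitProd s p).map_mul J J').trans
          ((congrArg₂ _ (hb J) (hb J')).trans ((baseIdeal (RatFunc F) O K).map_mul _ _).symm))) j
  have hΨ : ∀ J b', orbitProd s p J = baseIdeal (RatFunc F) O K b' →
      Ψ J = Multiplicative.ofAdd fun j ↦ 𝒟.symbol j (b' : RatFunc F) := by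
    intro J b' h
    have h1 : ∀ j, 𝒟.symbol j (b J : RatFunc F) = 𝒟.symbol j (b' : RatFunc F) :=
      𝒟.symbol_eq_of_baseIdeal_eq (O := O) (K := K) ((hb J).symm.trans h)
    exact congrArg Multiplicative.ofAdd (funext h1)
  have hker : π.ker ≤ Ψ.ker := ?_
  · refine ⟨π.liftOfSurjective hπ ⟨Ψ, hker⟩, fun J b' h ↦ ?_⟩
    exact (π.liftOfRightInverse_comp_apply _ (Function.rightInverse_surjInv hπ) ⟨Ψ, hker⟩ J).trans (hΨ J b' h)
  rw [hπk]
  rintro _ ⟨x, rfl⟩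
  have h1 := hs.orbitProd_principal hσ F[X] x
  rw [hdeg] at h1
  have h2 : ∀ j, 𝒟.symbol j (Algebra.norm (RatFunc F) (x : K)) = 0 :=
    fun j ↦ 𝒟.symbol_norm hα hadj j x.ne_zero
  exact (hΨ _ (Units.map (Algebra.norm (RatFunc F)) x) h1).trans
    (congrArg Multiplicative.ofAdd (funext h2))

theorem pow_le_card_range [Fintype F] [CharP F p] [CharP O p] [CharP K p]
    (hf : 𝒟.f = 0 ∨ (∃ c : F, c ≠ 0 ∧ 𝒟.f = C c ∧ ¬ ∃ x : F, x ^ p - x = c) ∨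
      ((¬ ∃ c : F, 𝒟.f = C c) ∧ ¬ p ∣ 𝒟.f.natDegree))
    {σ : K ≃ₐ[RatFunc F] K}
    {α : K} (hα : α ^ p - α = algebraMap (RatFunc F) K 𝒟.D) {n : ℕ} (hn : ¬ p ∣ n)
    (hσα : σ α = α + n) {s : (FractionalIdeal O⁰ K)ˣ ≃* (FractionalIdeal O⁰ K)ˣ}
    (hs : IsInducedBy σ s)
    {G : Type*} [CommGroup G] {π : (FractionalIdeal O⁰ K)ˣ →* G}
    {χ : G →* Multiplicative (Fin m → ZMod p)}
    (hχ : ∀ (J : (FractionalIdeal O⁰ K)ˣ) (b : (RatFunc F)ˣ),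
      orbitProd s p J = baseIdeal (RatFunc F) O K b →
        χ (π J) = Multiplicative.ofAdd fun j ↦ 𝒟.symbol j (b : RatFunc F)) :
    (𝒟.f ≠ 0 → p ^ m ≤ Nat.card χ.range) ∧ (𝒟.f = 0 → p ^ (m - 1) ≤ Nat.card χ.range) := by
  have key : ∀ c : Fin m → ZMod p, (∀ w ∈ χ.range, ∑ j, c j * w.toAdd j = 0) →
      (𝒟.f ≠ 0 → c = 0) ∧ (𝒟.f = 0 → ∀ i j, c i = c j) := by
    intro c hc
    refine 𝒟.eq_of_symbol_relation hf fun Q hQ h ↦ ?_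
    obtain ⟨J, hJ⟩ := 𝒟.exists_orbitProd_eq_place (O := O) (b := Q.unit) hα hn hσα hs hQ h rfl
    have h1 := hc _ ⟨π J, rfl⟩
    rw [hχ J Q.unit hJ] at h1
    exact h1
  constructor
  · intro h0
    exact pow_le_card_of_annihilator 0 Fin.elim0 fun c hc ↦ (key c hc).1 h0 ▸ zero_mem _
  · intro h0
    refine pow_le_card_of_annihilator 1 (fun _ _ ↦ 1) fun c hc ↦ ?_
    rcases isEmpty_or_nonempty (Fin m) with h | ⟨⟨i⟩⟩
    · rw [Subsingleton.elim c 0]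
      exact zero_mem _
    · have h1 : c = c i • (fun _ ↦ 1 : Fin m → ZMod p) :=
        funext fun j ↦ by rw [Pi.smul_apply, smul_eq_mul, mul_one, (key c hc).2 h0 j i]
      rw [h1]
      exact Submodule.smul_mem _ _ (Submodule.subset_span ⟨0, rfl⟩)

/-- The Rédei–Reichardt formula. -/
theorem card_quotient_eq [Fintype F] [CharP F p] [CharP O p] [CharP K p]
    (hf : 𝒟.f = 0 ∨ (∃ c : F, c ≠ 0 ∧ 𝒟.f = C c ∧ ¬ ∃ x : F, x ^ p - x = c) ∨
      ((¬ ∃ c : F, 𝒟.f = C c) ∧ ¬ p ∣ 𝒟.f.natDegree))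
    [IsGalois (RatFunc F) K] [Algebra F K] [IsScalarTower F (RatFunc F) K]
    {σ : K ≃ₐ[RatFunc F] K} (hσ : ∀ τ : K ≃ₐ[RatFunc F] K, τ ∈ Subgroup.zpowers σ)
    (hdeg : Module.finrank (RatFunc F) K = p)
    {α : K} (hα : α ^ p - α = algebraMap (RatFunc F) K 𝒟.D)
    (hadj : Algebra.adjoin (RatFunc F) {α} = ⊤)
    {s : (FractionalIdeal O⁰ K)ˣ ≃* (FractionalIdeal O⁰ K)ˣ}
    (hs : IsInducedBy σ s) [Module.Finite F[X] O] [Module.IsTorsionFree F[X] O]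
    {G : Type*} [CommGroup G] [Finite G] {π : (FractionalIdeal O⁰ K)ˣ →* G}
    (hπ : Function.Surjective π) (hπk : π.ker = (toPrincipalIdeal O K).range)
    {δ : G →* G} (hδ : ∀ J : (FractionalIdeal O⁰ K)ˣ, δ (π J) = π (s J * J⁻¹))
    {R : Matrix (Fin m) (Fin m) (ZMod p)}
    (hR : ∀ i j, R i j = 𝒟.symbol j (algebraMap F[X] (RatFunc F) (𝒟.P i).1))
    {C₁ : Subgroup G} (hC₁ : C₁ = (CommGroup.primaryComponent G p).map δ) :
    (𝒟.f ≠ 0 → Nat.card (C₁ ⧸ (C₁.map δ).subgroupOf C₁) = p ^ (m - R.rank)) ∧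
      (𝒟.f = 0 → Nat.card (C₁ ⧸ (C₁.map δ).subgroupOf C₁) = p ^ (m - 1 - R.rank)) := by
  have hp := (Fact.out : p.Prime)
  have hσ1 : σ ≠ 1 := by
    rintro rfl
    have h1 := IsGalois.card_aut_eq_finrank (RatFunc F) K
    rw [hdeg, Nat.card_eq_one_iff_unique.2 ⟨⟨fun a b ↦ ?_⟩, ⟨1⟩⟩] at h1
    · exact hp.one_lt.ne h1
    · have ha := hσ a
      have hb := hσ b
      rw [Subgroup.zpowers_one_eq_bot, Subgroup.mem_bot] at ha hb
      rw [ha, hb]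
  obtain ⟨n, hn, hσα⟩ := exists_apply_eq_add_natCast hα hadj hσ1
  choose 𝔓 h𝔓 using 𝒟.exists_pow_eq_place (O := O) hα
  obtain ⟨χ, hχ⟩ := 𝒟.exists_classSymbol (O := O) hσ hdeg hα hadj hs hπ hπk
  have hrange := 𝒟.pow_le_card_range hf hα hn hσα hs hχ
  have hprinc : ∀ y : Kˣ, π (toPrincipalIdeal O K y) = 1 :=
    fun y ↦ π.mem_ker.1 (hπk ▸ ⟨y, rfl⟩)
  let g : Fin m → G := fun i ↦ π (𝔓 i)
  have hs𝔓 : ∀ i, s (𝔓 i) = 𝔓 i := fun i ↦ hs.apply_eq_of_pow_eq hp.ne_zero (h𝔓 i)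
  have hprod : ∀ a : Fin m → ℤ, π (∏ i, 𝔓 i ^ a i) = ∏ i, g i ^ a i := by
    intro a
    rw [map_prod]
    exact Finset.prod_congr rfl fun i _ ↦ map_zpow π _ _
  have hX : ∀ x, χ (δ x) = 1 := by
    intro x
    obtain ⟨J, rfl⟩ := hπ x
    rw [hδ, hχ _ 1 ?_]
    · exact congrArg Multiplicative.ofAdd (funext 𝒟.symbol_one)
    · have h1 := hs.iterate_finrank hσ J
      rw [hdeg] at h1
      rw [_root_.map_mul, map_inv, orbitProd_map h1, mul_inv_cancel, map_one]
  have hg : ∀ i, g i ∈ δ.ker := by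
    intro i
    rw [MonoidHom.mem_ker, hδ, hs𝔓, mul_inv_cancel, map_one]
  have hgp : ∀ i, g i ^ p = 1 := by
    intro i
    refine (map_pow π (𝔓 i) p).symm.trans (π.mem_ker.1 ?_)
    rw [h𝔓, hπk]
    exact ⟨_, rfl⟩
  have hker : ∀ x ∈ δ.ker, ∃ a : Fin m → ℤ, x = ∏ i, g i ^ a i := by
    intro x hx
    obtain ⟨J, rfl⟩ := hπ x
    rw [MonoidHom.mem_ker, hδ, ← MonoidHom.mem_ker, hπk] at hx
    obtain ⟨x, hx⟩ := hx
    obtain ⟨y, a, h⟩ := 𝒟.exists_eq_principal_mul_prod hσ hdeg hα hn hσα hs h𝔓 (J := J) (x := x)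
      (by rw [hx, mul_comm, inv_mul_cancel_right])
    refine ⟨a, ?_⟩
    rw [← hprod, h, _root_.map_mul, hprinc, one_mul]
  have hR' : ∀ i, χ (g i) = Multiplicative.ofAdd (R i) := by
    intro i
    rw [hχ (𝔓 i) (𝒟.P i).unit (by rw [orbitProd_of_eq (hs𝔓 i), h𝔓])]
    exact congrArg Multiplicative.ofAdd (funext fun j ↦ (hR i j).symm)
  have key : ∀ M, Nat.card δ.ker ≤ p ^ M → p ^ M ≤ Nat.card χ.range →
      Nat.card (C₁ ⧸ (C₁.map δ).subgroupOf C₁) = p ^ (M - R.rank) := fun M h1 h2 ↦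
    card_quotient_eq_pow (δ := δ) (X := χ) (g := g) (R := R) (M := M) (C := C₁)
      hX hg hgp hker hR' h1 h2 hC₁
  refine ⟨fun h0 ↦ key m (card_le_pow_of_generated hgp hker) (hrange.1 h0),
    fun h0 ↦ key (m - 1) ?_ (hrange.2 h0)⟩
  obtain ⟨a, x, hax, i, hi⟩ := 𝒟.exists_relation hσ hdeg hα hn hσα hs h𝔓 h0
  refine card_le_pow_sub_one_of_relation hgp hker (c := a) ?_ hi
  exact (hprod a).symm.trans ((congrArg _ hax).trans (hprinc x))

end ArtinSchreierData

theorem finite_quotient_range_toPrincipalIdeal (F K O : Type*) [Field F] [Finite F] [Field K]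
    [Algebra (RatFunc F) K] [Algebra F[X] K] [IsScalarTower F[X] (RatFunc F) K]
    [FiniteDimensional (RatFunc F) K] [Algebra.IsSeparable (RatFunc F) K] [CommRing O]
    [IsDedekindDomain O] [Algebra F[X] O] [Algebra O K] [IsScalarTower F[X] O K]
    [IsFractionRing O K] [IsIntegralClosure O F[X] K] :
    Finite ((FractionalIdeal O⁰ K)ˣ ⧸ (toPrincipalIdeal O K).range) := by
  have := Fintype.ofFinite F
  classical
  let := ClassGroup.fintypeOfAdmissibleOfFinite (S := O) (RatFunc F) K
    (Polynomial.cardPowDegreeIsAdmissible (Fq := F))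
  exact Finite.of_equiv (ClassGroup O) (ClassGroup.equiv K).toEquiv

end ClassSymbol

end RedeiReichardt

/-- Rédei–Reichardt formula for Artin-Schreier extensions.  Let `K = k(α)` be a
geometric Artin-Schreier extension of `k = F_q(t)` of degree `p`, with
`α^p - α = D = Σ_i Q_i/P_i^{e_i} + f` normalized, ramified finite primes
`P_1, …, P_m`, and `σ` a generator of `G = Gal(K/k)`.  Let
`R ∈ M_{m×m}(F_p)` be the Rédei matrix: `R i j = {D_j/P_i}` (Hasse symbol) for
`i ≠ j`, the diagonal being determined by `Σ_j R i j + {f/P_i} = 0`.  Then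
`λ₂ = dim_{F_p}((σ-1)Cl(K)_p/(σ-1)²Cl(K)_p)` equals `m - rank R` if `K` is
imaginary (`f ≠ 0`) and `m - 1 - rank R` if `K` is real (`f = 0`); i.e. the
corresponding quotient has cardinality `p^(m - rank R)` resp.
`p^(m - 1 - rank R)`. -/
theorem redei_reichardt_artin_schreier
    (p m : ℕ) (hp : p.Prime) [Fact p.Prime]
    (Fq : Type*) [Field Fq] [Fintype Fq] [CharP Fq p] [Algebra (ZMod p) Fq]
    (K : Type*) [Field K] [Algebra (RatFunc Fq) K]
    [FiniteDimensional (RatFunc Fq) K] [IsGalois (RatFunc Fq) K]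
    (hdeg : Module.finrank (RatFunc Fq) K = p)
    [Algebra Fq K] [IsScalarTower Fq (RatFunc Fq) K]
    [Algebra (Polynomial Fq) K] [IsScalarTower (Polynomial Fq) (RatFunc Fq) K]
    [IsFractionRing (integralClosure (Polynomial Fq) K) K]
    -- normalized Artin-Schreier data
    (P Q : Fin m → Polynomial Fq) (e : Fin m → ℕ) (f : Polynomial Fq)
    (hPmonic : ∀ i, (P i).Monic) (hPirr : ∀ i, Irreducible (P i))
    (hPinj : Function.Injective P)
    (hcop : ∀ i, IsCoprime (P i) (Q i)) (he : ∀ i, ¬ p ∣ e i)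
    (hdegQ : ∀ i, (Q i).degree < ((P i) ^ (e i)).degree)
    (hf : f = 0 ∨ (∃ c : Fq, c ≠ 0 ∧ f = Polynomial.C c ∧ ¬ ∃ x : Fq, x ^ p - x = c) ∨
      ((¬ ∃ c : Fq, f = Polynomial.C c) ∧ ¬ p ∣ f.natDegree))
    (D : RatFunc Fq)
    (hD : D = (∑ i, algebraMap (Polynomial Fq) (RatFunc Fq) (Q i) /
        (algebraMap (Polynomial Fq) (RatFunc Fq) (P i)) ^ (e i)) +
      algebraMap (Polynomial Fq) (RatFunc Fq) f)
    (α : K) (hα : α ^ p - α = algebraMap (RatFunc Fq) K D)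
    (hadj : Algebra.adjoin (RatFunc Fq) {α} = ⊤)
    (hgeo : ∀ x : K, IsAlgebraic Fq x → x ∈ (algebraMap Fq K).range)
    (σ : K ≃ₐ[RatFunc Fq] K) (hσ : ∀ τ : K ≃ₐ[RatFunc Fq] K, τ ∈ Subgroup.zpowers σ)
    -- the action `sigmaAct` of `σ` on the invertible fractional ideals of `O_K`
    (sigmaAct : (FractionalIdeal (integralClosure (Polynomial Fq) K)⁰ K)ˣ ≃*
      (FractionalIdeal (integralClosure (Polynomial Fq) K)⁰ K)ˣ)
    (hsigma : ∀ J : (FractionalIdeal (integralClosure (Polynomial Fq) K)⁰ K)ˣ,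
      ((sigmaAct J : FractionalIdeal (integralClosure (Polynomial Fq) K)⁰ K) : Set K) =
        σ '' ((J : FractionalIdeal (integralClosure (Polynomial Fq) K)⁰ K) : Set K))
    -- `δ = σ - 1` on ideals, and the induced map `δ̄ = σ - 1` on `Cl(K)`
    (δ : (FractionalIdeal (integralClosure (Polynomial Fq) K)⁰ K)ˣ →*
      (FractionalIdeal (integralClosure (Polynomial Fq) K)⁰ K)ˣ)
    (hδ : δ = sigmaAct.toMonoidHom * (MonoidHom.id _)⁻¹)
    (hcomap : (toPrincipalIdeal (integralClosure (Polynomial Fq) K) K).range ≤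
      Subgroup.comap δ (toPrincipalIdeal (integralClosure (Polynomial Fq) K) K).range)
    -- the Rédei matrix: off-diagonal entries are the Hasse symbols `{D_j/P_i}`
    (R : Matrix (Fin m) (Fin m) (ZMod p))
    (hRoff : ∀ i j, i ≠ j → ∃ c : Polynomial Fq,
      (P i) ∣ ((P j) ^ (e j) * c - Q j) ∧
      R i j = Algebra.trace (ZMod p) Fq (Algebra.trace Fq
        (Polynomial Fq ⧸ Ideal.span {P i})
        (Ideal.Quotient.mk (Ideal.span {P i}) c)))
    -- the diagonal is determined by `Σ_j R i j + {f/P_i} = 0`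
    (hRdiag : ∀ i, (∑ j, R i j) + Algebra.trace (ZMod p) Fq (Algebra.trace Fq
        (Polynomial Fq ⧸ Ideal.span {P i})
        (Ideal.Quotient.mk (Ideal.span {P i}) f)) = 0) :
    -- `λ₂ = m - rank R` (imaginary) resp. `λ₂ = m - 1 - rank R` (real)
    letI : CommGroup ((FractionalIdeal (integralClosure (Polynomial Fq) K)⁰ K)ˣ ⧸
        (toPrincipalIdeal (integralClosure (Polynomial Fq) K) K).range) :=
      QuotientGroup.Quotient.commGroup _
    ∀ (δbar : ((FractionalIdeal (integralClosure (Polynomial Fq) K)⁰ K)ˣ ⧸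
        (toPrincipalIdeal (integralClosure (Polynomial Fq) K) K).range) →*
      ((FractionalIdeal (integralClosure (Polynomial Fq) K)⁰ K)ˣ ⧸
        (toPrincipalIdeal (integralClosure (Polynomial Fq) K) K).range)),
      δbar = QuotientGroup.map _ _ δ hcomap →
      ∀ Clp C1 C2 : Subgroup ((FractionalIdeal (integralClosure (Polynomial Fq) K)⁰ K)ˣ ⧸
        (toPrincipalIdeal (integralClosure (Polynomial Fq) K) K).range),
        Clp = CommGroup.primaryComponent _ p →
        C1 = Subgroup.map δbar Clp →
        C2 = Subgroup.map δbar C1 →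
        ((f ≠ 0 → Nat.card (C1 ⧸ C2.subgroupOf C1) = p ^ (m - R.rank)) ∧
         (f = 0 → Nat.card (C1 ⧸ C2.subgroupOf C1) = p ^ (m - 1 - R.rank))) := by
  intro δbar hδbar Clp C1 C2 hClp hC1 hC2
  let 𝒟 : RedeiReichardt.ArtinSchreierData Fq p m :=
    { P := fun i ↦ ⟨P i, hPmonic i, hPirr i⟩
      injective := fun i j h ↦ hPinj (congrArg Subtype.val h)
      Q := Q
      e := e
      f := f
      coprime := hcop
      not_dvd := he
      degree_lt := hdegQ }
  have hDD : D = 𝒟.D := by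
    rw [hD]
    refine congrArg (· + _) (Finset.sum_congr rfl fun i _ ↦ ?_)
    exact congrArg _ (map_pow _ _ _).symm
  have hsym : ∀ i j, R i j = 𝒟.symbol j (algebraMap (Polynomial Fq) (RatFunc Fq) (𝒟.P i).1) := by
    intro i
    have hoff : ∀ j, i ≠ j →
        R i j = 𝒟.symbol j (algebraMap (Polynomial Fq) (RatFunc Fq) (𝒟.P i).1) := by
      intro j hij
      obtain ⟨c, hc, h⟩ := hRoff i j hij
      exact h.trans (𝒟.symbol_P_of_ne hij hc).symm
    intro j
    by_cases hij : i = j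
    · subst hij
      have h1 := (hRdiag i).trans (𝒟.sum_symbol_P i).symm
      have h2 := add_right_cancel h1
      rw [← Finset.add_sum_erase _ _ (Finset.mem_univ i),
        ← Finset.add_sum_erase _ _ (Finset.mem_univ i),
        Finset.sum_congr rfl fun j hj ↦ hoff j (Finset.ne_of_mem_erase hj).symm] at h2
      exact add_right_cancel h2
    · exact hoff j hij
  have : IsDedekindDomain (integralClosure (Polynomial Fq) K) :=
    integralClosure.isDedekindDomain (Polynomial Fq) (RatFunc Fq) K
  have : Module.Finite (Polynomial Fq) (integralClosure (Polynomial Fq) K) :=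
    IsIntegralClosure.finite (Polynomial Fq) (RatFunc Fq) K _
  have : FaithfulSMul (Polynomial Fq) K := by
    refine (faithfulSMul_iff_algebraMap_injective _ _).2 ?_
    rw [IsScalarTower.algebraMap_eq (Polynomial Fq) (RatFunc Fq) K]
    exact (algebraMap (RatFunc Fq) K).injective.comp (RatFunc.algebraMap_injective Fq)
  have : Module.IsTorsionFree (Polynomial Fq) (integralClosure (Polynomial Fq) K) := inferInstance
  have : CharP K p := charP_of_injective_algebraMap (algebraMap Fq K).injective p
  have : CharP (integralClosure (Polynomial Fq) K) p :=
    (algebraMap (integralClosure (Polynomial Fq) K) K).charP Subtype.val_injective p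
  have := RedeiReichardt.finite_quotient_range_toPrincipalIdeal Fq K
    (integralClosure (Polynomial Fq) K)
  subst hC2
  have hδ' : ∀ J, δbar (QuotientGroup.mk' _ J) = QuotientGroup.mk' _ (sigmaAct J * J⁻¹) := by
    intro J
    rw [hδbar]
    exact congrArg (QuotientGroup.mk' _) (DFunLike.congr_fun hδ J)
  clear hδbar hδ hcomap
  rw [hClp] at hC1
  exact @RedeiReichardt.ArtinSchreierData.card_quotient_eq Fq _ p m _ _ 𝒟 K _ _ _ _ _
    (integralClosure (Polynomial Fq) K) _ _ _ _ _ _ _ _ _ _ _ hf _ _ _ σ hσ hdeg α (hDD ▸ hα)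
    hadj sigmaAct hsigma _ _ _ (QuotientGroup.Quotient.commGroup _) _ (QuotientGroup.mk' _)
    (QuotientGroup.mk'_surjective _) (QuotientGroup.ker_mk' _) δbar hδ' R hsym C1 hC1
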